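/- arXiv:1112.4985 — 3 statements merged into one kernel-verified Lean document; each statement's English description precedes it below -/
import Mathlib

section
/- Let λ ∈ ℂ be such that e^λ belongs to the spectrum σ(S_1) of the translation S_1 and Re λ = α_0. Then there exist an integer k ∈ ℤ and a sequence (f_n)_{n∈ℕ} in E with ‖f_n‖_{p,ω} = 1 for all n, such that for every t ∈ ℝ, ‖S_t f_n − e^{(λ + 2πk i)t} f_n‖_{p,ω} → 0 as n → ∞. (Lemma 1) -/
open MeasureTheory Filter Complex Set
open scoped Real ENNReal Topology NNReal

noncomputable section

/-- The weighted measure `ω(x)^p dx` on `ℝ`, so that `L^p_ω(ℝ)` is `Lp ℂ p (wm p ω)`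
    with the norm `(∫ |f|^p ω^p)^{1/p}`. -/
def wm (p : ℝ) (ω : ℝ → ℝ) : Measure ℝ :=
  volume.withDensity fun x => ENNReal.ofReal (ω x ^ p)

/-- The Fourier–Laplace transform `φ̂(z) = ∫_ℝ φ(t) e^{-izt} dt`. -/
def fourierLaplace (φ : ℝ → ℂ) (z : ℂ) : ℂ :=
  ∫ t : ℝ, φ t * Complex.exp (-Complex.I * z * (t : ℂ))

lemma aux_local (ω : ℝ → ℝ) (hc : Continuous ω) (hpos : ∀ x, 0 < ω x)
    (hsub : ∀ t : ℝ, ∃ C : ℝ, ∀ x : ℝ, ω (x + t) / ω x ≤ C) (T : ℝ) :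
    ∃ K : ℝ, 0 < K ∧ ∀ s, |s| ≤ T → ∀ x, ω (x + s) ≤ K * ω x := by
  have h1 : ∃ k : ℕ, (interior {t : ℝ | ∀ x, ω (x + t) ≤ k * ω x}).Nonempty := by
    apply nonempty_interior_of_iUnion_of_closed
    · intro k
      simp only [Set.ofPred_forall]
      exact isClosed_iInter fun x => isClosed_le (by fun_prop) (by fun_prop)
    · rw [eq_univ_iff_forall]
      intro t
      obtain ⟨C, hC⟩ := hsub t
      obtain ⟨k, hk⟩ := exists_nat_ge C
      rw [mem_iUnion]
      refine ⟨k, fun x => ?_⟩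
      rw [← div_le_iff₀ (hpos x)]
      exact (hC x).trans hk
  obtain ⟨k, a, ha⟩ := h1
  rw [mem_interior_iff_mem_nhds, Metric.mem_nhds_iff] at ha
  obtain ⟨r, hr, hball⟩ := ha
  obtain ⟨C, hC⟩ := hsub (-a)
  -- small shifts
  have hsmall : ∀ s, |s| < r → ∀ x, ω (x + s) ≤ (k * C) * ω x := by
    intro s hs x
    have h := hball (show a + s ∈ Metric.ball a r by simpa [Real.dist_eq] using hs) (x + -a)
    have h2 := (div_le_iff₀ (hpos x)).1 (hC x)
    have : x + -a + (a + s) = x + s := by ring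
    rw [this] at h
    calc _ ≤ k * ω (x + -a) := h
      _ ≤ k * (C * ω x) := by gcongr
      _ = _ := by ring
  have hKpos : 0 < k * C := by
    have := hsmall 0 (by simpa using hr) 0
    have h0 := hpos (0 + 0)
    have := h0.trans_le this
    exact pos_of_mul_pos_left this (hpos 0).le
  obtain ⟨m, hm⟩ := exists_nat_gt (|T| / r)
  have hm0 : (0 : ℝ) < m := lt_of_le_of_lt (by positivity) hm
  refine ⟨(k * C) ^ m, by positivity, fun s hs x => ?_⟩
  have hsm : |s / m| < r := by
    rw [abs_div, abs_of_pos hm0, div_lt_iff₀ hm0]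
    rw [div_lt_iff₀ hr] at hm
    calc |s| ≤ |T| := hs.trans (le_abs_self T)
      _ < _ := by linarith
  have : ∀ j : ℕ, ω (x + j * (s / m)) ≤ (k * C) ^ j * ω x := by
    intro j
    induction j with
    | zero => simp
    | succ j ih =>
      have := hsmall _ hsm (x + j * (s / m))
      have e : x + j * (s / m) + s / m = x + (j + 1 : ℕ) * (s / m) := by push_cast; ring
      rw [e] at this
      refine this.trans ?_
      rw [pow_succ']
      calc _ ≤ k * C * ((k * C) ^ j * ω x) := by gcongr
        _ = _ := by ring
  have := this m
  rwa [mul_div_cancel₀ _ hm0.ne'] at this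

lemma aux_norm (p : ℝ≥0∞) [Fact (1 ≤ p)] (hp : p ≠ ∞) (ω : ℝ → ℝ) (hc : Continuous ω)
    (hpos : ∀ x, 0 < ω x) (g : ℝ → ℂ) :
    eLpNorm g p (wm p.toReal ω) =
      (∫⁻ x, (‖g x‖ₑ * ENNReal.ofReal (ω x)) ^ p.toReal) ^ (1 / p.toReal) := by
  have h1 : (1 : ℝ≥0∞) ≤ p := Fact.out
  rw [eLpNorm_eq_lintegral_rpow_enorm_toReal (by positivity) hp, wm,
    lintegral_withDensity_eq_lintegral_mul_non_measurable]
  · congr 1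
    apply lintegral_congr
    intro x
    simp only [Pi.mul_apply]
    rw [ENNReal.mul_rpow_of_nonneg _ _ ENNReal.toReal_nonneg,
      ENNReal.ofReal_rpow_of_pos (hpos x), mul_comm]
  · have : Continuous fun x => ω x ^ p.toReal :=
      hc.rpow_const fun x => Or.inl (hpos x).ne'
    exact this.measurable.ennreal_ofReal
  · simp

lemma aux_ae (q : ℝ) (ω : ℝ → ℝ) (hc : Continuous ω) (hpos : ∀ x, 0 < ω x)
    (t : ℝ) (f g : ℝ → ℂ) (h : f =ᵐ[wm q ω] g) :
    (fun x => f (x - t)) =ᵐ[wm q ω] fun x => g (x - t) := by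
  have hcont : Continuous fun x => ω x ^ q :=
      hc.rpow_const fun x => Or.inl (hpos x).ne'
  have h1 : (volume : Measure ℝ) ≪ wm q ω := by
    apply withDensity_absolutelyContinuous' hcont.measurable.ennreal_ofReal.aemeasurable
    refine Eventually.of_forall fun x => ?_
    simp [Real.rpow_pos_of_pos (hpos x)]
  have h2 : wm q ω ≪ (volume : Measure ℝ) := withDensity_absolutelyContinuous _ _
  have h3 := h1.ae_le h
  exact h2.ae_le ((measurePreserving_sub_right volume t).quasiMeasurePreserving.ae h3)

lemma aux_S (p : ℝ≥0∞) [Fact (1 ≤ p)] (ω : ℝ → ℝ) (hc : Continuous ω)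
    (hpos : ∀ x, 0 < ω x)
    (S : ℝ → (Lp ℂ p (wm p.toReal ω) →L[ℂ] Lp ℂ p (wm p.toReal ω)))
    (hS : ∀ (t : ℝ) (f : Lp ℂ p (wm p.toReal ω)),
      (S t f : ℝ → ℂ) =ᵐ[wm p.toReal ω] fun x => f (x - t))
    (t : ℝ) (G : ℝ → ℂ) (hG : MemLp G p (wm p.toReal ω)) :
    (S t (hG.toLp G) : ℝ → ℂ) =ᵐ[wm p.toReal ω] fun x => G (x - t) :=
  (hS t _).trans (aux_ae _ ω hc hpos t _ _ hG.coeFn_toLp)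

lemma aux_upper (p : ℝ≥0∞) [Fact (1 ≤ p)] (hp : p ≠ ∞) (ω : ℝ → ℝ) (hc : Continuous ω)
    (hpos : ∀ x, 0 < ω x)
    (S : ℝ → (Lp ℂ p (wm p.toReal ω) →L[ℂ] Lp ℂ p (wm p.toReal ω)))
    (hS : ∀ (t : ℝ) (f : Lp ℂ p (wm p.toReal ω)),
      (S t f : ℝ → ℂ) =ᵐ[wm p.toReal ω] fun x => f (x - t))
    (t B : ℝ) (hB : 0 ≤ B) (h : ∀ x, ω (x + t) ≤ B * ω x) : ‖S t‖ ≤ B := by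
  have h1 : (1 : ℝ≥0∞) ≤ p := Fact.out
  have hq : 0 < p.toReal := ENNReal.toReal_pos (by positivity) hp
  refine ContinuousLinearMap.opNorm_le_bound _ hB fun f => ?_
  have key : eLpNorm (S t f) p (wm p.toReal ω) ≤
      ENNReal.ofReal B * eLpNorm f p (wm p.toReal ω) := by
    rw [eLpNorm_congr_ae (hS t f), aux_norm p hp ω hc hpos, aux_norm p hp ω hc hpos]
    have e : ENNReal.ofReal B = (ENNReal.ofReal B ^ p.toReal) ^ (1 / p.toReal) := by
      rw [← ENNReal.rpow_mul, mul_one_div_cancel hq.ne', ENNReal.rpow_one]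
    rw [e, ← ENNReal.mul_rpow_of_nonneg _ _ (by positivity)]
    gcongr
    rw [← lintegral_const_mul' _ _ (by simp [hq.le]),
      ← lintegral_add_right_eq_self _ t]
    apply lintegral_mono
    intro x
    simp only [add_sub_cancel_right]
    rw [← ENNReal.mul_rpow_of_nonneg _ _ hq.le]
    refine ENNReal.rpow_le_rpow ?_ hq.le
    rw [mul_left_comm, ← ENNReal.ofReal_mul hB]
    gcongr
    exact h x
  rw [Lp.norm_def, Lp.norm_def]
  have := ENNReal.toReal_mono (ENNReal.mul_ne_top (by simp) (Lp.eLpNorm_ne_top f)) key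
  rwa [ENNReal.toReal_mul, ENNReal.toReal_ofReal hB] at this

lemma aux_lower (p : ℝ≥0∞) [Fact (1 ≤ p)] (hp : p ≠ ∞) (ω : ℝ → ℝ) (hc : Continuous ω)
    (hpos : ∀ x, 0 < ω x)
    (S : ℝ → (Lp ℂ p (wm p.toReal ω) →L[ℂ] Lp ℂ p (wm p.toReal ω)))
    (hS : ∀ (t : ℝ) (f : Lp ℂ p (wm p.toReal ω)),
      (S t f : ℝ → ℂ) =ᵐ[wm p.toReal ω] fun x => f (x - t))
    (K : ℝ) (hK : 0 < K) (hloc : ∀ s, |s| ≤ 1 → ∀ x, ω (x + s) ≤ K * ω x) (t x : ℝ) :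
    ω (x + t) ≤ K ^ 2 * ‖S t‖ * ω x := by
  have h1 : (1 : ℝ≥0∞) ≤ p := Fact.out
  have hq : 0 < p.toReal := ENNReal.toReal_pos (by positivity) hp
  have hν : ∀ a, wm p.toReal ω (Icc a (a + 1)) =
      ∫⁻ x in Icc a (a + 1), ENNReal.ofReal (ω x ^ p.toReal) := fun a =>
    withDensity_apply _ measurableSet_Icc
  have hup : ∀ a, wm p.toReal ω (Icc a (a + 1)) ≤ ENNReal.ofReal (K * ω a) ^ p.toReal := by
    intro a
    rw [hν]
    calc _ ≤ ∫⁻ x in Icc a (a + 1), ENNReal.ofReal (K * ω a) ^ p.toReal := by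
          refine setLIntegral_mono' measurableSet_Icc fun x hx => ?_
          rw [← ENNReal.ofReal_rpow_of_pos (hpos x)]
          gcongr
          have := hloc (x - a) (by rw [abs_le]; constructor <;> linarith [hx.1, hx.2]) a
          simpa using this
      _ = _ := by simp
  have hlo : ∀ a, ENNReal.ofReal (ω a / K) ^ p.toReal ≤ wm p.toReal ω (Icc a (a + 1)) := by
    intro a
    rw [hν]
    calc _ = ∫⁻ x in Icc a (a + 1), ENNReal.ofReal (ω a / K) ^ p.toReal := by simp
      _ ≤ _ := by
          refine setLIntegral_mono' measurableSet_Icc fun x hx => ?_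
          rw [← ENNReal.ofReal_rpow_of_pos (hpos x)]
          gcongr
          have := hloc (a - x) (by rw [abs_le]; constructor <;> linarith [hx.1, hx.2]) x
          rw [div_le_iff₀ hK, mul_comm]
          simpa using this
  let G : ℝ → ℂ := indicator (Icc x (x + 1)) fun _ => 1
  have hfin : (wm p.toReal ω) (Icc x (x + 1)) ≠ ∞ :=
    ((hup x).trans_lt (ENNReal.rpow_lt_top_of_nonneg hq.le (by simp))).ne
  have hG : MemLp G p (wm p.toReal ω) := memLp_indicator_const p measurableSet_Icc 1 (Or.inr hfin)
  have hn1 : eLpNorm G p (wm p.toReal ω) ≤ ENNReal.ofReal (K * ω x) := by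
    rw [eLpNorm_indicator_const measurableSet_Icc (by positivity) hp]
    calc _ ≤ ‖(1 : ℂ)‖ₑ * (ENNReal.ofReal (K * ω x) ^ p.toReal) ^ (1 / p.toReal) := by
          gcongr
          exact hup x
      _ = _ := by rw [← ENNReal.rpow_mul, mul_one_div_cancel hq.ne']; simp
  have hn2 : ENNReal.ofReal (ω (x + t) / K) ≤ eLpNorm (S t (hG.toLp G)) p (wm p.toReal ω) := by
    rw [eLpNorm_congr_ae (aux_S p ω hc hpos S hS t G hG)]
    have : (fun y => G (y - t)) = indicator (Icc (x + t) (x + t + 1)) fun _ => (1 : ℂ) := by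
      ext y
      simp only [G, indicator_apply, mem_Icc]
      congr 1
      rw [eq_iff_iff]
      constructor <;> rintro ⟨h1, h2⟩ <;> constructor <;> linarith
    rw [this, eLpNorm_indicator_const measurableSet_Icc (by positivity) hp]
    calc _ = ‖(1 : ℂ)‖ₑ * (ENNReal.ofReal (ω (x + t) / K) ^ p.toReal) ^ (1 / p.toReal) := by
          rw [← ENNReal.rpow_mul, mul_one_div_cancel hq.ne']; simp
      _ ≤ _ := by
          gcongr
          exact hlo _
  have hb := (S t).le_opNorm (hG.toLp G)
  rw [Lp.norm_toLp, Lp.norm_def] at hb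
  have h3 := ENNReal.toReal_mono (Lp.eLpNorm_ne_top _) hn2
  have h4 := ENNReal.toReal_mono (by simp) hn1
  have := hpos x
  have := hpos (x + t)
  rw [ENNReal.toReal_ofReal (by positivity)] at h3 h4
  have h5 : ω (x + t) / K ≤ ‖S t‖ * (K * ω x) :=
    h3.trans (hb.trans (by gcongr))
  rw [div_le_iff₀ hK] at h5
  calc _ ≤ _ := h5
    _ = _ := by ring

/-- the density `(e^{-ax} ω(x))^q` -/
def Uf (q : ℝ) (ω : ℝ → ℝ) (a x : ℝ) : ℝ := (Real.exp (-(a * x)) * ω x) ^ q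

lemma Uf_pos (q : ℝ) (ω : ℝ → ℝ) (hpos : ∀ x, 0 < ω x) (a x : ℝ) : 0 < Uf q ω a x :=
  Real.rpow_pos_of_pos (mul_pos (Real.exp_pos _) (hpos x)) _

lemma Uf_cont (q : ℝ) (ω : ℝ → ℝ) (hc : Continuous ω) (hpos : ∀ x, 0 < ω x) (a : ℝ) :
    Continuous (Uf q ω a) := by
  have : Continuous fun x => Real.exp (-(a * x)) * ω x := by fun_prop
  exact this.rpow_const fun x => Or.inl (mul_pos (Real.exp_pos _) (hpos x)).ne'

lemma Uf_loc (q : ℝ) (hq : 0 < q) (ω : ℝ → ℝ) (hpos : ∀ x, 0 < ω x) (A T K : ℝ) (hK : 0 < K)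
    (hloc : ∀ s, |s| ≤ T → ∀ x, ω (x + s) ≤ K * ω x) (a : ℝ) (ha : |a| ≤ A) (s : ℝ)
    (hs : |s| ≤ T) (x : ℝ) :
    Uf q ω a (x + s) ≤ (Real.exp (A * T) * K) ^ q * Uf q ω a x := by
  have h1 := hpos x
  have h2 := hpos (x + s)
  unfold Uf
  rw [← Real.mul_rpow (by positivity) (by positivity)]
  refine Real.rpow_le_rpow (by positivity) ?_ hq.le
  have e : Real.exp (-(a * (x + s))) ≤ Real.exp (A * T) * Real.exp (-(a * x)) := by
    rw [← Real.exp_add, Real.exp_le_exp]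
    have : |a * s| ≤ A * T := by
      rw [abs_mul]
      exact mul_le_mul ha hs (abs_nonneg _) ((abs_nonneg _).trans ha)
    nlinarith [neg_abs_le (a * s)]
  calc _ ≤ (Real.exp (A * T) * Real.exp (-(a * x))) * (K * ω x) := by
        gcongr
        exact hloc s hs x
    _ = _ := by ring

lemma aux_int (p : ℝ≥0∞) [Fact (1 ≤ p)] (hp : p ≠ ∞) (ω : ℝ → ℝ) (hc : Continuous ω)
    (hpos : ∀ x, 0 < ω x)
    (S : ℝ → (Lp ℂ p (wm p.toReal ω) →L[ℂ] Lp ℂ p (wm p.toReal ω)))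
    (K : ℝ) (hlow : ∀ t x, ω (x + t) ≤ K ^ 2 * ‖S t‖ * ω x)
    (α0 : ℝ) (hα0 : Tendsto (fun t : ℝ => Real.log ‖S t‖ / t) atTop (𝓝 α0))
    (a : ℝ) (ha : α0 < a) (y : ℝ) : IntegrableOn (Uf p.toReal ω a) (Ioi y) := by
  have h1 : (1 : ℝ≥0∞) ≤ p := Fact.out
  have hq : 0 < p.toReal := ENNReal.toReal_pos (by positivity) hp
  refine integrable_of_isBigO_exp_neg (b := p.toReal * ((a - α0) / 2))
    (by have := sub_pos.2 ha; positivity) (Uf_cont p.toReal ω hc hpos a).continuousOn ?_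
  refine Asymptotics.IsBigO.of_bound ((K ^ 2 * ω 0) ^ p.toReal) ?_
  have hev := hα0.eventually_lt_const (show α0 < α0 + (a - α0) / 2 by linarith)
  filter_upwards [hev, eventually_gt_atTop 0] with t ht ht0
  rw [div_lt_iff₀ ht0] at ht
  have h2 : ‖S t‖ ≤ Real.exp ((α0 + (a - α0) / 2) * t) :=
    (Real.le_exp_log _).trans (Real.exp_le_exp.2 ht.le)
  have h3 := hlow t 0
  rw [zero_add] at h3
  have hw := hpos 0
  have hw2 := hpos t
  rw [Real.norm_of_nonneg (Uf_pos p.toReal ω hpos a t).le, Real.norm_of_nonneg (Real.exp_pos _).le]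
  have e : Real.exp (-(p.toReal * ((a - α0) / 2)) * t) = (Real.exp (-((a - α0) / 2 * t))) ^ p.toReal := by
    rw [← Real.exp_mul]; congr 1; ring
  rw [e, ← Real.mul_rpow (by positivity) (by positivity), Uf]
  refine Real.rpow_le_rpow (by positivity) ?_ hq.le
  calc _ ≤ Real.exp (-(a * t)) * (K ^ 2 * Real.exp ((α0 + (a - α0) / 2) * t) * ω 0) := by
        gcongr
        exact h3.trans (by gcongr)
    _ = K ^ 2 * ω 0 * (Real.exp (-(a * t)) * Real.exp ((α0 + (a - α0) / 2) * t)) := by ring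
    _ = _ := by rw [← Real.exp_add]; congr 2; ring

lemma aux_select (p : ℝ≥0∞) [Fact (1 ≤ p)] (hp : p ≠ ∞) (ω : ℝ → ℝ) (hc : Continuous ω)
    (hpos : ∀ x, 0 < ω x)
    (S : ℝ → (Lp ℂ p (wm p.toReal ω) →L[ℂ] Lp ℂ p (wm p.toReal ω)))
    (hS : ∀ (t : ℝ) (f : Lp ℂ p (wm p.toReal ω)),
      (S t f : ℝ → ℂ) =ᵐ[wm p.toReal ω] fun x => f (x - t))
    (K : ℝ) (hK : 0 < K) (hloc : ∀ s, |s| ≤ 1 → ∀ x, ω (x + s) ≤ K * ω x)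
    (α0 : ℝ) (hα0 : Tendsto (fun t : ℝ => Real.log ‖S t‖ / t) atTop (𝓝 α0))
    (n μ0 : ℝ) (hn : 0 < n) (hμ0 : 0 < μ0) (hμ1 : μ0 ≤ 1) :
    ∃ μ y : ℝ, 0 < μ ∧ μ ≤ μ0 ∧
      n * Uf p.toReal ω (α0 + μ) y ≤ ∫ x in Ioi y, Uf p.toReal ω (α0 + μ) x := by
  have h1 : (1 : ℝ≥0∞) ≤ p := Fact.out
  have hq : 0 < p.toReal := ENNReal.toReal_pos (by positivity) hp
  have hlow := aux_lower p hp ω hc hpos S hS K hK hloc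
  by_contra! hcon
  set D : ℝ := (Real.exp ((|α0| + 1) * 1) * K) ^ p.toReal with hD
  have hDpos : 0 < D := by positivity
  set κ : ℝ := 1 / (n * D) with hκ
  have hκpos : 0 < κ := by positivity
  set μ : ℝ := min μ0 (κ / (2 * p.toReal)) with hμ
  have hμpos : 0 < μ := lt_min hμ0 (by positivity)
  have hμle : μ ≤ κ / (2 * p.toReal) := min_le_right _ _
  have hμ1' : μ ≤ 1 := (min_le_left _ _).trans hμ1
  have hcon' := fun y => hcon μ y hμpos (min_le_left _ _)
  set a := α0 + μ with ha
  have haA : |a| ≤ |α0| + 1 := by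
    refine (abs_add_le _ _).trans ?_
    rw [abs_of_pos hμpos]; linarith
  set U := Uf p.toReal ω a with hU
  have hUpos : ∀ x, 0 < U x := Uf_pos p.toReal ω hpos a
  have hUloc : ∀ s, |s| ≤ 1 → ∀ x, U (x + s) ≤ D * U x := fun s hs x =>
    Uf_loc p.toReal hq ω hpos _ 1 K hK hloc a haA s hs x
  have hint : ∀ y, IntegrableOn U (Ioi y) := fun y =>
    aux_int p hp ω hc hpos S K hlow α0 hα0 a (by linarith) y
  set J : ℝ → ℝ := fun y => ∫ x in Ioi y, U x with hJ
  have hJnn : ∀ y, 0 ≤ J y := fun y => setIntegral_nonneg measurableSet_Ioi fun x _ => (hUpos x).le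
  have hsplit : ∀ y, J y = (∫ x in Ioc y (y + 1), U x) + J (y + 1) := by
    intro y
    simp only [hJ]
    rw [← setIntegral_union (by
        rw [Set.disjoint_left]; intro x hx hx2; exact absurd hx.2 (not_le.2 hx2))
        measurableSet_Ioi ((hint y).mono_set Ioc_subset_Ioi_self) (hint _),
      Ioc_union_Ioi_eq_Ioi (by linarith)]
  have hUI : ∀ y, U y ≤ D * ∫ x in Ioc y (y + 1), U x := by
    intro y
    have : ∫ x in Ioc y (y + 1), U y / D ≤ ∫ x in Ioc y (y + 1), U x := by
      refine setIntegral_mono_on (by simp) ((hint y).mono_set Ioc_subset_Ioi_self)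
        measurableSet_Ioc fun x hx => ?_
      have := hUloc (y - x) (by rw [abs_le]; constructor <;> linarith [hx.1, hx.2]) x
      rw [div_le_iff₀ hDpos, mul_comm]
      simpa using this
    simp at this
    rw [div_le_iff₀ hDpos] at this
    linarith
  have hstep : ∀ y, J (y + 1) ≤ Real.exp (-κ) * J y := by
    intro y
    have e1 := hsplit y
    have e2 := hUI y
    have e3 : J y < n * U y := hcon' y
    have e4 : J y ≤ (n * D) * (J y - J (y + 1)) := by
      calc J y ≤ n * U y := e3.le
        _ ≤ n * (D * ∫ x in Ioc y (y + 1), U x) := by gcongr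
        _ = _ := by rw [e1]; ring
    have e5 : κ * J y ≤ J y - J (y + 1) := by
      rw [hκ, one_div_mul_eq_div, div_le_iff₀ (by positivity)]
      linarith
    have e6 := mul_le_mul_of_nonneg_right (Real.add_one_le_exp (-κ)) (hJnn y)
    linarith
  have hiter : ∀ (j : ℕ) y, J (y + j) ≤ Real.exp (-κ * j) * J y := by
    intro j y
    induction j with
    | zero => simp
    | succ j ih =>
      have := hstep (y + j)
      rw [add_assoc] at this
      push_cast
      refine this.trans ?_
      calc _ ≤ Real.exp (-κ) * (Real.exp (-κ * j) * J y) := by gcongr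
        _ = _ := by rw [← mul_assoc, ← Real.exp_add]; congr 2; ring
  have hUj : ∀ (j : ℕ) y, U (y + j) ≤ (D * n) * Real.exp (-κ * j) * U y := by
    intro j y
    have e1 := hUI (y + j)
    have e2 := hsplit (y + j)
    have e3 := hJnn (y + j + 1)
    have e4 : J y ≤ n * U y := (hcon' y).le
    calc U (y + j) ≤ D * J (y + j) := e1.trans (by gcongr; linarith)
      _ ≤ D * (Real.exp (-κ * j) * (n * U y)) := by
        gcongr
        exact (hiter j y).trans (by gcongr)
      _ = _ := by ring
  have hω : ∀ (j : ℕ) y, ω (y + j) ≤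
      ((D * n) ^ (1 / p.toReal) * Real.exp ((a - κ / p.toReal) * j)) * ω y := by
    intro j y
    have := hpos y
    have := hpos (y + j)
    have h2 := Real.rpow_le_rpow (hUpos _).le (hUj j y) (show 0 ≤ 1 / p.toReal by positivity)
    simp only [hU, Uf] at h2
    rw [← Real.rpow_mul (by positivity), mul_one_div_cancel hq.ne', Real.rpow_one,
      Real.mul_rpow (x := D * n * Real.exp (-κ * j)) (by positivity) (by positivity),
      Real.mul_rpow (x := D * n) (y := Real.exp (-κ * j)) (by positivity) (by positivity),
      ← Real.rpow_mul (x := Real.exp (-(a * y)) * ω y) (by positivity), mul_one_div_cancel hq.ne',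
      Real.rpow_one, ← Real.exp_mul] at h2
    have h3 := mul_le_mul_of_nonneg_left h2 (Real.exp_pos (a * (y + j))).le
    rw [← mul_assoc, ← Real.exp_add, add_neg_cancel, Real.exp_zero, one_mul] at h3
    refine h3.trans (le_of_eq ?_)
    have : Real.exp ((a - κ / p.toReal) * j) =
      Real.exp (a * (y + j)) * Real.exp (-κ * j * (1 / p.toReal)) * Real.exp (-(a * y)) := by
      rw [← Real.exp_add, ← Real.exp_add]; congr 1; ring
    rw [this]; ring
  have hSj : ∀ j : ℕ, ‖S j‖ ≤ (D * n) ^ (1 / p.toReal) * Real.exp ((a - κ / p.toReal) * j) := fun j =>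
    aux_upper p hp ω hc hpos S hS j _ (by positivity) (hω j)
  have hSpos : ∀ t, 0 < ‖S t‖ := by
    intro t
    by_contra! h
    have h0 : ‖S t‖ = 0 := le_antisymm h (norm_nonneg _)
    have := hlow t 0
    rw [h0] at this
    have := hpos (0 + t)
    linarith
  have hlim := hα0.comp tendsto_natCast_atTop_atTop
  have hlim2 : Tendsto (fun j : ℕ => Real.log ((D * n) ^ (1 / p.toReal)) / (j : ℝ) + (a - κ / p.toReal)) atTop
      (𝓝 (0 + (a - κ / p.toReal))) :=
    (tendsto_const_div_atTop_nhds_zero_nat _).add tendsto_const_nhds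
  have hfinal : α0 ≤ 0 + (a - κ / p.toReal) := by
    refine le_of_tendsto_of_tendsto hlim hlim2 ?_
    filter_upwards [eventually_gt_atTop 0] with j hj
    have hj' : (0 : ℝ) < j := by exact_mod_cast hj
    simp only [Function.comp]
    rw [div_le_iff₀ hj', add_mul, div_mul_cancel₀ _ hj'.ne']
    refine (Real.log_le_log (hSpos _) (hSj j)).trans ?_
    rw [Real.log_mul (by positivity) (by positivity), Real.log_exp]
  have : κ / (2 * p.toReal) = κ / p.toReal / 2 := by field_simp
  have h5 : 0 < κ / p.toReal := by positivity
  linarith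

/-- test functions `1_s e^{-zx}` -/
def Ff (z : ℂ) (s : Set ℝ) : ℝ → ℂ := s.indicator fun x => Complex.exp (-(z * x))

lemma Ff_norm (p : ℝ≥0∞) [Fact (1 ≤ p)] (hp : p ≠ ∞) (ω : ℝ → ℝ) (hc : Continuous ω)
    (hpos : ∀ x, 0 < ω x) (z : ℂ) (s : Set ℝ) (hs : MeasurableSet s)
    (hint : IntegrableOn (Uf p.toReal ω z.re) s) :
    eLpNorm (Ff z s) p (wm p.toReal ω) =
      ENNReal.ofReal ((∫ x in s, Uf p.toReal ω z.re x) ^ (1 / p.toReal)) := by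
  have h1 : (1 : ℝ≥0∞) ≤ p := Fact.out
  have hq : 0 < p.toReal := ENNReal.toReal_pos (by positivity) hp
  rw [aux_norm p hp ω hc hpos, ← ENNReal.ofReal_rpow_of_nonneg
    (setIntegral_nonneg hs fun x _ => (Uf_pos _ ω hpos _ x).le) (by positivity),
    ofReal_integral_eq_lintegral_ofReal hint
      (Eventually.of_forall fun x => (Uf_pos _ ω hpos _ x).le), ← lintegral_indicator hs]
  congr 1
  apply lintegral_congr
  intro x
  by_cases hx : x ∈ s
  · have := hpos x
    simp only [Ff, indicator_of_mem hx, Uf]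
    rw [← ENNReal.ofReal_rpow_of_pos (by positivity), ENNReal.ofReal_mul (by positivity),
      ← ofReal_norm, Complex.norm_exp]
    simp
  · simp [Ff, indicator_of_notMem hx, hq]

lemma Ff_meas (z : ℂ) (s : Set ℝ) (hs : MeasurableSet s) (ν : Measure ℝ) :
    AEStronglyMeasurable (Ff z s) ν := by
  have : Continuous fun x : ℝ => Complex.exp (-(z * x)) := by fun_prop
  exact (this.measurable.indicator hs).aestronglyMeasurable

lemma aux_est (p : ℝ≥0∞) [Fact (1 ≤ p)] (hp : p ≠ ∞) (ω : ℝ → ℝ) (hc : Continuous ω)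
    (hpos : ∀ x, 0 < ω x)
    (S : ℝ → (Lp ℂ p (wm p.toReal ω) →L[ℂ] Lp ℂ p (wm p.toReal ω)))
    (hS : ∀ (t : ℝ) (f : Lp ℂ p (wm p.toReal ω)),
      (S t f : ℝ → ℂ) =ᵐ[wm p.toReal ω] fun x => f (x - t))
    (z c : ℂ) (y : ℝ) (hF : MemLp (Ff z (Ioi y)) p (wm p.toReal ω)) (t : ℝ) :
    ‖S t (hF.toLp _) - c • hF.toLp _‖ ≤ ‖Complex.exp (z * t) - c‖ * ‖hF.toLp _‖ +
      Real.exp (z.re * t) * (∫ x in Icc (y - |t|) (y + |t|), Uf p.toReal ω z.re x) ^ (1 / p.toReal) := by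
  have h1 : (1 : ℝ≥0∞) ≤ p := Fact.out
  set F := Ff z (Ioi y) with hFdef
  set H : ℝ → ℂ := fun x => Complex.exp (-(z * t)) * F (x - t) - F x with hH
  have hFt : AEStronglyMeasurable (fun x => F (x - t)) (wm p.toReal ω) := by
    have : Continuous fun x : ℝ => Complex.exp (-(z * x)) := by fun_prop
    have := (this.measurable.indicator (measurableSet_Ioi (a := y)))
    exact (this.comp (measurable_sub_const t)).aestronglyMeasurable
  have hHm : AEStronglyMeasurable H (wm p.toReal ω) :=
    (hFt.const_mul _).sub hF.1
  have hae : (S t (hF.toLp F) - c • hF.toLp F : Lp ℂ p (wm p.toReal ω)) =ᵐ[wm p.toReal ω]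
      (Complex.exp (z * t) - c) • F + Complex.exp (z * t) • H := by
    filter_upwards [Lp.coeFn_sub (S t (hF.toLp F)) (c • hF.toLp F), Lp.coeFn_smul c (hF.toLp F),
      hF.coeFn_toLp, aux_S p ω hc hpos S hS t F hF] with x e1 e2 e3 e4
    rw [e1, Pi.sub_apply, e2, Pi.smul_apply, e3, e4]
    simp only [Pi.add_apply, Pi.smul_apply, smul_eq_mul, hH]
    have : Complex.exp (z * t) * Complex.exp (-(z * t)) = 1 := by
      rw [← Complex.exp_add]; simp
    linear_combination (-F (x - t)) * this
  have hIint : IntegrableOn (Uf p.toReal ω z.re) (Icc (y - |t|) (y + |t|)) :=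
    (Uf_cont _ ω hc hpos _).continuousOn.integrableOn_Icc
  have hHn : eLpNorm H p (wm p.toReal ω) ≤ ENNReal.ofReal
      ((∫ x in Icc (y - |t|) (y + |t|), Uf p.toReal ω z.re x) ^ (1 / p.toReal)) := by
    rw [← Ff_norm p hp ω hc hpos z _ measurableSet_Icc hIint]
    refine eLpNorm_mono fun x => ?_
    have e : Complex.exp (-(z * t)) * Complex.exp (-(z * (x - t : ℝ))) = Complex.exp (-(z * x)) := by
      rw [← Complex.exp_add]; congr 1; push_cast; ring
    have hb1 := neg_abs_le t
    have hb2 := le_abs_self t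
    simp only [hH, hFdef, Ff, indicator_apply, mem_Ioi, mem_Icc]
    by_cases ha : y < x - t <;> by_cases hb : y < x
    · simp only [ha, hb, if_true, e]; simp
    · have : y - |t| ≤ x ∧ x ≤ y + |t| := by constructor <;> linarith
      simp only [ha, hb, this, if_true, if_false, e]; simp
    · have : y - |t| ≤ x ∧ x ≤ y + |t| := by constructor <;> linarith
      simp only [ha, hb, this, if_true, if_false]; simp
    · simp only [ha, hb, if_false]; simp
  have hIn : 0 ≤ ∫ x in Icc (y - |t|) (y + |t|), Uf p.toReal ω z.re x :=
    setIntegral_nonneg measurableSet_Icc fun x _ => (Uf_pos _ ω hpos _ x).le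
  have key : eLpNorm (S t (hF.toLp F) - c • hF.toLp F : Lp ℂ p (wm p.toReal ω)) p (wm p.toReal ω) ≤
      ENNReal.ofReal (‖Complex.exp (z * t) - c‖ * ‖hF.toLp F‖ +
      Real.exp (z.re * t) * (∫ x in Icc (y - |t|) (y + |t|), Uf p.toReal ω z.re x) ^ (1 / p.toReal)) := by
    rw [eLpNorm_congr_ae hae]
    refine (eLpNorm_add_le (hF.1.const_smul _) (hHm.const_smul _) h1).trans ?_
    rw [eLpNorm_const_smul, eLpNorm_const_smul, ENNReal.ofReal_add (by positivity) (by positivity),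
      ENNReal.ofReal_mul (by positivity), ENNReal.ofReal_mul (by positivity), Lp.norm_toLp,
      ENNReal.ofReal_toReal hF.2.ne, ofReal_norm]
    have : ‖Complex.exp (z * t)‖ₑ = ENNReal.ofReal (Real.exp (z.re * t)) := by
      rw [← ofReal_norm, Complex.norm_exp]; simp
    rw [this]
    gcongr
  rw [Lp.norm_def]
  exact ENNReal.toReal_le_of_le_ofReal (by positivity) key

theorem lemma1
    (p : ℝ≥0∞) [Fact (1 ≤ p)] (hp : p ≠ ∞)
    (ω : ℝ → ℝ) (hω_cont : Continuous ω) (hω_pos : ∀ x, 0 < ω x)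
    (hω_sub : ∀ t : ℝ, ∃ C : ℝ, ∀ x : ℝ, ω (x + t) / ω x ≤ C)
    -- `S t` is the translation by `t` on `E = L^p_ω(ℝ)`
    (S : ℝ → (Lp ℂ p (wm p.toReal ω) →L[ℂ] Lp ℂ p (wm p.toReal ω)))
    (hS : ∀ (t : ℝ) (f : Lp ℂ p (wm p.toReal ω)),
      (S t f : ℝ → ℂ) =ᵐ[wm p.toReal ω] fun x => f (x - t))
    -- `α₀ = lim_{t→∞} (1/t) log ‖S_t‖`
    (α0 : ℝ) (hα0 : Tendsto (fun t : ℝ => Real.log ‖S t‖ / t) atTop (𝓝 α0))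
    (lam : ℂ) (hlam : Complex.exp lam ∈ spectrum ℂ (S 1)) (hre : lam.re = α0) :
    ∃ (k : ℤ) (f : ℕ → Lp ℂ p (wm p.toReal ω)),
      (∀ n, ‖f n‖ = 1) ∧
      ∀ t : ℝ, Tendsto
        (fun n => ‖S t (f n) -
          Complex.exp ((lam + 2 * Real.pi * (k : ℂ) * Complex.I) * (t : ℂ)) • f n‖)
        atTop (𝓝 0) := by
  have h1 : (1 : ℝ≥0∞) ≤ p := Fact.out
  have hq : 0 < p.toReal := ENNReal.toReal_pos (by positivity) hp
  obtain ⟨K, hK, hloc⟩ := aux_local ω hω_cont hω_pos hω_sub 1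
  have hlow := aux_lower p hp ω hω_cont hω_pos S hS K hK hloc
  have hsel := fun n : ℕ => aux_select p hp ω hω_cont hω_pos S hS K hK hloc α0 hα0
    (n + 1) (1 / (n + 1)) (by positivity) (by positivity)
    (by rw [div_le_one (by positivity)]; linarith [Nat.cast_nonneg (α := ℝ) n])
  choose μ y hμpos hμle hJ using hsel
  have hzre : ∀ n, (lam + μ n).re = α0 + μ n := fun n => by simp [hre]
  have hint : ∀ n, IntegrableOn (Uf p.toReal ω (lam + μ n).re) (Ioi (y n)) := fun n => by
    rw [hzre]
    exact aux_int p hp ω hω_cont hω_pos S K hlow α0 hα0 _ (by linarith [hμpos n]) _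
  have hnorm := fun n => Ff_norm p hp ω hω_cont hω_pos (lam + μ n) _ measurableSet_Ioi (hint n)
  have hF : ∀ n, MemLp (Ff (lam + μ n) (Ioi (y n))) p (wm p.toReal ω) := fun n =>
    ⟨Ff_meas _ _ measurableSet_Ioi _, by rw [hnorm]; exact ENNReal.ofReal_lt_top⟩
  let J : ℕ → ℝ := fun n => ∫ x in Ioi (y n), Uf p.toReal ω (α0 + μ n) x
  have hUJ : ∀ n, Uf p.toReal ω (α0 + μ n) (y n) ≤ J n / (n + 1) := fun n => by
    rw [le_div_iff₀ (by positivity), mul_comm]; exact hJ n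
  have hJpos : ∀ n, 0 < J n := fun n =>
    lt_of_lt_of_le (mul_pos (by positivity) (Uf_pos _ ω hω_pos _ _)) (hJ n)
  let G : ℕ → Lp ℂ p (wm p.toReal ω) := fun n => (hF n).toLp _
  have hG : ∀ n, ‖G n‖ = (J n) ^ (1 / p.toReal) := fun n => by
    have := (hJpos n).le
    simp only [G]
    rw [Lp.norm_toLp, hnorm, hzre, ENNReal.toReal_ofReal (by positivity)]
  have hGpos : ∀ n, 0 < ‖G n‖ := fun n => by
    rw [hG]; exact Real.rpow_pos_of_pos (hJpos n) _
  refine ⟨0, fun n => ((‖G n‖⁻¹ : ℝ) : ℂ) • G n, fun n => ?_, fun t => ?_⟩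
  · rw [norm_smul, Complex.norm_real, norm_inv, norm_norm, inv_mul_cancel₀ (hGpos n).ne']
  obtain ⟨K', hK', hloc'⟩ := aux_local ω hω_cont hω_pos hω_sub |t|
  set D : ℝ := (Real.exp ((|α0| + 1) * |t|) * K') ^ p.toReal with hD
  have hDpos : 0 < D := by positivity
  have hμ1 : ∀ n, μ n ≤ 1 := fun n => (hμle n).trans
    (by rw [div_le_one (by positivity)]; linarith [Nat.cast_nonneg (α := ℝ) n])
  have hI : ∀ n, ∫ x in Icc (y n - |t|) (y n + |t|), Uf p.toReal ω (α0 + μ n) x ≤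
      (2 * |t| * D / (n + 1)) * J n := by
    intro n
    have haA : |α0 + μ n| ≤ |α0| + 1 := by
      refine (abs_add_le _ _).trans ?_
      rw [abs_of_pos (hμpos n)]; linarith [hμ1 n]
    calc _ ≤ ∫ x in Icc (y n - |t|) (y n + |t|), D * (J n / (n + 1)) := by
          refine setIntegral_mono_on (Uf_cont _ ω hω_cont hω_pos _).continuousOn.integrableOn_Icc
            (continuous_const.continuousOn.integrableOn_Icc) measurableSet_Icc fun x hx => ?_
          have := Uf_loc p.toReal hq ω hω_pos (|α0| + 1) |t| K' hK' hloc' _ haA (x - y n)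
            (by rw [abs_le]; constructor <;> linarith [hx.1, hx.2]) (y n)
          rw [add_sub_cancel] at this
          refine this.trans ?_
          gcongr
          exact hUJ n
      _ = _ := by
          have := abs_nonneg t
          rw [setIntegral_const, smul_eq_mul, Real.volume_real_Icc]
          rw [max_eq_left (by linarith)]
          ring
  have hbound : ∀ n, ‖S t (((‖G n‖⁻¹ : ℝ) : ℂ) • G n) -
      Complex.exp ((lam + 2 * Real.pi * ((0 : ℤ) : ℂ) * Complex.I) * (t : ℂ)) •
        (((‖G n‖⁻¹ : ℝ) : ℂ) • G n)‖ ≤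
      ‖Complex.exp ((lam + μ n) * t) - Complex.exp (lam * t)‖ +
        Real.exp ((α0 + μ n) * t) * (2 * |t| * D / (n + 1)) ^ (1 / p.toReal) := by
    intro n
    have e0 : (lam + 2 * Real.pi * ((0 : ℤ) : ℂ) * Complex.I) * (t : ℂ) = lam * t := by simp
    have est := aux_est p hp ω hω_cont hω_pos S hS (lam + μ n) (Complex.exp (lam * t)) (y n) (hF n) t
    rw [hzre] at est
    change ‖S t (G n) - _ • G n‖ ≤ _ * ‖G n‖ + _ at est
    rw [e0, map_smul, smul_comm, ← smul_sub, norm_smul, Complex.norm_real, norm_inv, norm_norm,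
      inv_mul_le_iff₀ (hGpos n)]
    refine est.trans ?_
    have hnn : 0 ≤ ∫ x in Icc (y n - |t|) (y n + |t|), Uf p.toReal ω (α0 + μ n) x :=
      setIntegral_nonneg measurableSet_Icc fun x _ => (Uf_pos _ ω hω_pos _ x).le
    have h3 := Real.rpow_le_rpow hnn (hI n) (show 0 ≤ 1 / p.toReal by positivity)
    rw [Real.mul_rpow (by positivity) (hJpos n).le, ← hG] at h3
    have h4 := mul_le_mul_of_nonneg_left h3 (Real.exp_pos ((α0 + μ n) * t)).le
    linarith
  have hμ0 : Tendsto μ atTop (𝓝 0) :=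
    squeeze_zero (fun n => (hμpos n).le) hμle tendsto_one_div_add_atTop_nhds_zero_nat
  refine squeeze_zero (fun n => norm_nonneg _) hbound ?_
  have hc1 : Continuous fun m : ℝ => ‖Complex.exp ((lam + m) * t) - Complex.exp (lam * t)‖ := by
    fun_prop
  have hc2 : Continuous fun m : ℝ => Real.exp ((α0 + m) * t) := by fun_prop
  have l1 := (hc1.tendsto 0).comp hμ0
  have l2 := (hc2.tendsto 0).comp hμ0
  have l3 : Tendsto (fun n : ℕ => (2 * |t| * D / ((n : ℝ) + 1)) ^ (1 / p.toReal)) atTop (𝓝 0) := by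
    have := (tendsto_one_div_add_atTop_nhds_zero_nat (𝕜 := ℝ)).const_mul (2 * |t| * D)
    simp only [mul_one_div, mul_zero] at this
    have := this.rpow_const (p := 1 / p.toReal) (Or.inr (by positivity))
    rwa [Real.zero_rpow (by positivity)] at this
  have := l1.add (l2.mul l3)
  simpa [Function.comp_def] using this
end
end

section
/- Let φ ∈ C_c(ℝ) with supp(φ) ⊂ ℝ^+. Then the spectrum of the Wiener–Hopf operator T_φ on 𝐄 is σ(T_φ) = closure of φ̂(𝒪), where 𝒪 = {z ∈ ℂ : Im z < 𝛂_0} and φ̂(z) = ∫_ℝ φ(t) e^{−izt} dt. (Theorem 5(i)) -/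
open MeasureTheory Filter Complex Set
open scoped Real ENNReal Topology NNReal

noncomputable section

/-- The weighted measure `ω(x)^p dx` on `ℝ⁺ = [0,∞)` (a measure on `ℝ` carried by `[0,∞)`),
so that `𝐄 = L^p_ω(ℝ⁺)` is `Lp ℂ p (wmp p ω)`. -/
def wmp (p : ℝ) (ω : ℝ → ℝ) : Measure ℝ :=
  (volume.restrict (Set.Ici (0 : ℝ))).withDensity fun x => ENNReal.ofReal (ω x ^ p)

theorem exists_char {A : Type*} [NormedRing A] [NormedAlgebra ℂ A] [CompleteSpace A]
    (s : Set A) (hs : ∀ x ∈ s, ∀ y ∈ s, x * y = y * x) (a : A) (ha : a ∈ s) (l : ℂ)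
    (hl : l ∈ spectrum ℂ a) :
    ∃ χ : A →L[ℂ] ℂ, χ 1 = 1 ∧ χ a = l ∧ ∀ x ∈ s, ∀ y ∈ s, χ (x * y) = χ x * χ y := by
  set B := (Algebra.adjoin ℂ s).topologicalClosure with hB
  have hcomm : ∀ x y : B, x * y = y * x := by
    have h1 : IsMulCommutative (Algebra.adjoin ℂ s) := Algebra.isMulCommutative_adjoin ℂ hs
    have := (Subalgebra.commRingTopologicalClosure (Algebra.adjoin ℂ s)
      (fun x y => h1.is_comm.comm x y)).mul_comm
    exact this
  let : NormedCommRing B := { (inferInstance : NormedRing B) with mul_comm := hcomm }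
  have hBc : IsClosed (B : Set A) := Subalgebra.isClosed_topologicalClosure _
  have : CompleteSpace B := hBc.completeSpace_coe
  have hsB : ∀ x ∈ s, x ∈ B := fun x hx =>
    Subalgebra.le_topologicalClosure _ (Algebra.subset_adjoin hx)
  have h2 : l ∈ spectrum ℂ (⟨a, hsB a ha⟩ : B) := spectrum.subset_subalgebra (⟨a, hsB a ha⟩ : B) hl
  obtain ⟨f, hf⟩ := WeakDual.CharacterSpace.mem_spectrum_iff_exists.1 h2
  let f' : StrongDual ℂ B := WeakDual.toStrongDual (f : WeakDual ℂ B)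
  obtain ⟨g, hg, -⟩ := exists_extension_norm_eq (𝕜 := ℂ) (Subalgebra.toSubmodule B) f'
  have hg' : ∀ x : B, g x = f x := fun x => hg x
  refine ⟨g, ?_, ?_, ?_⟩
  · have := hg' 1
    rw [map_one] at this
    exact this
  · rw [← hf]; exact hg' ⟨a, hsB a ha⟩
  · intro x hx y hy
    have := hg' (⟨x, hsB x hx⟩ * ⟨y, hsB y hy⟩)
    rw [map_mul] at this
    rw [← hg', ← hg'] at this
    exact this

theorem cauchy_exp (m : ℝ → ℂ) (h0 : m 0 = 1) (hadd : ∀ s t, 0 ≤ s → 0 ≤ t → m (s + t) = m s * m t)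
    (hc : ContinuousOn m (Ici 0)) : ∃ a : ℂ, ∀ t, 0 ≤ t → m t = Complex.exp (a * t) := by
  -- continuous extension
  let M : ℝ → ℂ := fun t => m (max t 0)
  have hM : Continuous M := by
    apply hc.comp_continuous (by fun_prop) (fun x => by simp)
  have hMm : ∀ t, 0 ≤ t → M t = m t := fun t ht => by simp [M, ht]
  let F : ℝ → ℂ := fun t => ∫ x in (0:ℝ)..t, M x
  have hF : ∀ t, HasDerivAt F (M t) t := fun t =>
    intervalIntegral.integral_hasDerivAt_right (hM.intervalIntegrable _ _)
      hM.stronglyMeasurable.stronglyMeasurableAtFilter hM.continuousAt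
  have hδ : ∃ δ : ℝ, 0 < δ ∧ F δ ≠ 0 := by
    by_contra hcon
    push Not at hcon
    have h1 : HasDerivWithinAt F 1 (Ici 0) 0 := by
      have := (hF 0).hasDerivWithinAt (s := Ici 0)
      rwa [hMm 0 le_rfl, h0] at this
    have h2 : HasDerivWithinAt F 0 (Ici 0) 0 := by
      refine (hasDerivWithinAt_const (0:ℝ) (Ici (0:ℝ)) (0:ℂ)).congr (fun x hx => ?_) (by simp [F])
      rcases eq_or_lt_of_le (show (0:ℝ) ≤ x from hx) with h | h
      · simp [F, ← h]
      · exact hcon x h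
    exact one_ne_zero ((uniqueDiffWithinAt_Ici (0:ℝ)).eq_deriv _ h1 h2)
  obtain ⟨δ, hδ, hFδ⟩ := hδ
  have key : ∀ t, 0 ≤ t → m t = (F (t + δ) - F t) / F δ := by
    intro t ht
    rw [eq_div_iff hFδ]
    have e1 : F (t + δ) - F t = ∫ x in t..(t+δ), M x :=
      intervalIntegral.integral_interval_sub_left (hM.intervalIntegrable _ _)
        (hM.intervalIntegrable _ _)
    rw [e1]
    have e2 : ∫ x in t..(t+δ), M x = ∫ x in (0:ℝ)..δ, M (x + t) := by
      rw [intervalIntegral.integral_comp_add_right]; simp [add_comm]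
    rw [e2, ← intervalIntegral.integral_const_mul]
    apply intervalIntegral.integral_congr
    intro x hx
    rw [uIcc_of_le hδ.le] at hx
    simp only
    rw [hMm x hx.1, hMm _ (by linarith [hx.1]), hadd x t hx.1 ht, mul_comm]
  set a : ℂ := (m δ - 1) / F δ with ha
  refine ⟨a, fun t ht => ?_⟩
  let G : ℝ → ℂ := fun t => (F (t + δ) - F t) / F δ * Complex.exp (-a * t)
  have hG : ∀ t, 0 ≤ t → HasDerivAt G 0 t := by
    intro t ht
    have d1 : HasDerivAt (fun t => F (t + δ)) (M (t + δ)) t := (hF (t+δ)).comp_add_const t δ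
    have d2 : HasDerivAt (fun t : ℝ => Complex.exp (-a * t)) (Complex.exp (-a * t) * (-a * 1)) t :=
      ((HasDerivAt.ofReal_comp (hasDerivAt_id t)).const_mul (-a)).cexp
    have := ((d1.sub (hF t)).div_const (F δ)).mul d2
    refine HasDerivAt.congr_deriv this ?_
    simp only [Pi.sub_apply]
    rw [← key t ht, hMm t ht, hMm (t+δ) (by linarith), hadd t δ ht hδ.le, ha]
    field_simp
    ring
  have hconst := constant_of_has_deriv_right_zero (f := G) (a := 0) (b := t)
    (fun x hx => (hG x hx.1).continuousAt.continuousWithinAt)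
    (fun x hx => (hG x hx.1).hasDerivWithinAt) t ⟨ht, le_rfl⟩
  simp only [G] at hconst
  rw [← key t ht, ← key 0 le_rfl, h0] at hconst
  simp only [ofReal_zero, mul_zero, Complex.exp_zero, mul_one] at hconst
  rw [neg_mul, Complex.exp_neg] at hconst
  field_simp [Complex.exp_ne_zero] at hconst
  exact hconst

theorem weight_unif (ω : ℝ → ℝ) (hω_cont : Continuous ω) (hω_pos : ∀ x, 0 < ω x)
    (hω_sub : ∀ t : ℝ, 0 ≤ t → ∃ c C : ℝ, 0 < c ∧
      ∀ x : ℝ, 0 ≤ x → c ≤ ω (x + t) / ω x ∧ ω (x + t) / ω x ≤ C) (L : ℝ) :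
    ∃ D : ℝ, 1 ≤ D ∧ ∀ t, 0 ≤ t → t ≤ L → ∀ x, 0 ≤ x → ω (x + t) ≤ D * ω x ∧ ω x ≤ D * ω (x + t) := by
  let w : ℝ → ℝ := fun x => Real.log (ω x)
  have hw : Continuous w := hω_cont.log (fun x => (hω_pos x).ne')
  have hb : ∀ t : ℝ, 0 ≤ t → ∃ n : ℕ, ∀ x, 0 ≤ x → |w (x + t) - w x| ≤ n := by
    intro t ht
    obtain ⟨c, C, hc, h⟩ := hω_sub t ht
    obtain ⟨n, hn⟩ := exists_nat_ge (max (Real.log C) (-Real.log c))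
    refine ⟨n, fun x hx => ?_⟩
    obtain ⟨h1, h2⟩ := h x hx
    have e : w (x + t) - w x = Real.log (ω (x+t) / ω x) :=
      (Real.log_div (hω_pos _).ne' (hω_pos _).ne').symm
    have hpos : 0 < ω (x+t) / ω x := div_pos (hω_pos _) (hω_pos _)
    rw [e, abs_le]
    have := Real.log_le_log hc h1
    have := Real.log_le_log hpos h2
    have := le_max_left (Real.log C) (-Real.log c)
    have := le_max_right (Real.log C) (-Real.log c)
    constructor <;> linarith
  -- Baire
  let K : ℕ → Set ℝ := fun n => {t | ∀ x, 0 ≤ x → |w (x + |t|) - w x| ≤ n}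
  obtain ⟨n, hn⟩ := nonempty_interior_of_iUnion_of_closed (f := K)
    (fun n => by
      have : K n = ⋂ x, ⋂ (_ : 0 ≤ x), {t | |w (x + |t|) - w x| ≤ n} := by
        ext t; simp [K]
      rw [this]
      refine isClosed_iInter fun x => isClosed_iInter fun _ => isClosed_le (by fun_prop) (by fun_prop))
    (by
      ext t; simp only [mem_iUnion, mem_univ, iff_true]
      exact hb |t| (abs_nonneg t))
  obtain ⟨t0, ht0⟩ := hn
  obtain ⟨ε, hε, hball⟩ := Metric.isOpen_iff.1 isOpen_interior t0 ht0
  -- interval in nonneg reals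
  have hinteg : ∃ b δ : ℝ, 0 ≤ b ∧ 0 < δ ∧ ∀ t, 0 ≤ t → t ≤ δ → ∀ x, 0 ≤ x → |w (x + (b + t)) - w x| ≤ n := by
    refine ⟨|t0|, ε / 2, abs_nonneg _, by linarith, fun t h1 h2 x hx => ?_⟩
    rcases le_total 0 t0 with h | h
    · have : t0 + t ∈ K n := interior_subset (hball (by
        simp [abs_of_nonneg h1]; linarith))
      have h3 := this x hx
      rwa [abs_of_nonneg (by linarith : 0 ≤ t0 + t), ← abs_of_nonneg h] at h3
    · have : t0 - t ∈ K n := interior_subset (hball (by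
        simp [abs_of_nonneg h1]; linarith))
      have h3 := this x hx
      rw [abs_of_nonpos (by linarith : t0 - t ≤ 0)] at h3
      rw [abs_of_nonpos h]
      convert h3 using 4
      ring
  obtain ⟨b, δ, hb0, hδ, hbδ⟩ := hinteg
  have hsmall : ∀ t, 0 ≤ t → t ≤ δ → ∀ x, 0 ≤ x → |w (x + t) - w x| ≤ 2 * n := by
    intro t h1 h2 x hx
    have e1 := abs_le.1 (hbδ t h1 h2 x hx)
    have e2 := abs_le.1 (hbδ 0 le_rfl hδ.le (x + t) (by linarith))
    rw [show x + t + (b + 0) = x + (b + t) by ring] at e2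
    rw [abs_le]; constructor <;> linarith [e1.1, e1.2, e2.1, e2.2]
  have hlarge : ∀ k : ℕ, ∀ t, 0 ≤ t → t ≤ k * δ → ∀ x, 0 ≤ x → |w (x + t) - w x| ≤ k * (2 * n) := by
    intro k
    induction k with
    | zero =>
      intro t h1 h2 x hx
      have : t = 0 := by simp at h2; linarith
      simp [this]
    | succ k ih =>
      intro t h1 h2 x hx
      push_cast at h2 ⊢
      have hn0 : (0:ℝ) ≤ n := n.cast_nonneg
      rcases le_total t δ with h | h
      · have := hsmall t h1 h x hx
        have : 0 ≤ (k:ℝ) * (2 * n) := by positivity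
        linarith
      · have e1 := abs_le.1 (hsmall δ hδ.le le_rfl x hx)
        have e2 := abs_le.1 (ih (t - δ) (by linarith) (by linarith) (x + δ) (by linarith))
        rw [show x + δ + (t - δ) = x + t by ring] at e2
        rw [abs_le]; constructor <;> linarith [e1.1, e1.2, e2.1, e2.2]
  obtain ⟨k, hk⟩ := exists_nat_ge (L / δ)
  refine ⟨Real.exp (k * (2 * n)), Real.one_le_exp (by positivity), fun t h1 h2 x hx => ?_⟩
  have := abs_le.1 (hlarge k t h1 (h2.trans ((div_le_iff₀ hδ).1 hk)) x hx)
  have e : ∀ x, ω x = Real.exp (w x) := fun x => (Real.exp_log (hω_pos x)).symm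
  rw [e (x+t), e x, ← Real.exp_add, ← Real.exp_add, Real.exp_le_exp, Real.exp_le_exp]
  constructor <;> linarith [this.1, this.2]

/-- extension by zero -/
def ext0 (f : ℝ → ℂ) : ℝ → ℂ := Set.indicator (Set.Ici (0 : ℝ)) f

/-- weighted p-th power norm -/
def NN (q : ℝ) (ω : ℝ → ℝ) (F : ℝ → ℂ) : ℝ≥0∞ := ∫⁻ x, (‖F x‖ₑ * ENNReal.ofReal (ω x)) ^ q

theorem ext0_neg (f : ℝ → ℂ) {x : ℝ} (hx : x < 0) : ext0 f x = 0 := by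
  simp [ext0, hx]

theorem ext0_nonneg (f : ℝ → ℂ) {x : ℝ} (hx : 0 ≤ x) : ext0 f x = f x := by
  simp [ext0, hx]


theorem dens_meas {ω : ℝ → ℝ} (hω_cont : Continuous ω) (hω_pos : ∀ x, 0 < ω x) (q : ℝ) : Measurable fun x => ENNReal.ofReal (ω x ^ q) := by
  have : Continuous fun x => ω x ^ q := hω_cont.rpow_const (fun x => Or.inl (hω_pos x).ne')
  fun_prop

theorem ae_wmp_iff {ω : ℝ → ℝ} (hω_cont : Continuous ω) (hω_pos : ∀ x, 0 < ω x) (q : ℝ) (P : ℝ → Prop) :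
    (∀ᵐ x ∂(wmp q ω), P x) ↔ ∀ᵐ x : ℝ, 0 ≤ x → P x := by
  rw [wmp, ae_withDensity_iff (dens_meas hω_cont hω_pos q), ae_restrict_iff' measurableSet_Ici]
  have : ∀ x, ENNReal.ofReal (ω x ^ q) ≠ 0 := fun x => by
    simp [Real.rpow_pos_of_pos (hω_pos x) q]
  simp [this]

theorem ae_wmp_iff_ext {ω : ℝ → ℝ} (hω_cont : Continuous ω) (hω_pos : ∀ x, 0 < ω x) (q : ℝ) (f g : ℝ → ℂ) :
    f =ᵐ[wmp q ω] g ↔ ext0 f =ᵐ[volume] ext0 g := by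
  rw [Filter.EventuallyEq, ae_wmp_iff hω_cont hω_pos]
  refine eventually_congr (Eventually.of_forall fun x => ?_)
  rcases lt_or_ge x 0 with h | h
  · simp [ext0_neg _ h, h]
  · simp [ext0_nonneg _ h, h]

theorem eLpNorm_pow {ω : ℝ → ℝ} (hω_cont : Continuous ω) (hω_pos : ∀ x, 0 < ω x) (p : ℝ≥0∞) [hp1 : Fact (1 ≤ p)] (hp : p ≠ ∞) (f : ℝ → ℂ) :
    eLpNorm f p (wmp p.toReal ω) ^ p.toReal = NN p.toReal ω (ext0 f) := by
  have hp0 : p ≠ 0 := (lt_of_lt_of_le one_pos hp1.out).ne'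
  have hq : 0 < p.toReal := ENNReal.toReal_pos hp0 hp
  rw [eLpNorm_eq_lintegral_rpow_enorm_toReal hp0 hp, ← ENNReal.rpow_mul, one_div,
    inv_mul_cancel₀ hq.ne', ENNReal.rpow_one, wmp,
    lintegral_withDensity_eq_lintegral_mul_non_measurable _ (dens_meas hω_cont hω_pos _)
      (Eventually.of_forall fun x => ENNReal.ofReal_lt_top), NN, ← lintegral_indicator measurableSet_Ici]
  congr 1
  ext x
  rcases lt_or_ge x 0 with h | h
  · simp [ext0_neg _ h, h, hq]
  · simp only [mem_Ici, h, indicator_of_mem, Pi.mul_apply, ext0_nonneg]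
    rw [ENNReal.mul_rpow_of_nonneg _ _ hq.le, ENNReal.ofReal_rpow_of_pos (hω_pos x), mul_comm]

theorem enorm_pow_NN {ω : ℝ → ℝ} (hω_cont : Continuous ω) (hω_pos : ∀ x, 0 < ω x) (p : ℝ≥0∞) [hp1 : Fact (1 ≤ p)] (hp : p ≠ ∞) (f : Lp ℂ p (wmp p.toReal ω)) :
    ‖f‖ₑ ^ p.toReal = NN p.toReal ω (ext0 f) := by
  rw [Lp.enorm_def, eLpNorm_pow hω_cont hω_pos p hp]

theorem aesm_ext {ω : ℝ → ℝ} (hω_cont : Continuous ω) (hω_pos : ∀ x, 0 < ω x) (p : ℝ≥0∞) (f : Lp ℂ p (wmp p.toReal ω)) :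
    AEStronglyMeasurable (ext0 f) volume := by
  rw [ext0, aestronglyMeasurable_indicator_iff measurableSet_Ici]
  refine (Lp.aestronglyMeasurable f).mono_ac ?_
  apply withDensity_absolutelyContinuous' (dens_meas hω_cont hω_pos _).aemeasurable
  refine Eventually.of_forall fun x => ?_
  simp [Real.rpow_pos_of_pos (hω_pos x)]

theorem Lp_ext0 {ω : ℝ → ℝ} (hω_cont : Continuous ω) (hω_pos : ∀ x, 0 < ω x) (p : ℝ≥0∞) (f g : Lp ℂ p (wmp p.toReal ω)) (h : ext0 f =ᵐ[volume] ext0 g) : f = g :=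
  Lp.ext ((ae_wmp_iff_ext hω_cont hω_pos _ _ _).2 h)

theorem ext0_add {ω : ℝ → ℝ} (hω_cont : Continuous ω) (hω_pos : ∀ x, 0 < ω x) (p : ℝ≥0∞) (f g : Lp ℂ p (wmp p.toReal ω)) :
    ext0 ⇑(f + g) =ᵐ[volume] fun x => ext0 f x + ext0 g x := by
  have := (ae_wmp_iff_ext hω_cont hω_pos _ _ _).1 (Lp.coeFn_add f g)
  refine this.trans (Eventually.of_forall fun x => ?_)
  rcases lt_or_ge x 0 with h | h
  · simp [ext0_neg _ h]
  · simp [ext0_nonneg _ h]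

theorem ext0_smul {ω : ℝ → ℝ} (hω_cont : Continuous ω) (hω_pos : ∀ x, 0 < ω x) (p : ℝ≥0∞) (c : ℂ) (f : Lp ℂ p (wmp p.toReal ω)) :
    ext0 ⇑(c • f) =ᵐ[volume] fun x => c * ext0 f x := by
  have := (ae_wmp_iff_ext hω_cont hω_pos _ _ _).1 (Lp.coeFn_smul c f)
  refine this.trans (Eventually.of_forall fun x => ?_)
  rcases lt_or_ge x 0 with h | h
  · simp [ext0_neg _ h]
  · simp [ext0_nonneg _ h]

theorem ext0_sub {ω : ℝ → ℝ} (hω_cont : Continuous ω) (hω_pos : ∀ x, 0 < ω x) (p : ℝ≥0∞) (f g : Lp ℂ p (wmp p.toReal ω)) :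
    ext0 ⇑(f - g) =ᵐ[volume] fun x => ext0 f x - ext0 g x := by
  have := (ae_wmp_iff_ext hω_cont hω_pos _ _ _).1 (Lp.coeFn_sub f g)
  refine this.trans (Eventually.of_forall fun x => ?_)
  rcases lt_or_ge x 0 with h | h
  · simp [ext0_neg _ h]
  · simp [ext0_nonneg _ h]

theorem exists_Lp {ω : ℝ → ℝ} (hω_cont : Continuous ω) (hω_pos : ∀ x, 0 < ω x) (p : ℝ≥0∞) [hp1 : Fact (1 ≤ p)] (hp : p ≠ ∞) (F : ℝ → ℂ)
    (hF : AEStronglyMeasurable F volume) (hneg : ∀ x, x < 0 → F x = 0)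
    (hfin : NN p.toReal ω F < ∞) : ∃ f : Lp ℂ p (wmp p.toReal ω), ext0 f =ᵐ[volume] F := by
  have hFe : ext0 F = F := by
    ext x
    rcases lt_or_ge x 0 with h | h
    · simp [ext0_neg _ h, hneg x h]
    · simp [ext0_nonneg _ h]
  have hp0 : p ≠ 0 := (lt_of_lt_of_le one_pos hp1.out).ne'
  have hq : 0 < p.toReal := ENNReal.toReal_pos hp0 hp
  have hm : MemLp F p (wmp p.toReal ω) := by
    refine ⟨hF.mono_ac ?_, ?_⟩
    · exact (withDensity_absolutelyContinuous _ _).trans Measure.restrict_le_self.absolutelyContinuous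
    · have := eLpNorm_pow hω_cont hω_pos p hp F
      rw [hFe] at this
      rw [← this] at hfin
      by_contra hcon
      simp only [not_lt, top_le_iff] at hcon
      rw [hcon, ENNReal.top_rpow_of_pos hq] at hfin
      exact absurd hfin (lt_irrefl _)
  refine ⟨hm.toLp, ?_⟩
  have := (ae_wmp_iff_ext hω_cont hω_pos _ _ _).1 hm.coeFn_toLp
  rwa [hFe] at this

theorem locInt {ω : ℝ → ℝ} (hω_cont : Continuous ω) (hω_pos : ∀ x, 0 < ω x) (p : ℝ≥0∞) [hp1 : Fact (1 ≤ p)] (hp : p ≠ ∞) (f : Lp ℂ p (wmp p.toReal ω)) :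
    LocallyIntegrable (ext0 f) volume := by
  have hp0 : p ≠ 0 := (lt_of_lt_of_le one_pos hp1.out).ne'
  have hq : 0 < p.toReal := ENNReal.toReal_pos hp0 hp
  have hq1 : 1 ≤ p.toReal := by
    rw [← ENNReal.toReal_one]; exact ENNReal.toReal_mono hp hp1.out
  rw [locallyIntegrable_iff]
  intro k hk
  have hinv : Continuous fun x => (ω x)⁻¹ := hω_cont.inv₀ (fun x => (hω_pos x).ne')
  obtain ⟨C, hC⟩ := (hk.bddAbove_image hinv.continuousOn)
  refine ⟨(aesm_ext hω_cont hω_pos p f).restrict, ?_⟩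
  have hbd : ∀ᵐ x ∂(volume.restrict k), ‖ext0 f x‖ₑ ≤
      1 + ENNReal.ofReal C ^ p.toReal * (‖ext0 f x‖ₑ * ENNReal.ofReal (ω x)) ^ p.toReal := by
    rw [ae_restrict_iff' hk.measurableSet]
    refine Eventually.of_forall fun x hx => ?_
    have h1 : (ω x)⁻¹ ≤ C := hC (mem_image_of_mem _ hx)
    have h2 : 1 ≤ ENNReal.ofReal C * ENNReal.ofReal (ω x) := by
      rw [← ENNReal.ofReal_mul ((inv_pos.2 (hω_pos x)).le.trans h1), ← ENNReal.ofReal_one]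
      apply ENNReal.ofReal_le_ofReal
      rwa [inv_le_iff_one_le_mul₀ (hω_pos x)] at h1
    rw [← ENNReal.mul_rpow_of_nonneg _ _ hq.le]
    rcases le_total ‖ext0 f x‖ₑ 1 with h | h
    · exact h.trans le_self_add
    · refine le_add_left ?_
      calc ‖ext0 f x‖ₑ ≤ ‖ext0 f x‖ₑ ^ p.toReal := ENNReal.le_rpow_self_of_one_le h hq1
        _ ≤ _ := by
          apply ENNReal.rpow_le_rpow _ hq.le
          calc ‖ext0 f x‖ₑ = 1 * ‖ext0 f x‖ₑ := by rw [one_mul]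
            _ ≤ (ENNReal.ofReal C * ENNReal.ofReal (ω x)) * ‖ext0 f x‖ₑ := by gcongr
            _ = _ := by ring
  have hNN : NN p.toReal ω (ext0 f) < ∞ := by
    rw [← enorm_pow_NN hω_cont hω_pos p hp]
    exact ENNReal.rpow_lt_top_of_nonneg hq.le (by simp)
  refine lt_of_le_of_lt (lintegral_mono_ae hbd) ?_
  rw [lintegral_add_left (by fun_prop), lintegral_const_mul' _ _
    (ENNReal.rpow_lt_top_of_nonneg hq.le (by simp)).ne]
  refine ENNReal.add_lt_top.2 ⟨by simpa using hk.measure_lt_top, ENNReal.mul_lt_top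
    (ENNReal.rpow_lt_top_of_nonneg hq.le (by simp)) ?_⟩
  exact lt_of_le_of_lt (setLIntegral_le_lintegral _ _) hNN

theorem NN_congr (q : ℝ) (ω : ℝ → ℝ) {F G : ℝ → ℂ} (h : F =ᵐ[volume] G) : NN q ω F = NN q ω G := by
  apply lintegral_congr_ae
  filter_upwards [h] with x hx
  rw [hx]

theorem NN_shift_eq (q : ℝ) (ω : ℝ → ℝ) (F : ℝ → ℂ) (t : ℝ) :
    NN q ω (fun x => F (x - t)) = ∫⁻ x, (‖F x‖ₑ * ENNReal.ofReal (ω (x + t))) ^ q := by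
  rw [NN, ← lintegral_sub_right_eq_self (fun x => (‖F x‖ₑ * ENNReal.ofReal (ω (x + t))) ^ q) t]
  simp

theorem NN_shift_le (q : ℝ) (hq : 0 < q) (ω : ℝ → ℝ) (F : ℝ → ℂ) (hneg : ∀ x, x < 0 → F x = 0)
    (t D : ℝ) (hD0 : 0 ≤ D) (hD : ∀ x, 0 ≤ x → ω (x + t) ≤ D * ω x) :
    NN q ω (fun x => F (x - t)) ≤ ENNReal.ofReal D ^ q * NN q ω F := by
  rw [NN_shift_eq, NN, ← lintegral_const_mul' _ _ (ENNReal.rpow_lt_top_of_nonneg hq.le (by simp)).ne]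
  refine lintegral_mono fun x => ?_
  rcases lt_or_ge x 0 with h | h
  · simp [hneg x h, hq]
  · rw [← ENNReal.mul_rpow_of_nonneg _ _ hq.le]
    apply ENNReal.rpow_le_rpow _ hq.le
    calc _ ≤ ‖F x‖ₑ * ENNReal.ofReal (D * ω x) := by
          gcongr
          exact hD x h
      _ = _ := by rw [ENNReal.ofReal_mul hD0]; ring

/-- convolution -/
def cv (ψ F : ℝ → ℂ) (x : ℝ) : ℂ := ∫ y, ψ y * F (x - y)

theorem cv_eq (ψ F : ℝ → ℂ) : cv ψ F = convolution ψ F (ContinuousLinearMap.mul ℂ ℂ) volume := by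
  ext x; simp [cv, convolution_def]

theorem cv_congr (ψ : ℝ → ℂ) {F G : ℝ → ℂ} (h : F =ᵐ[volume] G) : cv ψ F = cv ψ G := by
  rw [cv_eq, cv_eq]; exact convolution_congr _ (ae_eq_refl _) h

theorem cv_aesm {ψ F : ℝ → ℂ} (hψ : AEStronglyMeasurable ψ volume) (hF : AEStronglyMeasurable F volume) :
    AEStronglyMeasurable (cv ψ F) volume :=
  (hψ.convolution_integrand (ContinuousLinearMap.mul ℂ ℂ) hF).integral_prod_right'

theorem cv_neg {ψ F : ℝ → ℂ} (hψ : ∀ x, x < 0 → ψ x = 0) (hF : ∀ x, x < 0 → F x = 0) (x : ℝ)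
    (hx : x < 0) : cv ψ F x = 0 := by
  rw [cv]
  convert integral_zero ℝ ℂ with y
  rcases lt_or_ge y 0 with h | h
  · simp [hψ y h]
  · simp [hF (x - y) (by linarith)]

theorem cv_integrable {ψ F : ℝ → ℂ} (hψ : AEStronglyMeasurable ψ volume) {B L : ℝ}
    (hB : ∀ x, ‖ψ x‖ ≤ B) (hs : ∀ x, x ∉ Icc 0 L → ψ x = 0) (hF : LocallyIntegrable F volume) (x : ℝ) :
    Integrable fun y => ψ y * F (x - y) := by
  have h1 : Integrable (indicator (Icc (x - L) x) F) :=
    (hF.integrableOn_isCompact isCompact_Icc).integrable_indicator measurableSet_Icc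
  have h2 := (h1.comp_sub_left x).bdd_mul hψ (Eventually.of_forall hB)
  refine h2.congr (Eventually.of_forall fun y => ?_)
  simp only
  by_cases hy : y ∈ Icc 0 L
  · rw [indicator_of_mem]
    exact ⟨by linarith [hy.2], by linarith [hy.1]⟩
  · simp [hs y hy]

theorem NN_cv_le (p : ℝ≥0∞) [hp1 : Fact (1 ≤ p)] (hp : p ≠ ∞) {ω : ℝ → ℝ} (hω_cont : Continuous ω)
    {ψ F : ℝ → ℂ} {B L D : ℝ} (hD0 : 0 ≤ D)
    (hB : ∀ x, ‖ψ x‖ ≤ B) (hs : ∀ x, x ∉ Icc 0 L → ψ x = 0)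
    (hF : AEStronglyMeasurable F volume) (hneg : ∀ x, x < 0 → F x = 0)
    (hD : ∀ t, 0 ≤ t → t ≤ L → ∀ x, 0 ≤ x → ω (x + t) ≤ D * ω x) :
    NN p.toReal ω (cv ψ F) ≤ (ENNReal.ofReal B * ENNReal.ofReal L * ENNReal.ofReal D) ^ p.toReal
      * NN p.toReal ω F := by
  have hp0 : p ≠ 0 := (lt_of_lt_of_le one_pos hp1.out).ne'
  have hq : 0 < p.toReal := ENNReal.toReal_pos hp0 hp
  set q := p.toReal with hqdef
  have hq1 : 1 ≤ q := by
    rw [hqdef, ← ENNReal.toReal_one]; exact ENNReal.toReal_mono hp hp1.out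
  set ν := (volume : Measure ℝ).restrict (Icc 0 L) with hν
  have hνu : ν univ = ENNReal.ofReal L := by simp [hν]
  have step1 : ∀ x, ‖cv ψ F x‖ₑ ≤ ENNReal.ofReal B * ∫⁻ y, ‖F (x - y)‖ₑ ∂ν := by
    intro x
    refine (enorm_integral_le_lintegral_enorm _).trans ?_
    rw [← lintegral_const_mul' _ _ ENNReal.ofReal_ne_top, hν, ← lintegral_indicator measurableSet_Icc]
    refine lintegral_mono fun y => ?_
    by_cases hy : y ∈ Icc 0 L
    · rw [indicator_of_mem hy, enorm_mul]
      gcongr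
      rw [← ofReal_norm]
      exact ENNReal.ofReal_le_ofReal (hB y)
    · simp [hs y hy]
  have step2 : ∀ x, (∫⁻ y, ‖F (x - y)‖ₑ ∂ν) ^ q ≤
      ENNReal.ofReal L ^ (q - 1) * ∫⁻ y, ‖F (x - y)‖ₑ ^ q ∂ν := by
    intro x
    have hm : AEStronglyMeasurable (fun y => F (x - y)) ν :=
      (hF.comp_quasiMeasurePreserving (quasiMeasurePreserving_sub_left volume x)).restrict
    have := eLpNorm_le_eLpNorm_mul_rpow_measure_univ (p := 1) (q := p) hp1.out hm
    rw [eLpNorm_one_eq_lintegral_enorm, eLpNorm_eq_lintegral_rpow_enorm_toReal hp0 hp, hνu] at this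
    have h2 := ENNReal.rpow_le_rpow this hq.le
    rw [ENNReal.mul_rpow_of_nonneg _ _ hq.le, ← ENNReal.rpow_mul, ← ENNReal.rpow_mul, ← hqdef,
      one_div, inv_mul_cancel₀ hq.ne', ENNReal.rpow_one] at h2
    rw [mul_comm]
    convert h2 using 3
    simp; field_simp
  have step3 : ∀ x, (‖cv ψ F x‖ₑ * ENNReal.ofReal (ω x)) ^ q ≤
      ENNReal.ofReal B ^ q * ENNReal.ofReal L ^ (q - 1) *
        ∫⁻ y, (‖F (x - y)‖ₑ * ENNReal.ofReal (ω x)) ^ q ∂ν := by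
    intro x
    simp_rw [ENNReal.mul_rpow_of_nonneg _ _ hq.le]
    rw [lintegral_mul_const' _ _ (ENNReal.rpow_lt_top_of_nonneg hq.le (by simp)).ne, ← mul_assoc]
    gcongr
    calc _ ≤ (ENNReal.ofReal B * ∫⁻ y, ‖F (x - y)‖ₑ ∂ν) ^ q :=
          ENNReal.rpow_le_rpow (step1 x) hq.le
      _ = ENNReal.ofReal B ^ q * (∫⁻ y, ‖F (x - y)‖ₑ ∂ν) ^ q := ENNReal.mul_rpow_of_nonneg _ _ hq.le
      _ ≤ _ := by rw [mul_assoc]; gcongr; exact step2 x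
  have hfin : ENNReal.ofReal B ^ q * ENNReal.ofReal L ^ (q - 1) ≠ ∞ :=
    ENNReal.mul_ne_top (ENNReal.rpow_lt_top_of_nonneg hq.le (by simp)).ne
      (ENNReal.rpow_lt_top_of_nonneg (by linarith) (by simp)).ne
  calc NN q ω (cv ψ F) ≤ ∫⁻ x, ENNReal.ofReal B ^ q * ENNReal.ofReal L ^ (q - 1) *
        ∫⁻ y, (‖F (x - y)‖ₑ * ENNReal.ofReal (ω x)) ^ q ∂ν := lintegral_mono step3
    _ = ENNReal.ofReal B ^ q * ENNReal.ofReal L ^ (q - 1) *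
        ∫⁻ x, ∫⁻ y, (‖F (x - y)‖ₑ * ENNReal.ofReal (ω x)) ^ q ∂ν := lintegral_const_mul' _ _ hfin
    _ = ENNReal.ofReal B ^ q * ENNReal.ofReal L ^ (q - 1) *
        ∫⁻ y, NN q ω (fun x => F (x - y)) ∂ν := by
      rw [lintegral_lintegral_swap]
      · rfl
      have h1 : AEStronglyMeasurable (fun z : ℝ × ℝ => F (z.1 - z.2)) (volume.prod ν) := by
        have := (aestronglyMeasurable_const (b := (1:ℂ)) (μ := ν)).convolution_integrand
          (ContinuousLinearMap.mul ℂ ℂ) hF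
        simpa using this
      have h2 : AEMeasurable (fun z : ℝ × ℝ => ‖F (z.1 - z.2)‖ₑ * ENNReal.ofReal (ω z.1)) (volume.prod ν) := by
        refine h1.enorm.mul ?_
        exact (Measurable.ennreal_ofReal (by fun_prop)).aemeasurable
      exact h2.pow_const q
    _ ≤ ENNReal.ofReal B ^ q * ENNReal.ofReal L ^ (q - 1) *
        ∫⁻ y, ENNReal.ofReal D ^ q * NN q ω F ∂ν := by
      refine mul_le_mul_right ?_ _
      refine lintegral_mono_ae ?_
      rw [hν, ae_restrict_iff' measurableSet_Icc]
      exact Eventually.of_forall fun y hy => NN_shift_le q hq ω F hneg y D hD0 (hD y hy.1 hy.2)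
    _ = _ := by
      rw [lintegral_const, hνu, ENNReal.mul_rpow_of_nonneg _ _ hq.le, ENNReal.mul_rpow_of_nonneg _ _ hq.le]
      have : ENNReal.ofReal L ^ q = ENNReal.ofReal L ^ (q - 1) * ENNReal.ofReal L := by
        conv_lhs => rw [show q = (q - 1) + 1 by ring]
        rw [ENNReal.rpow_add_of_nonneg _ _ (by linarith) (by norm_num), ENNReal.rpow_one]
      rw [this]; ring

theorem tr_aesm (L : ℝ) (ψ : BoundedContinuousFunction ℝ ℂ) :
    AEStronglyMeasurable (indicator (Icc 0 L) ψ) volume :=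
  (ψ.continuous.stronglyMeasurable.indicator measurableSet_Icc).aestronglyMeasurable

theorem tr_bd (L : ℝ) (ψ : BoundedContinuousFunction ℝ ℂ) (x : ℝ) :
    ‖indicator (Icc 0 L) ψ x‖ ≤ ‖ψ‖ :=
  (norm_indicator_le_norm_self _ _).trans (ψ.norm_coe_le_norm x)

theorem tr_supp (L : ℝ) (ψ : ℝ → ℂ) (x : ℝ) (hx : x ∉ Icc 0 L) : indicator (Icc 0 L) ψ x = 0 :=
  indicator_of_notMem hx _

theorem exists_Psi (p : ℝ≥0∞) [hp1 : Fact (1 ≤ p)] (hp : p ≠ ∞) {ω : ℝ → ℝ}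
    (hω_cont : Continuous ω) (hω_pos : ∀ x, 0 < ω x)
    (hω_sub : ∀ t : ℝ, 0 ≤ t → ∃ c C : ℝ, 0 < c ∧
      ∀ x : ℝ, 0 ≤ x → c ≤ ω (x + t) / ω x ∧ ω (x + t) / ω x ≤ C) (L : ℝ) :
    ∃ Ψ : BoundedContinuousFunction ℝ ℂ →L[ℂ]
        (Lp ℂ p (wmp p.toReal ω) →L[ℂ] Lp ℂ p (wmp p.toReal ω)),
      ∀ ψ f, ext0 (Ψ ψ f) =ᵐ[volume] cv (indicator (Icc 0 L) ψ) (ext0 f) := by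
  have hp0 : p ≠ 0 := (lt_of_lt_of_le one_pos hp1.out).ne'
  have hq : 0 < p.toReal := ENNReal.toReal_pos hp0 hp
  obtain ⟨D, hD1, hD⟩ := weight_unif ω hω_cont hω_pos hω_sub L
  have hD0 : 0 ≤ D := by linarith
  have hle : ∀ (ψ : BoundedContinuousFunction ℝ ℂ) (f : Lp ℂ p (wmp p.toReal ω)),
      NN p.toReal ω (cv (indicator (Icc 0 L) ψ) (ext0 f)) ≤
        (ENNReal.ofReal ‖ψ‖ * ENNReal.ofReal L * ENNReal.ofReal D) ^ p.toReal * ‖f‖ₑ ^ p.toReal := by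
    intro ψ f
    rw [enorm_pow_NN hω_cont hω_pos p hp]
    exact NN_cv_le p hp hω_cont hD0 (tr_bd L ψ) (tr_supp L ψ) (aesm_ext hω_cont hω_pos p f)
      (fun x hx => ext0_neg _ hx) (fun t h1 h2 x hx => (hD t h1 h2 x hx).1)
  have hex : ∀ (ψ : BoundedContinuousFunction ℝ ℂ) (f : Lp ℂ p (wmp p.toReal ω)),
      ∃ g : Lp ℂ p (wmp p.toReal ω), ext0 g =ᵐ[volume] cv (indicator (Icc 0 L) ψ) (ext0 f) := by
    intro ψ f
    refine exists_Lp hω_cont hω_pos p hp _ (cv_aesm (tr_aesm L ψ) (aesm_ext hω_cont hω_pos p f)) ?_ ?_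
    · exact cv_neg (fun x hx => tr_supp L ψ x (fun h => by linarith [h.1])) (fun x hx => ext0_neg _ hx)
    · refine (hle ψ f).trans_lt (ENNReal.mul_lt_top ?_ ?_)
      · exact ENNReal.rpow_lt_top_of_nonneg hq.le (by finiteness)
      · exact ENNReal.rpow_lt_top_of_nonneg hq.le (by simp)
  choose U hU using hex
  have hci : ∀ (ψ : BoundedContinuousFunction ℝ ℂ) (f : Lp ℂ p (wmp p.toReal ω)) (x : ℝ),
      Integrable fun y => indicator (Icc 0 L) ψ y * ext0 f (x - y) := fun ψ f x =>
    cv_integrable (tr_aesm L ψ) (tr_bd L ψ) (tr_supp L ψ) (locInt hω_cont hω_pos p hp f) x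
  let Ub := LinearMap.mk₂ ℂ U
    (by
      intro ψ₁ ψ₂ f
      apply Lp_ext0 hω_cont hω_pos
      refine (hU _ _).trans (EventuallyEq.trans ?_ (ext0_add hω_cont hω_pos p _ _).symm)
      filter_upwards [hU ψ₁ f, hU ψ₂ f] with x h1 h2
      rw [h1, h2, cv, cv, cv, ← integral_add (hci _ _ _) (hci _ _ _)]
      congr 1; ext y
      by_cases hy : y ∈ Icc 0 L
      · simp only [indicator_of_mem hy, BoundedContinuousFunction.coe_add, Pi.add_apply]; ring
      · simp only [indicator_of_notMem hy]; ring)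
    (by
      intro c ψ f
      apply Lp_ext0 hω_cont hω_pos
      refine (hU _ _).trans (EventuallyEq.trans ?_ (ext0_smul hω_cont hω_pos p _ _).symm)
      filter_upwards [hU ψ f] with x h1
      rw [h1, cv, cv, ← integral_const_mul]
      congr 1; ext y
      by_cases hy : y ∈ Icc 0 L
      · simp only [indicator_of_mem hy, BoundedContinuousFunction.coe_smul, smul_eq_mul]; ring
      · simp only [indicator_of_notMem hy]; ring)
    (by
      intro ψ f g
      apply Lp_ext0 hω_cont hω_pos
      refine (hU _ _).trans (EventuallyEq.trans ?_ (ext0_add hω_cont hω_pos p _ _).symm)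
      rw [cv_congr _ (ext0_add hω_cont hω_pos p f g)]
      filter_upwards [hU ψ f, hU ψ g] with x h1 h2
      rw [h1, h2, cv, cv, cv, ← integral_add (hci _ _ _) (hci _ _ _)]
      congr 1; ext y
      ring)
    (by
      intro c ψ f
      apply Lp_ext0 hω_cont hω_pos
      refine (hU _ _).trans (EventuallyEq.trans ?_ (ext0_smul hω_cont hω_pos p _ _).symm)
      rw [cv_congr _ (ext0_smul hω_cont hω_pos p c f)]
      filter_upwards [hU ψ f] with x h1
      rw [h1, cv, cv, ← integral_const_mul]
      congr 1; ext y
      ring)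
  refine ⟨Ub.mkContinuous₂ (max L 0 * D) ?_, fun ψ f => hU ψ f⟩
  intro ψ f
  change ‖U ψ f‖ ≤ _
  have h1 := hle ψ f
  rw [← NN_congr _ _ (hU ψ f), ← enorm_pow_NN hω_cont hω_pos p hp,
    ← ENNReal.mul_rpow_of_nonneg _ _ hq.le, ENNReal.rpow_le_rpow_iff hq] at h1
  have h2 : ENNReal.ofReal L = ENNReal.ofReal (max L 0) := by
    rw [ENNReal.ofReal_max]; simp
  rw [h2, ← ofReal_norm, ← ofReal_norm, ← ENNReal.ofReal_mul (by positivity),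
    ← ENNReal.ofReal_mul (by positivity), ← ENNReal.ofReal_mul (by positivity),
    ENNReal.ofReal_le_ofReal_iff (by positivity)] at h1
  linarith

section ops
variable {p : ℝ≥0∞} [hp1 : Fact (1 ≤ p)] (hp : p ≠ ∞) {ω : ℝ → ℝ}
    (hω_cont : Continuous ω) (hω_pos : ∀ x, 0 < ω x)

theorem ext0_S {S : ℝ → (Lp ℂ p (wmp p.toReal ω) →L[ℂ] Lp ℂ p (wmp p.toReal ω))}
    (hω_cont : Continuous ω) (hω_pos : ∀ x, 0 < ω x)
    (hSp : ∀ t : ℝ, 0 ≤ t → ∀ f : Lp ℂ p (wmp p.toReal ω),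
      (S t f : ℝ → ℂ) =ᵐ[wmp p.toReal ω] fun x => if t ≤ x then f (x - t) else 0)
    (t : ℝ) (ht : 0 ≤ t) (f : Lp ℂ p (wmp p.toReal ω)) :
    ext0 (S t f) =ᵐ[volume] fun x => ext0 f (x - t) := by
  refine ((ae_wmp_iff_ext hω_cont hω_pos _ _ _).1 (hSp t ht f)).trans (Eventually.of_forall fun x => ?_)
  rcases lt_or_ge x t with h | h
  · simp only
    rw [ext0_neg _ (by linarith : x - t < 0)]
    simp [ext0, not_le.2 h]
  · simp only
    rw [ext0_nonneg _ (by linarith : 0 ≤ x - t), ext0_nonneg _ (ht.trans h)]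
    simp [h]

theorem ext0_T {T : Lp ℂ p (wmp p.toReal ω) →L[ℂ] Lp ℂ p (wmp p.toReal ω)}
    (hω_cont : Continuous ω) (hω_pos : ∀ x, 0 < ω x)
    {φ : ℝ → ℂ} (hneg : ∀ x, x < 0 → φ x = 0)
    (hTφ : ∀ f : Lp ℂ p (wmp p.toReal ω),
      (T f : ℝ → ℂ) =ᵐ[wmp p.toReal ω]
        fun x => ∫ y : ℝ, φ y * Set.indicator (Set.Ici (0 : ℝ)) (⇑f) (x - y))
    (f : Lp ℂ p (wmp p.toReal ω)) :
    ext0 (T f) =ᵐ[volume] cv φ (ext0 f) := by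
  refine ((ae_wmp_iff_ext hω_cont hω_pos _ _ _).1 (hTφ f)).trans (Eventually.of_forall fun x => ?_)
  rcases lt_or_ge x 0 with h | h
  · rw [ext0_neg _ h, cv_neg hneg (fun x hx => ext0_neg _ hx) x h]
  · rw [ext0_nonneg _ h]; rfl

theorem ae_shift {F G : ℝ → ℂ} (h : F =ᵐ[volume] G) (t : ℝ) :
    (fun x => F (x - t)) =ᵐ[volume] fun x => G (x - t) :=
  (measurePreserving_sub_right volume t).quasiMeasurePreserving.ae_eq_comp h

theorem cv_shift_right (φ F : ℝ → ℂ) (t x : ℝ) : cv φ (fun x => F (x - t)) x = cv φ F (x - t) := by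
  rw [cv, cv]; congr 1; ext y; rw [show x - y - t = x - t - y by ring]

theorem cv_shift_left (φ F : ℝ → ℂ) (t x : ℝ) : cv (fun x => φ (x - t)) F x = cv φ F (x - t) := by
  rw [cv, cv, ← integral_sub_right_eq_self (fun y => φ y * F (x - t - y)) t]
  congr 1; ext y; rw [show x - t - (y - t) = x - y by ring]

theorem SS_add {S : ℝ → (Lp ℂ p (wmp p.toReal ω) →L[ℂ] Lp ℂ p (wmp p.toReal ω))}
    (hω_cont : Continuous ω) (hω_pos : ∀ x, 0 < ω x)
    (hS : ∀ t : ℝ, 0 ≤ t → ∀ f, ext0 (S t f) =ᵐ[volume] fun x => ext0 f (x - t))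
    (s t : ℝ) (hs : 0 ≤ s) (ht : 0 ≤ t) : S (s + t) = S s * S t := by
  ext1 f
  apply Lp_ext0 hω_cont hω_pos
  refine (hS _ (add_nonneg hs ht) f).trans (EventuallyEq.symm ?_)
  refine (hS s hs (S t f)).trans ((ae_shift (hS t ht f) s).trans (Eventually.of_forall fun x => ?_))
  simp only; congr 1; ring

theorem S_zero {S : ℝ → (Lp ℂ p (wmp p.toReal ω) →L[ℂ] Lp ℂ p (wmp p.toReal ω))}
    (hω_cont : Continuous ω) (hω_pos : ∀ x, 0 < ω x)
    (hS : ∀ t : ℝ, 0 ≤ t → ∀ f, ext0 (S t f) =ᵐ[volume] fun x => ext0 f (x - t)) : S 0 = 1 := by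
  ext1 f
  apply Lp_ext0 hω_cont hω_pos
  refine (hS 0 le_rfl f).trans (Eventually.of_forall fun x => ?_)
  simp

theorem ext0_ST {S : ℝ → (Lp ℂ p (wmp p.toReal ω) →L[ℂ] Lp ℂ p (wmp p.toReal ω))}
    {T : Lp ℂ p (wmp p.toReal ω) →L[ℂ] Lp ℂ p (wmp p.toReal ω)} {φ : ℝ → ℂ}
    (hS : ∀ t : ℝ, 0 ≤ t → ∀ f, ext0 (S t f) =ᵐ[volume] fun x => ext0 f (x - t))
    (hT : ∀ f, ext0 (T f) =ᵐ[volume] cv φ (ext0 f)) (t : ℝ) (ht : 0 ≤ t) (f) :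
    ext0 ((S t * T) f) =ᵐ[volume] fun x => cv φ (ext0 f) (x - t) :=
  (hS t ht (T f)).trans (ae_shift (hT f) t)

theorem ST_comm {S : ℝ → (Lp ℂ p (wmp p.toReal ω) →L[ℂ] Lp ℂ p (wmp p.toReal ω))}
    {T : Lp ℂ p (wmp p.toReal ω) →L[ℂ] Lp ℂ p (wmp p.toReal ω)} {φ : ℝ → ℂ}
    (hω_cont : Continuous ω) (hω_pos : ∀ x, 0 < ω x)
    (hS : ∀ t : ℝ, 0 ≤ t → ∀ f, ext0 (S t f) =ᵐ[volume] fun x => ext0 f (x - t))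
    (hT : ∀ f, ext0 (T f) =ᵐ[volume] cv φ (ext0 f)) (t : ℝ) (ht : 0 ≤ t) :
    S t * T = T * S t := by
  ext1 f
  apply Lp_ext0 hω_cont hω_pos
  refine (ext0_ST hS hT t ht f).trans (EventuallyEq.symm ?_)
  refine (hT (S t f)).trans ?_
  rw [cv_congr φ (hS t ht f)]
  exact Eventually.of_forall fun x => cv_shift_right _ _ _ _

end ops

theorem cv_assoc {φ F : ℝ → ℂ} (hφ_cont : Continuous φ) (hφ_supp : HasCompactSupport φ)
    (hF : LocallyIntegrable F volume) : cv (cv φ φ) F = cv φ (cv φ F) := by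
  have hFn : LocallyIntegrable (fun x => ‖F x‖) volume := fun x => by
    obtain ⟨s, hs, h⟩ := hF x
    exact ⟨s, hs, h.norm⟩
  ext x
  simp only [cv_eq]
  refine convolution_assoc _ _ _ _ (fun x y z => by simp [mul_assoc]) hφ_cont.aestronglyMeasurable
    hφ_cont.aestronglyMeasurable hF.aestronglyMeasurable ?_ ?_ ?_
  · exact Eventually.of_forall fun y =>
      hφ_supp.convolutionExists_left _ hφ_cont hφ_cont.locallyIntegrable y
  · exact Eventually.of_forall fun y =>
      hφ_supp.norm.convolutionExists_left _ hφ_cont.norm hFn y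
  · refine hφ_supp.norm.convolutionExists_left _ hφ_cont.norm ?_ x
    exact (hφ_supp.norm.continuous_convolution_left _ hφ_cont.norm hFn).locallyIntegrable

theorem sub_dir {p : ℝ≥0∞} [hp1 : Fact (1 ≤ p)] (hp : p ≠ ∞) {ω : ℝ → ℝ}
    (hω_cont : Continuous ω) (hω_pos : ∀ x, 0 < ω x)
    (hω_sub : ∀ t : ℝ, 0 ≤ t → ∃ c C : ℝ, 0 < c ∧
      ∀ x : ℝ, 0 ≤ x → c ≤ ω (x + t) / ω x ∧ ω (x + t) / ω x ≤ C)
    {S : ℝ → (Lp ℂ p (wmp p.toReal ω) →L[ℂ] Lp ℂ p (wmp p.toReal ω))}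
    {T : Lp ℂ p (wmp p.toReal ω) →L[ℂ] Lp ℂ p (wmp p.toReal ω)} {φ : ℝ → ℂ}
    (hS : ∀ t : ℝ, 0 ≤ t → ∀ f, ext0 (S t f) =ᵐ[volume] fun x => ext0 f (x - t))
    (hT : ∀ f, ext0 (T f) =ᵐ[volume] cv φ (ext0 f))
    {α0 : ℝ} (hα0 : Tendsto (fun t : ℝ => Real.log ‖S t‖ / t) atTop (𝓝 α0))
    (hφ_cont : Continuous φ) (hφ_supp : HasCompactSupport φ) {L : ℝ}
    (hL : ∀ x, x ∉ Icc 0 L → φ x = 0) {l : ℂ} (hl0 : l ≠ 0) (hl : l ∈ spectrum ℂ T) :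
    ∃ z : ℂ, z.im ≤ α0 ∧ fourierLaplace φ z = l := by
  have hsc : ∀ x ∈ insert T (S '' Ici 0), ∀ y ∈ insert T (S '' Ici 0), x * y = y * x := by
    rintro x (rfl | ⟨s, hs, rfl⟩) y (rfl | ⟨t, ht, rfl⟩)
    · rfl
    · exact (ST_comm hω_cont hω_pos hS hT t ht).symm
    · exact ST_comm hω_cont hω_pos hS hT s hs
    · rw [← SS_add hω_cont hω_pos hS s t hs ht, ← SS_add hω_cont hω_pos hS t s ht hs, add_comm]
  obtain ⟨χ, hχ1, hχT, hχm⟩ := exists_char _ hsc T (mem_insert _ _) l hl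
  have hTs : T ∈ insert T (S '' Ici 0) := mem_insert _ _
  have hSs : ∀ t, 0 ≤ t → S t ∈ insert T (S '' Ici 0) := fun t ht =>
    mem_insert_of_mem _ (mem_image_of_mem _ ht)
  -- the translates
  obtain ⟨Bd, hBd⟩ := hφ_supp.exists_bound_of_continuous hφ_cont
  let φB : BoundedContinuousFunction ℝ ℂ := BoundedContinuousFunction.ofNormedAddCommGroup φ hφ_cont Bd hBd
  let tr : ℝ → BoundedContinuousFunction ℝ ℂ := fun t => φB.compContinuous ⟨fun x => x - t, by fun_prop⟩
  have htr : ∀ t x, tr t x = φ (x - t) := fun t x => rfl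
  have htr_cont : Continuous tr := by
    have huc := HasCompactSupport.uniformContinuous_of_continuous hφ_supp hφ_cont
    rw [Metric.continuous_iff]
    intro t ε hε
    obtain ⟨δ, hδ, h⟩ := Metric.uniformContinuous_iff.1 huc (ε/2) (by linarith)
    refine ⟨δ, hδ, fun s hs => ?_⟩
    refine lt_of_le_of_lt ((BoundedContinuousFunction.dist_le (by linarith)).2 fun x => ?_)
      (by linarith : ε/2 < ε)
    rw [htr, htr]
    refine (h ?_).le
    rw [dist_comm] at hs
    rw [Real.dist_eq] at hs ⊢
    rwa [show x - s - (x - t) = t - s by ring]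
  have hSTΨ : ∀ (L' t : ℝ), 0 ≤ t → t + L ≤ L' →
      ∀ Ψ : BoundedContinuousFunction ℝ ℂ →L[ℂ]
        (Lp ℂ p (wmp p.toReal ω) →L[ℂ] Lp ℂ p (wmp p.toReal ω)),
      (∀ ψ f, ext0 (Ψ ψ f) =ᵐ[volume] cv (indicator (Icc 0 L') ψ) (ext0 f)) →
      S t * T = Ψ (tr t) := by
    intro L' t ht htL Ψ hΨ
    ext1 f
    apply Lp_ext0 hω_cont hω_pos
    refine (ext0_ST hS hT t ht f).trans (EventuallyEq.symm ?_)
    refine (hΨ _ _).trans (Eventually.of_forall fun x => ?_)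
    have : indicator (Icc 0 L') (tr t) = fun x => φ (x - t) := by
      rw [indicator_eq_self.2]
      · rfl
      · intro y hy
        by_contra hcon
        apply hy
        rw [htr]
        apply hL
        rintro ⟨h1, h2⟩
        exact hcon ⟨by linarith, by linarith⟩
    rw [this, cv_shift_left]
  let m : ℝ → ℂ := fun t => χ (S t)
  have hm0 : m 0 = 1 := by simp only [m]; rw [S_zero hω_cont hω_pos hS, hχ1]
  have hmadd : ∀ s t, 0 ≤ s → 0 ≤ t → m (s + t) = m s * m t := by
    intro s t hs ht
    simp only [m]
    rw [SS_add hω_cont hω_pos hS s t hs ht, hχm _ (hSs s hs) _ (hSs t ht)]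
  have hmT : ∀ t, 0 ≤ t → χ (S t * T) = m t * l := fun t ht => by
    rw [hχm _ (hSs t ht) _ hTs, hχT]
  have hmc : ContinuousOn m (Ici 0) := by
    intro t ht
    have ht : 0 ≤ t := ht
    obtain ⟨Ψ, hΨ⟩ := exists_Psi p hp hω_cont hω_pos hω_sub (t + 1 + L)
    have hc : ContinuousOn m (Icc 0 (t + 1)) := by
      have : ContinuousOn (fun s => χ (Ψ (tr s)) / l) (Icc 0 (t + 1)) := by fun_prop
      refine this.congr fun s hs => ?_
      show m s = χ (Ψ (tr s)) / l
      rw [← hSTΨ _ s hs.1 (by linarith [hs.2]) Ψ hΨ, hmT s hs.1, mul_div_cancel_right₀ _ hl0]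
    refine (hc t ⟨ht, by linarith⟩).mono_of_mem_nhdsWithin ?_
    have : Iio (t+1) ∩ Ici 0 ∈ 𝓝[Ici 0] t :=
      inter_mem (mem_nhdsWithin_of_mem_nhds (Iio_mem_nhds (by linarith))) self_mem_nhdsWithin
    exact mem_of_superset this fun x hx => ⟨hx.2, le_of_lt hx.1⟩
  obtain ⟨a, ha⟩ := cauchy_exp m hm0 hmadd hmc
  -- value
  obtain ⟨Ψ, hΨ⟩ := exists_Psi p hp hω_cont hω_pos hω_sub (L + L)
  have hinteg : Integrable fun t => φ t • tr t := by
    apply Continuous.integrable_of_hasCompactSupport (by fun_prop)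
    exact hφ_supp.smul_right
  set g := ∫ t, φ t • tr t with hg
  have hgx : ∀ x, g x = cv φ φ x := by
    intro x
    have := (BoundedContinuousFunction.evalCLM ℂ x : BoundedContinuousFunction ℝ ℂ →L[ℂ] ℂ).integral_comp_comm hinteg
    simp only [BoundedContinuousFunction.evalCLM_apply] at this
    rw [hg, ← this]
    rfl
  have hTT : T * T = Ψ g := by
    ext1 f
    apply Lp_ext0 hω_cont hω_pos
    refine (hT (T f)).trans (EventuallyEq.symm ?_)
    refine (hΨ _ _).trans (Eventually.of_forall fun x => ?_)
    have : indicator (Icc 0 (L + L)) g = cv φ φ := by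
      ext y
      by_cases hy : y ∈ Icc 0 (L + L)
      · rw [indicator_of_mem hy, hgx]
      · rw [indicator_of_notMem hy, cv]
        symm
        convert integral_zero ℝ ℂ with u
        by_cases hu : u ∈ Icc 0 L
        · rw [hL (y - u), mul_zero]
          rintro ⟨h1, h2⟩
          exact hy ⟨by linarith [hu.1], by linarith [hu.2]⟩
        · rw [hL u hu, zero_mul]
    rw [this, cv_assoc hφ_cont hφ_supp (locInt hω_cont hω_pos p hp f), cv_congr φ (hT f)]
  have hval : l * l = (∫ t, φ t * Complex.exp (a * t)) * l := by
    have e1 : χ (T * T) = l * l := by rw [hχm _ hTs _ hTs, hχT]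
    rw [← e1, hTT, hg]
    have e2 := (χ.comp Ψ).integral_comp_comm hinteg
    simp only [ContinuousLinearMap.comp_apply] at e2
    rw [← e2, ← integral_mul_const]
    congr 1; ext t
    rw [map_smul, map_smul, smul_eq_mul]
    by_cases ht : t ∈ Icc 0 L
    · rw [← hSTΨ _ t ht.1 (by linarith [ht.2]) Ψ hΨ, hmT t ht.1, ha t ht.1, mul_assoc]
    · rw [hL t ht]; simp
  have hval' := mul_right_cancel₀ hl0 hval
  refine ⟨I * a, ?_, ?_⟩
  · have him : (I * a).im = a.re := by simp
    rw [him]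
    have hlim : Tendsto (fun t : ℝ => Real.log ‖χ‖ / t + Real.log ‖S t‖ / t) atTop (𝓝 (0 + α0)) :=
      (tendsto_const_nhds.div_atTop tendsto_id).add hα0
    rw [zero_add] at hlim
    refine ge_of_tendsto hlim ?_
    filter_upwards [eventually_gt_atTop 0] with t ht
    have h1 : Real.exp (a.re * t) ≤ ‖χ‖ * ‖S t‖ := by
      have := χ.le_opNorm (S t)
      have e : χ (S t) = Complex.exp (a * t) := ha t ht.le
      rw [e, Complex.norm_exp] at this
      simpa using this
    have h3 : 0 < ‖χ‖ * ‖S t‖ := lt_of_lt_of_le (Real.exp_pos _) h1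
    have h2 : 0 < ‖χ‖ := pos_of_mul_pos_left h3 (norm_nonneg _)
    have h4 : 0 < ‖S t‖ := pos_of_mul_pos_right h3 h2.le
    have h5 := (Real.le_log_iff_exp_le h3).2 h1
    rw [Real.log_mul h2.ne' h4.ne'] at h5
    rw [← add_div, le_div_iff₀ ht]
    exact h5
  · rw [hval', fourierLaplace]
    congr 1; ext t
    congr 2
    rw [← mul_assoc, neg_mul, I_mul_I]; ring

theorem lint_exp (B M : ℝ) (hM : 0 < M) (φ : ℝ → ℂ) (hB : ∀ x, ‖φ x‖ ≤ B) (hneg : ∀ x, x < 0 → φ x = 0) :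
    ∫⁻ y, ‖φ y‖ₑ * ENNReal.ofReal (Real.exp (-M * y)) ≤ ENNReal.ofReal (B / M) := by
  have hB0 : 0 ≤ B := (norm_nonneg _).trans (hB 0)
  have h1 : ∫⁻ y in Ioi (0:ℝ), ENNReal.ofReal (Real.exp (-M * y)) = ENNReal.ofReal (1 / M) := by
    rw [← ofReal_integral_eq_lintegral_ofReal]
    · rw [integral_exp_mul_Ioi (by linarith : -M < 0)]
      simp
    · exact integrableOn_exp_mul_Ioi (by linarith : -M < 0) 0
    · exact Eventually.of_forall fun x => (Real.exp_pos _).le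
  have h2 : ∫⁻ y, ‖φ y‖ₑ * ENNReal.ofReal (Real.exp (-M * y)) ≤
      ∫⁻ y, indicator (Ici (0:ℝ)) (fun y => ENNReal.ofReal B * ENNReal.ofReal (Real.exp (-M * y))) y := by
    refine lintegral_mono fun y => ?_
    rcases lt_or_ge y 0 with h | h
    · simp [hneg y h]
    · rw [indicator_of_mem (show y ∈ Ici (0:ℝ) from h)]
      gcongr
      rw [← ofReal_norm]
      exact ENNReal.ofReal_le_ofReal (hB y)
  refine h2.trans ?_
  rw [lintegral_indicator measurableSet_Ici, setLIntegral_congr Ioi_ae_eq_Ici.symm,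
    lintegral_const_mul' _ _ ENNReal.ofReal_ne_top, h1, ← ENNReal.ofReal_mul hB0]
  apply le_of_eq; congr 1; ring

theorem volterra {φ u : ℝ → ℂ} {B : ℝ} (hφ : Continuous φ) (hB : ∀ x, ‖φ x‖ ≤ B)
    (hneg : ∀ x, x < 0 → φ x = 0)
    (hu : LocallyIntegrable u volume) (hun : ∀ x, x < 0 → u x = 0) {l : ℂ} (hl : l ≠ 0)
    (h : ∀ᵐ x, cv φ u x = l * u x) : u =ᵐ[volume] 0 := by
  have hB0 : 0 ≤ B := (norm_nonneg _).trans (hB 0)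
  have hl' : 0 < ‖l‖ := norm_pos_iff.2 hl
  set M : ℝ := (B + 1) / ‖l‖ with hM
  have hM0 : 0 < M := by positivity
  have key : ∀ N : ℕ, ∀ᵐ x, x ∈ Icc (0:ℝ) N → u x = 0 := by
    intro N
    set E : ℝ → ℝ≥0∞ := fun x => ENNReal.ofReal (Real.exp (-M * x)) with hE
    have hEm : Measurable E := by fun_prop
    set v : ℝ → ℝ≥0∞ := indicator (Icc (0:ℝ) N) fun x => ‖u x‖ₑ * E x with hv
    have hvm : AEMeasurable v := (hu.aestronglyMeasurable.enorm.mul hEm.aemeasurable).indicator measurableSet_Icc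
    have hvfin : ∫⁻ x, v x < ∞ := by
      rw [hv, lintegral_indicator measurableSet_Icc]
      have h1 := (hu.integrableOn_isCompact (isCompact_Icc (a := (0:ℝ)) (b := N))).2
      refine lt_of_le_of_lt (setLIntegral_mono' measurableSet_Icc (g := fun x => ‖u x‖ₑ) fun x hx => ?_) h1
      have : E x ≤ 1 := by
        rw [hE]; simp only [ENNReal.ofReal_le_one, Real.exp_le_one_iff]
        nlinarith [hx.1]
      exact mul_le_of_le_one_right' this
    have hpt : ∀ᵐ x, ‖l‖ₑ * v x ≤ ∫⁻ y, (‖φ y‖ₑ * E y) * v (x - y) := by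
      filter_upwards [h] with x hx
      by_cases hxN : x ∈ Icc (0:ℝ) N
      · have e1 : ‖l‖ₑ * v x = ‖cv φ u x‖ₑ * E x := by
          rw [hx, enorm_mul, hv, indicator_of_mem hxN, mul_assoc]
        rw [e1]
        calc ‖cv φ u x‖ₑ * E x ≤ (∫⁻ y, ‖φ y * u (x - y)‖ₑ) * E x := by
              gcongr; exact enorm_integral_le_lintegral_enorm _
          _ = ∫⁻ y, ‖φ y * u (x - y)‖ₑ * E x := (lintegral_mul_const' _ _ ENNReal.ofReal_ne_top).symm
          _ ≤ _ := by
            refine lintegral_mono fun y => ?_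
            simp only
            rcases lt_or_ge y 0 with h1 | h1
            · simp [hneg y h1]
            rcases lt_or_ge (x - y) 0 with h2 | h2
            · simp [hun _ h2]
            have : x - y ∈ Icc (0:ℝ) N := ⟨h2, by linarith [hxN.2]⟩
            rw [hv, indicator_of_mem this, enorm_mul]
            have : E x = E y * E (x - y) := by
              simp only [hE]
              rw [← ENNReal.ofReal_mul (Real.exp_pos _).le, ← Real.exp_add]
              congr 2; ring
            rw [this]
            apply le_of_eq; ring
      · rw [hv, indicator_of_notMem hxN]; simp
    have hφm : Measurable fun y => ‖φ y‖ₑ * E y := (hφ.measurable.enorm).mul hEm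
    have hinteg : ‖l‖ₑ * ∫⁻ x, v x ≤ (∫⁻ y, ‖φ y‖ₑ * E y) * ∫⁻ x, v x := by
      rw [← lintegral_const_mul' _ _ enorm_ne_top]
      refine (lintegral_mono_ae hpt).trans ?_
      have hjm : AEMeasurable (Function.uncurry fun x y : ℝ => (‖φ y‖ₑ * E y) * v (x - y)) (volume.prod volume) := by
        have a1 : AEMeasurable (fun z : ℝ × ℝ => ‖φ z.2‖ₑ * E z.2) (volume.prod volume) :=
          (hφm.comp measurable_snd).aemeasurable
        have a2 : AEMeasurable (fun z : ℝ × ℝ => v (z.1 - z.2)) (volume.prod volume) :=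
          hvm.comp_quasiMeasurePreserving (quasiMeasurePreserving_sub volume volume)
        exact a1.mul a2
      rw [lintegral_lintegral_swap hjm]
      apply le_of_eq
      have : ∀ y, ∫⁻ x, (‖φ y‖ₑ * E y) * v (x - y) = (‖φ y‖ₑ * E y) * ∫⁻ x, v x := by
        intro y
        rw [lintegral_const_mul' _ _ (ENNReal.mul_ne_top enorm_ne_top ENNReal.ofReal_ne_top), lintegral_sub_right_eq_self]
      simp_rw [this]
      exact lintegral_mul_const' _ _ hvfin.ne
    have hlt : ∫⁻ y, ‖φ y‖ₑ * E y < ‖l‖ₑ := by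
      refine (lint_exp B M hM0 φ hB hneg).trans_lt ?_
      rw [← ofReal_norm, ENNReal.ofReal_lt_ofReal_iff hl', div_lt_iff₀ hM0, hM]
      field_simp
      linarith
    have hz : ∫⁻ x, v x = 0 := by
      by_contra hcon
      exact absurd hinteg (not_le.2 (ENNReal.mul_lt_mul_left hcon hvfin.ne hlt))
    rw [lintegral_eq_zero_iff' hvm] at hz
    filter_upwards [hz] with x hx hxN
    rw [hv, indicator_of_mem hxN] at hx
    simpa [hE, not_le.2 (Real.exp_pos _)] using hx
  filter_upwards [ae_all_iff.2 key] with x hx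
  rcases lt_or_ge x 0 with h1 | h1
  · exact hun x h1
  · obtain ⟨N, hN⟩ := exists_nat_ge x
    exact hx N ⟨h1, hN⟩

theorem upper_est {q : ℝ} (hq : 0 < q) {ω : ℝ → ℝ} {h : ℝ → ℂ} {L B W s : ℝ}
    (hout : ∀ x, x ∉ Icc 0 L → h x = 0) (hB0 : 0 ≤ B) (hB : ∀ x ∈ Icc 0 L, ‖h x‖ ≤ B)
    (hW : ∀ x ∈ Icc 0 L, ω (x + s) ≤ W) :
    ∫⁻ x, (‖h x‖ₑ * ENNReal.ofReal (ω (x + s))) ^ q ≤ ENNReal.ofReal (B * W) ^ q * ENNReal.ofReal L := by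
  calc _ ≤ ∫⁻ x, indicator (Icc 0 L) (fun _ => ENNReal.ofReal (B * W) ^ q) x := by
        refine lintegral_mono fun x => ?_
        by_cases hx : x ∈ Icc 0 L
        · simp only [indicator_of_mem hx]
          apply ENNReal.rpow_le_rpow _ hq.le
          rw [ENNReal.ofReal_mul hB0, ← ofReal_norm]
          exact mul_le_mul' (ENNReal.ofReal_le_ofReal (hB x hx)) (ENNReal.ofReal_le_ofReal (hW x hx))
        · simp [hout x hx, hq]
    _ = _ := by
        rw [lintegral_indicator_const measurableSet_Icc]; simp

theorem lower_est {q : ℝ} (hq : 0 < q) {ω : ℝ → ℝ} {K : ℝ → ℂ} {s t a W : ℝ} (ha : 0 ≤ a)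
    (hK : ∀ x ∈ Icc t (t + 1), a ≤ ‖K x‖) (hW : ∀ x ∈ Icc t (t + 1), W ≤ ω (x + s)) :
    ENNReal.ofReal (a * W) ^ q ≤ ∫⁻ x, (‖K x‖ₑ * ENNReal.ofReal (ω (x + s))) ^ q := by
  calc _ = ∫⁻ x, indicator (Icc t (t+1)) (fun _ => ENNReal.ofReal (a * W) ^ q) x := by
        rw [lintegral_indicator_const measurableSet_Icc]; simp
    _ ≤ _ := by
        refine lintegral_mono fun x => ?_
        by_cases hx : x ∈ Icc t (t + 1)
        · simp only [indicator_of_mem hx]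
          apply ENNReal.rpow_le_rpow _ hq.le
          rw [ENNReal.ofReal_mul ha, ← ofReal_norm]
          exact mul_le_mul' (ENNReal.ofReal_le_ofReal (hK x hx)) (ENNReal.ofReal_le_ofReal (hW x hx))
        · simp [indicator_of_notMem hx]

theorem sup_dir {p : ℝ≥0∞} [hp1 : Fact (1 ≤ p)] (hp : p ≠ ∞) {ω : ℝ → ℝ}
    (hω_cont : Continuous ω) (hω_pos : ∀ x, 0 < ω x)
    (hω_sub : ∀ t : ℝ, 0 ≤ t → ∃ c C : ℝ, 0 < c ∧
      ∀ x : ℝ, 0 ≤ x → c ≤ ω (x + t) / ω x ∧ ω (x + t) / ω x ≤ C)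
    {S : ℝ → (Lp ℂ p (wmp p.toReal ω) →L[ℂ] Lp ℂ p (wmp p.toReal ω))}
    {T : Lp ℂ p (wmp p.toReal ω) →L[ℂ] Lp ℂ p (wmp p.toReal ω)} {φ : ℝ → ℂ}
    (hS : ∀ t : ℝ, 0 ≤ t → ∀ f, ext0 (S t f) =ᵐ[volume] fun x => ext0 f (x - t))
    (hT : ∀ f, ext0 (T f) =ᵐ[volume] cv φ (ext0 f))
    {α0 : ℝ} (hα0 : Tendsto (fun t : ℝ => Real.log ‖S t‖ / t) atTop (𝓝 α0))
    (hφ_cont : Continuous φ) (hφ_supp : HasCompactSupport φ) {L : ℝ} (hL0 : 0 ≤ L)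
    (hL : ∀ x, x ∉ Icc 0 L → φ x = 0) {z : ℂ} (hz : z.im < α0) (hl0 : fourierLaplace φ z ≠ 0) :
    fourierLaplace φ z ∈ spectrum ℂ T := by
  have hp0 : p ≠ 0 := (lt_of_lt_of_le one_pos hp1.out).ne'
  have hq : 0 < p.toReal := ENNReal.toReal_pos hp0 hp
  have hq1 : 1 ≤ p.toReal := by
    rw [← ENNReal.toReal_one]; exact ENNReal.toReal_mono hp hp1.out
  obtain ⟨Bφ, hBφ⟩ := hφ_supp.exists_bound_of_continuous hφ_cont
  have hφneg : ∀ x, x < 0 → φ x = 0 := fun x hx => hL x fun h => absurd h.1 (not_le.2 hx)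
  set l := fourierLaplace φ z with hldef
  by_contra hns
  rw [spectrum.notMem_iff] at hns
  set A : Lp ℂ p (wmp p.toReal ω) →L[ℂ] Lp ℂ p (wmp p.toReal ω) := algebraMap ℂ _ l - T with hA
  obtain ⟨R, hAR, hRA⟩ : ∃ R, A * R = 1 ∧ R * A = 1 := by
    obtain ⟨U, hU⟩ := hns
    exact ⟨↑U⁻¹, by rw [← hU]; exact U.mul_inv, by rw [← hU]; exact U.inv_mul⟩
  set k : ℝ → ℂ := fun x => Complex.exp (I * z * x) with hk
  have hkc : Continuous k := by fun_prop
  have hknorm : ∀ x : ℝ, ‖k x‖ = Real.exp (-z.im * x) := by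
    intro x
    simp [hk, Complex.norm_exp]
  set K := ext0 k with hKdef
  have hKint : LocallyIntegrable K volume := hkc.locallyIntegrable.indicator measurableSet_Ici
  have hKneg : ∀ x, x < 0 → K x = 0 := fun x hx => ext0_neg _ hx
  have hcvK : Continuous (cv φ K) := by
    rw [cv_eq]; exact hφ_supp.continuous_convolution_left _ hφ_cont hKint
  set h : ℝ → ℂ := fun x => l * K x - cv φ K x with hh
  have hhneg : ∀ x, x < 0 → h x = 0 := fun x hx => by
    simp only [hh]; rw [hKneg x hx, cv_neg hφneg hKneg x hx]; simp
  have hhout : ∀ x, x ∉ Icc 0 L → h x = 0 := by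
    intro x hx
    rcases lt_or_ge x 0 with h0 | h0
    · exact hhneg x h0
    have hxL : L ≤ x := by
      by_contra hcon
      exact hx ⟨h0, by linarith⟩
    have : cv φ K x = l * k x := by
      rw [cv, hldef, fourierLaplace, ← integral_mul_const]
      congr 1; ext y
      by_cases hy : y ∈ Icc 0 L
      · rw [hKdef, ext0_nonneg _ (by linarith [hy.2]), mul_assoc]
        simp only [hk]
        rw [← Complex.exp_add]
        congr 2
        push_cast; ring
      · rw [hL y hy]; simp
    simp only [hh]
    rw [this, hKdef, ext0_nonneg _ h0, sub_self]
  obtain ⟨B, hB⟩ : ∃ B, ∀ x ∈ Icc 0 L, ‖h x‖ ≤ B := by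
    have hc : ContinuousOn (fun x => l * k x - cv φ K x) (Icc 0 L) := by fun_prop
    obtain ⟨B, hB⟩ := isCompact_Icc.exists_bound_of_continuousOn hc
    refine ⟨B, fun x hx => ?_⟩
    simp only [hh]
    rw [hKdef, ext0_nonneg _ hx.1]
    exact hB x hx
  have hB0 : 0 ≤ B := (norm_nonneg _).trans (hB 0 ⟨le_rfl, hL0⟩)
  obtain ⟨D, hD1, hD⟩ := weight_unif ω hω_cont hω_pos hω_sub (max L 1)
  have hup : ∀ s, 0 ≤ s → ∫⁻ x, (‖h x‖ₑ * ENNReal.ofReal (ω (x + s))) ^ p.toReal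
      ≤ ENNReal.ofReal (B * (D * ω s)) ^ p.toReal * ENNReal.ofReal L := by
    intro s hs
    refine upper_est hq hhout hB0 hB fun x hx => ?_
    rw [add_comm]
    exact (hD x hx.1 (hx.2.trans (le_max_left _ _)) s hs).1
  have hhm : AEStronglyMeasurable h volume :=
    (hKint.aestronglyMeasurable.const_mul l).sub hcvK.aestronglyMeasurable
  obtain ⟨f, hf⟩ := exists_Lp hω_cont hω_pos p hp h hhm hhneg (by
    have := hup 0 le_rfl
    simp only [add_zero] at this
    exact this.trans_lt (ENNReal.mul_lt_top (ENNReal.rpow_lt_top_of_nonneg hq.le ENNReal.ofReal_ne_top)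
      ENNReal.ofReal_lt_top))
  set g := R f with hg
  have hAg : A g = f := by
    have := congrArg (fun X => X f) hAR
    simpa using this
  have hAg' : l • g - T g = f := by
    rw [← hAg, hA]
    simp [Algebra.algebraMap_eq_smul_one]
  have hgK : ext0 g =ᵐ[volume] K := by
    have hgint := locInt hω_cont hω_pos p hp g
    have hu := volterra (u := fun x => ext0 g x - K x) hφ_cont hBφ hφneg (hgint.sub hKint)
      (fun x hx => by simp [ext0_neg _ hx, hKneg x hx]) hl0 (by
        have e1 := ext0_sub hω_cont hω_pos p (l • g) (T g)
        rw [hAg'] at e1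
        filter_upwards [e1, hf, ext0_smul hω_cont hω_pos p l g, hT g] with x h1 h2 h3 h4
        rw [h2, h3, h4] at h1
        have e2 : cv φ (fun x => ext0 g x - K x) x = cv φ (ext0 g) x - cv φ K x := by
          rw [cv, cv, cv, ← integral_sub
            (cv_integrable hφ_cont.aestronglyMeasurable hBφ hL hgint x)
            (cv_integrable hφ_cont.aestronglyMeasurable hBφ hL hKint x)]
          congr 1; ext y; ring
        rw [e2]
        simp only [hh] at h1
        linear_combination h1)
    filter_upwards [hu] with x hx
    exact sub_eq_zero.1 hx
  have hSR : ∀ s, 0 ≤ s → S s g = R (S s f) := by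
    intro s hs
    have c1 : S s * A = A * S s := by
      rw [hA, mul_sub, sub_mul, ST_comm hω_cont hω_pos hS hT s hs, Algebra.commutes]
    have c2 : S s * R = R * S s := by
      calc S s * R = (R * A) * (S s * R) := by rw [hRA, one_mul]
        _ = R * (A * S s) * R := by simp only [mul_assoc]
        _ = R * S s * (A * R) := by rw [← c1]; simp only [mul_assoc]
        _ = R * S s := by rw [hAR, mul_one]
    exact congrArg (fun X => X f) c2
  set y := z.im with hy
  have hlow : ∀ s t, 0 ≤ s → 0 ≤ t →
      ENNReal.ofReal (Real.exp (-y * t - |y|) * (ω (s + t) / D)) ^ p.toReal ≤ ‖S s g‖ₑ ^ p.toReal := by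
    intro s t hs ht
    rw [enorm_pow_NN hω_cont hω_pos p hp, NN_congr _ _ ((hS s hs g).trans (ae_shift hgK s)), NN_shift_eq]
    refine lower_est (t := t) hq (Real.exp_pos _).le (fun x hx => ?_) fun x hx => ?_
    · rw [hKdef, ext0_nonneg _ (ht.trans hx.1), hknorm]
      apply Real.exp_le_exp.2
      have h1 : 0 ≤ x - t := by linarith [hx.1]
      have h2 : x - t ≤ 1 := by linarith [hx.2]
      nlinarith [le_abs_self y, neg_abs_le y, abs_nonneg y]
    · rw [div_le_iff₀ (by linarith)]
      have := (hD (x - t) (by linarith [hx.1]) (by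
        refine le_trans ?_ (le_max_right _ _); linarith [hx.2]) (s + t) (by linarith)).2
      rw [show s + t + (x - t) = x + s by ring] at this
      linarith
  have hupS : ∀ s, 0 ≤ s → ‖S s f‖ₑ ^ p.toReal ≤ ENNReal.ofReal (B * (D * ω s) * (L + 1)) ^ p.toReal := by
    intro s hs
    rw [enorm_pow_NN hω_cont hω_pos p hp, NN_congr _ _ ((hS s hs f).trans (ae_shift hf s)), NN_shift_eq]
    refine (hup s hs).trans ?_
    rw [ENNReal.ofReal_mul (p := B * (D * ω s))
      (mul_nonneg hB0 (mul_nonneg (by linarith) (hω_pos s).le)), ENNReal.mul_rpow_of_nonneg _ _ hq.le]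
    gcongr
    have h1 : (1:ℝ≥0∞) ≤ ENNReal.ofReal (L + 1) := by
      rw [ENNReal.one_le_ofReal]; linarith
    calc ENNReal.ofReal L ≤ ENNReal.ofReal (L + 1) := ENNReal.ofReal_le_ofReal (by linarith)
      _ = ENNReal.ofReal (L + 1) ^ (1:ℝ) := (ENNReal.rpow_one _).symm
      _ ≤ _ := ENNReal.rpow_le_rpow_of_exponent_le h1 hq1
  set C : ℝ := D * Real.exp |y| * (‖R‖ * (B * D * (L + 1))) + 1 with hC
  have hC0 : 0 < C := by positivity
  have hgrow : ∀ t, 0 ≤ t → ∀ s, 0 ≤ s → ω (s + t) ≤ (C * Real.exp (y * t)) * ω s := by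
    intro t ht s hs
    have hD0 : 0 < D := by linarith
    have hωs := hω_pos s
    have h1 := (ENNReal.rpow_le_rpow_iff hq).1 (hlow s t hs ht)
    have h2 := (ENNReal.rpow_le_rpow_iff hq).1 (hupS s hs)
    rw [← ofReal_norm, ENNReal.ofReal_le_ofReal_iff (norm_nonneg _)] at h1
    rw [← ofReal_norm, ENNReal.ofReal_le_ofReal_iff (by positivity)] at h2
    rw [hSR s hs] at h1
    have h3 := (h1.trans (R.le_opNorm _)).trans (mul_le_mul_of_nonneg_left h2 (norm_nonneg R))
    have h4 : ω (s + t) = (Real.exp (-y * t - |y|) * (ω (s + t) / D)) * (D * Real.exp |y| * Real.exp (y * t)) := by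
      have : Real.exp (-y * t - |y|) * Real.exp |y| * Real.exp (y * t) = 1 := by
        rw [← Real.exp_add, ← Real.exp_add, Real.exp_eq_one_iff]; ring
      have hDD : D * D⁻¹ = 1 := mul_inv_cancel₀ hD0.ne'
      rw [div_eq_mul_inv]
      linear_combination (-1 : ℝ) * ω (s + t) * D * D⁻¹ * this - ω (s + t) * hDD
    rw [h4]
    calc _ ≤ (‖R‖ * (B * (D * ω s) * (L + 1))) * (D * Real.exp |y| * Real.exp (y * t)) :=
          mul_le_mul_of_nonneg_right h3 (by positivity)
      _ = ((C - 1) * Real.exp (y * t)) * ω s := by rw [hC]; ring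
      _ ≤ _ := by gcongr; linarith
  have hSle : ∀ t, 0 ≤ t → ‖S t‖ ≤ C * Real.exp (y * t) := by
    intro t ht
    have hc0 : 0 ≤ C * Real.exp (y * t) := by positivity
    refine ContinuousLinearMap.opNorm_le_bound _ hc0 fun F => ?_
    have h1 : ‖S t F‖ₑ ^ p.toReal ≤ ENNReal.ofReal (C * Real.exp (y * t) * ‖F‖) ^ p.toReal := by
      rw [ENNReal.ofReal_mul hc0, ENNReal.mul_rpow_of_nonneg _ _ hq.le, ofReal_norm,
        enorm_pow_NN hω_cont hω_pos p hp, NN_congr _ _ (hS t ht F), enorm_pow_NN hω_cont hω_pos p hp]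
      exact NN_shift_le _ hq ω _ (fun x hx => ext0_neg _ hx) t _ hc0 (hgrow t ht)
    have h2 := (ENNReal.rpow_le_rpow_iff hq).1 h1
    rwa [← ofReal_norm, ENNReal.ofReal_le_ofReal_iff (by positivity)] at h2
  have hSpos : ∀ t, 0 ≤ t → 0 < ‖S t‖ := by
    intro t ht
    rw [norm_pos_iff]
    intro h0
    have h1 := (ENNReal.rpow_le_rpow_iff hq).1 (hlow t 0 ht le_rfl)
    rw [h0] at h1
    simp only [zero_apply, enorm_zero, nonpos_iff_eq_zero, ENNReal.ofReal_eq_zero] at h1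
    have : 0 < Real.exp (-y * 0 - |y|) * (ω (t + 0) / D) :=
      mul_pos (Real.exp_pos _) (div_pos (hω_pos _) (by linarith))
    linarith
  have hlim : Tendsto (fun t : ℝ => Real.log C / t + y) atTop (𝓝 (0 + y)) :=
    (tendsto_const_nhds.div_atTop tendsto_id).add tendsto_const_nhds
  rw [zero_add] at hlim
  have : α0 ≤ y := by
    refine le_of_tendsto_of_tendsto hα0 hlim ?_
    filter_upwards [eventually_gt_atTop 0] with t ht
    have h1 := Real.log_le_log (hSpos t ht.le) (hSle t ht.le)
    rw [Real.log_mul hC0.ne' (Real.exp_pos _).ne', Real.log_exp] at h1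
    rw [div_le_iff₀ ht, add_mul, div_mul_cancel₀ _ ht.ne']
    exact h1
  linarith

theorem zero_mem_spec {p : ℝ≥0∞} [hp1 : Fact (1 ≤ p)] (hp : p ≠ ∞) {ω : ℝ → ℝ}
    (hω_cont : Continuous ω) (hω_pos : ∀ x, 0 < ω x)
    {T : Lp ℂ p (wmp p.toReal ω) →L[ℂ] Lp ℂ p (wmp p.toReal ω)} {φ : ℝ → ℂ}
    (hT : ∀ f, ext0 (T f) =ᵐ[volume] cv φ (ext0 f))
    (hφ_cont : Continuous φ) (hφ_supp : HasCompactSupport φ)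
    (hneg : ∀ x, x < 0 → φ x = 0) : (0 : ℂ) ∈ spectrum ℂ T := by
  have hp0 : p ≠ 0 := (lt_of_lt_of_le one_pos hp1.out).ne'
  have hq : 0 < p.toReal := ENNReal.toReal_pos hp0 hp
  by_contra hns
  rw [spectrum.notMem_iff, map_zero, zero_sub, IsUnit.neg_iff] at hns
  obtain ⟨U, hU⟩ := hns
  set F : ℝ → ℂ := indicator (Icc 0 1) (fun _ => 1) with hF
  obtain ⟨W, hW⟩ := (isCompact_Icc (a := (0:ℝ)) (b := 1)).exists_bound_of_continuousOn hω_cont.continuousOn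
  obtain ⟨e, he⟩ := exists_Lp hω_cont hω_pos p hp F
    ((measurable_const.indicator measurableSet_Icc).aestronglyMeasurable)
    (fun x hx => indicator_of_notMem (fun h => absurd h.1 (not_le.2 hx)) _) (by
      have := upper_est (ω := ω) (h := F) (L := 1) (B := 1) (W := W) (s := 0) hq
        (fun x hx => indicator_of_notMem hx _) zero_le_one
        (fun x hx => by rw [hF, indicator_of_mem hx]; simp)
        (fun x hx => by rw [add_zero]; exact (le_abs_self _).trans (hW x hx))
      simp only [add_zero] at this
      exact this.trans_lt (ENNReal.mul_lt_top (ENNReal.rpow_lt_top_of_nonneg hq.le ENNReal.ofReal_ne_top)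
        ENNReal.ofReal_lt_top))
  set f := (↑U⁻¹ : Lp ℂ p (wmp p.toReal ω) →L[ℂ] Lp ℂ p (wmp p.toReal ω)) e
  have hTf : T f = e := by
    have := congrArg (fun X : Lp ℂ p (wmp p.toReal ω) →L[ℂ] Lp ℂ p (wmp p.toReal ω) => X e) U.mul_inv
    rw [hU] at this
    exact this
  have hG : cv φ (ext0 f) =ᵐ[volume] F := by
    have := (hT f).symm
    rw [hTf] at this
    exact this.trans he
  have hGc : Continuous (cv φ (ext0 f)) := by
    rw [cv_eq]
    exact hφ_supp.continuous_convolution_left _ hφ_cont (locInt hω_cont hω_pos p hp f)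
  have h0 : cv φ (ext0 f) 0 = 0 := by
    have hcl : IsClosed {x | cv φ (ext0 f) x = 0} := isClosed_eq hGc continuous_const
    have hsub : Iio (0:ℝ) ⊆ {x | cv φ (ext0 f) x = 0} := fun x hx =>
      cv_neg hneg (fun x hx => ext0_neg _ hx) x hx
    have := hcl.closure_subset_iff.2 hsub
    rw [closure_Iio] at this
    exact this (mem_Iic.2 le_rfl)
  have h1 : cv φ (ext0 f) 0 = 1 := by
    have := MeasureTheory.Measure.eqOn_Icc_of_ae_eq (μ := volume) (f := cv φ (ext0 f))
      (g := fun _ => (1:ℂ)) (zero_ne_one (α := ℝ)) (by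
        refine EventuallyEq.trans (g := F) (ae_restrict_of_ae hG) ?_
        filter_upwards [ae_restrict_mem measurableSet_Icc] with x hx
        rw [hF, indicator_of_mem hx]) hGc.continuousOn continuousOn_const
    exact this ⟨le_rfl, zero_le_one⟩
  rw [h0] at h1
  exact zero_ne_one h1

theorem fl_continuous {φ : ℝ → ℂ} (hφ_cont : Continuous φ) (hφ_supp : HasCompactSupport φ) :
    Continuous (fourierLaplace φ) := by
  have h : ∀ z, fourierLaplace φ z =
      ∫ t in tsupport φ, φ t * Complex.exp (-Complex.I * z * (t : ℂ)) := by
    intro z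
    rw [fourierLaplace, setIntegral_eq_integral_of_forall_compl_eq_zero]
    intro t ht
    rw [image_eq_zero_of_notMem_tsupport ht, zero_mul]
  rw [show fourierLaplace φ = _ from funext h]
  exact continuous_parametric_integral_of_continuous (by fun_prop) hφ_supp

theorem fl_tendsto {φ : ℝ → ℂ} {B : ℝ} (hB : ∀ x, ‖φ x‖ ≤ B) (hneg : ∀ x, x < 0 → φ x = 0) :
    Tendsto (fun M : ℝ => fourierLaplace φ (-(M : ℂ) * I)) atTop (𝓝 0) := by
  have hlim : Tendsto (fun M : ℝ => B / M) atTop (𝓝 0) := tendsto_const_nhds.div_atTop tendsto_id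
  refine squeeze_zero_norm' ?_ hlim
  have hB0 : 0 ≤ B := (norm_nonneg _).trans (hB 0)
  filter_upwards [eventually_gt_atTop 0] with M hM
  have h1 : ‖fourierLaplace φ (-(M : ℂ) * I)‖ₑ ≤ ENNReal.ofReal (B / M) := by
    refine (enorm_integral_le_lintegral_enorm _).trans (le_trans (le_of_eq ?_) (lint_exp B M hM φ hB hneg))
    congr 1; ext t
    rw [enorm_mul]
    congr 1
    rw [← ofReal_norm, Complex.norm_exp]
    congr 2
    have : -I * (-(M:ℂ) * I) * t = ((-M * t : ℝ) : ℂ) := by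
      push_cast
      linear_combination (M : ℂ) * t * I_mul_I
    rw [this, ofReal_re]
  rwa [← ofReal_norm, ENNReal.ofReal_le_ofReal_iff (by positivity)] at h1

/-- Theorem 5(i): for `φ ∈ C_c(ℝ)` with `supp φ ⊆ ℝ⁺`, the spectrum of the Wiener–Hopf operator
`T_φ` on `𝐄 = L^p_ω(ℝ⁺)` equals the closure of `φ̂(𝒪)`, `𝒪 = {Im z < 𝛂₀}`. -/
theorem thm5_i
    (p : ℝ≥0∞) [Fact (1 ≤ p)] (hp : p ≠ ∞)
    (ω : ℝ → ℝ) (hω_cont : Continuous ω) (hω_pos : ∀ x, 0 < ω x)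
    (hω_sub : ∀ t : ℝ, 0 ≤ t → ∃ c C : ℝ, 0 < c ∧
      ∀ x : ℝ, 0 ≤ x → c ≤ ω (x + t) / ω x ∧ ω (x + t) / ω x ≤ C)
    (Sp : ℝ → (Lp ℂ p (wmp p.toReal ω) →L[ℂ] Lp ℂ p (wmp p.toReal ω)))
    (hSp : ∀ t : ℝ, 0 ≤ t → ∀ f : Lp ℂ p (wmp p.toReal ω),
      (Sp t f : ℝ → ℂ) =ᵐ[wmp p.toReal ω] fun x => if t ≤ x then f (x - t) else 0)
    (α0 : ℝ) (hα0 : Tendsto (fun t : ℝ => Real.log ‖Sp t‖ / t) atTop (𝓝 α0))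
    (φ : ℝ → ℂ) (hφ_cont : Continuous φ) (hφ_supp : HasCompactSupport φ)
    (hφ_plus : tsupport φ ⊆ Set.Ici (0 : ℝ))
    (Tφ : Lp ℂ p (wmp p.toReal ω) →L[ℂ] Lp ℂ p (wmp p.toReal ω))
    (hTφ : ∀ f : Lp ℂ p (wmp p.toReal ω),
      (Tφ f : ℝ → ℂ) =ᵐ[wmp p.toReal ω]
        fun x => ∫ y : ℝ, φ y * Set.indicator (Set.Ici (0 : ℝ)) (⇑f) (x - y)) :
    spectrum ℂ Tφ = closure (fourierLaplace φ '' {z : ℂ | z.im < α0}) := by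
  obtain ⟨L, hL0, hL⟩ : ∃ L : ℝ, 0 ≤ L ∧ ∀ x, x ∉ Icc 0 L → φ x = 0 := by
    obtain ⟨b, hb⟩ := hφ_supp.isCompact.bddAbove
    refine ⟨max b 0, le_max_right _ _, fun x hx => ?_⟩
    by_contra hne
    have hm : x ∈ tsupport φ := subset_tsupport _ hne
    exact hx ⟨hφ_plus hm, (hb hm).trans (le_max_left _ _)⟩
  have hneg : ∀ x, x < 0 → φ x = 0 := fun x hx => hL x fun h => absurd h.1 (not_le.2 hx)
  have hS := ext0_S hω_cont hω_pos hSp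
  have hT := ext0_T hω_cont hω_pos hneg hTφ
  have hflc := fl_continuous hφ_cont hφ_supp
  apply Subset.antisymm
  · intro l hl
    by_cases hl0 : l = 0
    · subst hl0
      obtain ⟨B, hB⟩ := hφ_supp.exists_bound_of_continuous hφ_cont
      refine mem_closure_of_tendsto (fl_tendsto hB hneg) ?_
      filter_upwards [eventually_gt_atTop (-α0)] with M hM
      refine mem_image_of_mem _ ?_
      show (-(M : ℂ) * I).im < α0
      simp
      linarith
    · obtain ⟨z, hz, rfl⟩ := sub_dir hp hω_cont hω_pos hω_sub hS hT hα0 hφ_cont hφ_supp hL hl0 hl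
      refine image_closure_subset_closure_image hflc (mem_image_of_mem _ ?_)
      rw [Complex.closure_setOfPred_im_lt]
      exact hz
  · refine closure_minimal ?_ (spectrum.isClosed Tφ)
    rintro _ ⟨z, hz, rfl⟩
    by_cases hl0 : fourierLaplace φ z = 0
    · rw [hl0]
      exact zero_mem_spec hp hω_cont hω_pos hT hφ_cont hφ_supp hneg
    · exact sup_dir hp hω_cont hω_pos hω_sub hS hT hα0 hφ_cont hφ_supp hL0 hL hz hl0
end
end

section
/- Let 𝒜 be the closed commutative subalgebra of bounded operators on 𝐄 generated by {T_φ : φ ∈ C_c(ℝ), supp(φ) ⊂ ℝ^+} together with {𝐒_x : x ≥ 0}. Let γ be a (nonzero, continuous, multiplicative) character of 𝒜 and suppose γ(T_φ) ≠ 0 for some φ ∈ C_c(ℝ) with supp(φ) ⊂ ℝ^+. Then the function θ_γ(x) = γ(𝐒_x) is continuous and nonvanishing on ℝ^+, there exists λ ∈ ℂ such that γ(𝐒_x) = e^{λx} for all x ≥ 0 with e^λ ∈ σ(𝐒_1), and γ(T_ψ) = ∫_0^∞ ψ(x) e^{λx} dx for every ψ ∈ C_c(ℝ) with supp(ψ)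 ⊂ ℝ^+. (Key intermediate claim in the proof of Theorem 5) -/
open MeasureTheory Filter Complex Set
open scoped Real ENNReal Topology NNReal

noncomputable section

/-! ### Basic facts on the measure -/

theorem wmp_dens_meas (q : ℝ) (ω : ℝ → ℝ) (hω_cont : Continuous ω) :
    Measurable fun x => ENNReal.ofReal (ω x ^ q) := by
  have := hω_cont.measurable
  fun_prop

theorem wmp_ae_iff (q : ℝ) (ω : ℝ → ℝ) (hω_cont : Continuous ω) (hω_pos : ∀ x, 0 < ω x)
    (P : ℝ → Prop) :
    (∀ᵐ x ∂(wmp q ω), P x) ↔ ∀ᵐ x, 0 ≤ x → P x := by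
  unfold wmp
  rw [ae_withDensity_iff (wmp_dens_meas q ω hω_cont), ae_restrict_iff' measurableSet_Ici]
  have : ∀ x, ENNReal.ofReal (ω x ^ q) ≠ 0 := fun x => by
    have := Real.rpow_pos_of_pos (hω_pos x) q
    simpa using this
  simp [this]

theorem wmp_lintegral (q : ℝ) (ω : ℝ → ℝ) (hω_cont : Continuous ω) (g : ℝ → ℝ≥0∞) :
    ∫⁻ x, g x ∂(wmp q ω) = ∫⁻ x in Ici 0, ENNReal.ofReal (ω x ^ q) * g x := by
  unfold wmp
  rw [lintegral_withDensity_eq_lintegral_mul_non_measurable _ (wmp_dens_meas q ω hω_cont)]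
  · rfl
  · exact ae_of_all _ fun x => ENNReal.ofReal_lt_top

theorem wmp_locfin (q : ℝ) (hq : 0 ≤ q) (ω : ℝ → ℝ) (hω_cont : Continuous ω) :
    IsLocallyFiniteMeasure (wmp q ω) := by
  unfold wmp
  apply IsLocallyFiniteMeasure.withDensity_ofReal
  exact hω_cont.rpow_const (fun x => Or.inr hq)

theorem wmp_ae_shift (q : ℝ) (ω : ℝ → ℝ) (hω_cont : Continuous ω) (hω_pos : ∀ x, 0 < ω x)
    (P : ℝ → Prop) (h : ∀ᵐ x ∂(wmp q ω), P x) (t : ℝ) :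
    ∀ᵐ x ∂(wmp q ω), t ≤ x → P (x - t) := by
  rw [wmp_ae_iff q ω hω_cont hω_pos] at h ⊢
  have := (measurePreserving_sub_right volume t).quasiMeasurePreserving.ae h
  filter_upwards [this] with x hx _ hxt
  exact hx (by linarith)

/-! ### Local boundedness of the weight quotients -/

theorem weight_local_bound (ω : ℝ → ℝ) (hω_cont : Continuous ω) (hω_pos : ∀ x, 0 < ω x)
    (hω_sub : ∀ t : ℝ, 0 ≤ t → ∃ c C : ℝ, 0 < c ∧
      ∀ x : ℝ, 0 ≤ x → c ≤ ω (x + t) / ω x ∧ ω (x + t) / ω x ≤ C) (T : ℝ) :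
    ∃ M : ℝ, 0 < M ∧ ∀ t, 0 ≤ t → t ≤ T → ∀ x, 0 ≤ x → ω (x + t) ≤ M * ω x := by
  -- Baire
  obtain ⟨n, hn⟩ := nonempty_interior_of_iUnion_of_closed
    (f := fun n : ℕ => {t : ℝ | ∀ x, 0 ≤ x → ω (x + |t|) ≤ n * ω x})
    (fun n => by
      simp only [ofPred_forall]
      refine isClosed_iInter fun x => isClosed_iInter fun _ => ?_
      exact isClosed_le (by fun_prop) (by fun_prop))
    (by
      rw [eq_univ_iff_forall]
      intro t
      obtain ⟨c, C, hc, h⟩ := hω_sub |t| (abs_nonneg t)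
      obtain ⟨n, hn⟩ := exists_nat_ge C
      refine mem_iUnion.2 ⟨n, fun x hx => ?_⟩
      have := (h x hx).2
      rw [div_le_iff₀ (hω_pos x)] at this
      exact this.trans (mul_le_mul_of_nonneg_right hn (hω_pos x).le))
  obtain ⟨a, ha⟩ := hn
  rw [mem_interior_iff_mem_nhds, Metric.mem_nhds_iff] at ha
  obtain ⟨ε, hε, hball⟩ := ha
  have key : ∃ b δ : ℝ, 0 ≤ b ∧ 0 < δ ∧ ∀ s, 0 ≤ s → s ≤ δ → ∀ x, 0 ≤ x →
      ω (x + (b + s)) ≤ n * ω x := by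
    refine ⟨|a|, ε / 2, abs_nonneg a, by positivity, fun s hs hs' x hx => ?_⟩
    rcases le_or_gt 0 a with h0 | h0
    · have hm : a + s ∈ Metric.ball a ε := by
        rw [Metric.mem_ball, Real.dist_eq, add_sub_cancel_left, abs_of_nonneg hs]; linarith
      have := hball hm x hx
      rwa [abs_of_nonneg (by linarith : 0 ≤ a + s), ← abs_of_nonneg h0] at this
      
    · have hm : a - s ∈ Metric.ball a ε := by
        rw [Metric.mem_ball, Real.dist_eq, sub_sub_cancel_left, abs_neg, abs_of_nonneg hs]
        linarith
      have := hball hm x hx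
      rw [abs_of_neg (by linarith : a - s < 0)] at this
      rw [abs_of_neg h0]
      convert this using 3
      ring
  obtain ⟨b, δ, hb, hδ, hk⟩ := key
  obtain ⟨c, C, hc, hcC⟩ := hω_sub b hb
  have hn0 : (0 : ℝ) ≤ n := Nat.cast_nonneg n
  have step : ∀ s, 0 ≤ s → s ≤ δ → ∀ x, 0 ≤ x → ω (x + s) ≤ (n / c + 1) * ω x := by
    intro s hs hs' x hx
    have h1 := hk s hs hs' x hx
    have h2 := (hcC (x + s) (by linarith)).1
    rw [le_div_iff₀ (hω_pos _)] at h2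
    have e : x + (b + s) = x + s + b := by ring
    rw [e] at h1
    have h3 : ω (x + s) ≤ n * ω x / c := by
      rw [le_div_iff₀ hc]; linarith
    have : (n / c + 1) * ω x = n * ω x / c + ω x := by ring
    rw [this]
    linarith [hω_pos x]
  have hM1 : (1 : ℝ) ≤ n / c + 1 := by
    have : (0 : ℝ) ≤ n / c := by positivity
    linarith
  have iter : ∀ k : ℕ, ∀ t, 0 ≤ t → t ≤ k * δ → ∀ x, 0 ≤ x →
      ω (x + t) ≤ (n / c + 1) ^ k * ω x := by
    intro k
    induction k with
    | zero =>
      intro t ht ht' x hx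
      have : t = 0 := le_antisymm (by simpa using ht') ht
      simp [this]
    | succ k ih =>
      intro t ht ht' x hx
      push_cast at ht'
      rcases le_or_gt t δ with h | h
      · refine (step t ht h x hx).trans (mul_le_mul_of_nonneg_right ?_ (hω_pos x).le)
        exact le_self_pow₀ hM1 (Nat.succ_ne_zero k)
      · have h1 := step δ hδ.le le_rfl (x + (t - δ)) (by linarith)
        have h2 := ih (t - δ) (by linarith) (by linarith) x hx
        have e : x + (t - δ) + δ = x + t := by ring
        rw [e] at h1
        refine h1.trans ?_
        rw [pow_succ', mul_assoc]
        exact mul_le_mul_of_nonneg_left h2 (by linarith)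
  obtain ⟨k, hk⟩ := exists_nat_ge (T / δ)
  refine ⟨(n / c + 1) ^ k, by positivity, fun t ht hT x hx => iter k t ht ?_ x hx⟩
  rw [div_le_iff₀ hδ] at hk
  linarith

/-- If the weight quotient is bounded by `M`, then the translation has norm at most `M`. -/
theorem shift_lintegral_le (q : ℝ) (hq : 0 ≤ q) (ω : ℝ → ℝ) (hω_cont : Continuous ω)
    (hω_pos : ∀ x, 0 < ω x) (t : ℝ) (ht : 0 ≤ t) (M : ℝ) (hM : 0 ≤ M)
    (hb : ∀ x, 0 ≤ x → ω (x + t) ≤ M * ω x) (g : ℝ → ℝ≥0∞) :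
    ∫⁻ x, (if t ≤ x then g (x - t) else 0) ∂(wmp q ω) ≤
      ENNReal.ofReal (M ^ q) * ∫⁻ x, g x ∂(wmp q ω) := by
  rw [wmp_lintegral q ω hω_cont, wmp_lintegral q ω hω_cont,
    ← lintegral_const_mul' _ _ ENNReal.ofReal_ne_top,
    ← lintegral_indicator measurableSet_Ici, ← lintegral_indicator measurableSet_Ici,
    ← lintegral_add_right_eq_self _ t]
  refine lintegral_mono fun x => ?_
  by_cases hx : 0 ≤ x
  · have h1 : x + t ∈ Ici (0 : ℝ) := by simp; linarith
    rw [indicator_of_mem h1, indicator_of_mem (show x ∈ Ici (0 : ℝ) from hx), if_pos (by linarith),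
      add_sub_cancel_right, ← mul_assoc, ← ENNReal.ofReal_mul (by positivity),
      ← Real.mul_rpow hM (hω_pos x).le]
    gcongr
    · exact (hω_pos _).le
    · exact hb x hx
  · have : ¬ t ≤ x + t := by linarith
    simp [indicator, this]

theorem Sp_norm_le (p : ℝ≥0∞) [Fact (1 ≤ p)] (hp : p ≠ ∞)
    (ω : ℝ → ℝ) (hω_cont : Continuous ω) (hω_pos : ∀ x, 0 < ω x)
    (t : ℝ) (ht : 0 ≤ t)
    (S : Lp ℂ p (wmp p.toReal ω) →L[ℂ] Lp ℂ p (wmp p.toReal ω))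
    (hS : ∀ f : Lp ℂ p (wmp p.toReal ω),
      (S f : ℝ → ℂ) =ᵐ[wmp p.toReal ω] fun x => if t ≤ x then f (x - t) else 0)
    (M : ℝ) (hM : 0 ≤ M)
    (hb : ∀ x, 0 ≤ x → ω (x + t) ≤ M * ω x) : ‖S‖ ≤ M := by
  have hp1 : 1 ≤ p := Fact.out
  have hp0 : p ≠ 0 := (zero_lt_one.trans_le hp1).ne'
  have hq : 0 < p.toReal := ENNReal.toReal_pos hp0 hp
  refine ContinuousLinearMap.opNorm_le_bound _ hM fun f => ?_
  rw [Lp.norm_def, Lp.norm_def, ← ENNReal.toReal_ofReal hM, ← ENNReal.toReal_mul]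
  refine ENNReal.toReal_mono (ENNReal.mul_ne_top ENNReal.ofReal_ne_top (Lp.eLpNorm_ne_top f)) ?_
  rw [eLpNorm_congr_ae (hS f), eLpNorm_eq_lintegral_rpow_enorm_toReal hp0 hp,
    eLpNorm_eq_lintegral_rpow_enorm_toReal hp0 hp]
  have h := shift_lintegral_le p.toReal hq.le ω hω_cont hω_pos t ht M hM hb
    (fun x => ‖f x‖ₑ ^ p.toReal)
  have e : (fun x => ‖if t ≤ x then f (x - t) else 0‖ₑ ^ p.toReal) =
      fun x => if t ≤ x then ‖f (x - t)‖ₑ ^ p.toReal else 0 := by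
    funext x
    split_ifs <;> simp [hq]
  rw [e]
  refine (ENNReal.rpow_le_rpow h (by positivity)).trans ?_
  rw [ENNReal.mul_rpow_of_nonneg _ _ (by positivity), ENNReal.ofReal_rpow_of_nonneg (by positivity) (by positivity),
    ← Real.rpow_mul hM, mul_one_div_cancel hq.ne', Real.rpow_one]

/-! ### The semigroup law and strong continuity -/

theorem Sp_add (p : ℝ≥0∞) [Fact (1 ≤ p)]
    (ω : ℝ → ℝ) (hω_cont : Continuous ω) (hω_pos : ∀ x, 0 < ω x)
    (Sp : ℝ → (Lp ℂ p (wmp p.toReal ω) →L[ℂ] Lp ℂ p (wmp p.toReal ω)))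
    (hSp : ∀ t : ℝ, 0 ≤ t → ∀ f : Lp ℂ p (wmp p.toReal ω),
      (Sp t f : ℝ → ℂ) =ᵐ[wmp p.toReal ω] fun x => if t ≤ x then f (x - t) else 0)
    (s t : ℝ) (hs : 0 ≤ s) (ht : 0 ≤ t) : Sp (s + t) = Sp s * Sp t := by
  ext1 f
  rw [mul_apply_eq_comp]
  apply Lp.ext
  have h1 := wmp_ae_shift p.toReal ω hω_cont hω_pos _ (hSp t ht f) s
  filter_upwards [hSp (s + t) (by linarith) f, hSp s hs (Sp t f), h1] with x hx1 hx2 hx3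
  rw [hx1, hx2]
  by_cases h : s ≤ x
  · rw [if_pos h, hx3 h]
    by_cases h' : t ≤ x - s
    · rw [if_pos h', if_pos (by linarith), sub_sub]
    · rw [if_neg h', if_neg (by linarith)]
  · rw [if_neg h, if_neg (by linarith)]

theorem Sp_zero (p : ℝ≥0∞) [Fact (1 ≤ p)]
    (ω : ℝ → ℝ) (hω_cont : Continuous ω) (hω_pos : ∀ x, 0 < ω x)
    (Sp : ℝ → (Lp ℂ p (wmp p.toReal ω) →L[ℂ] Lp ℂ p (wmp p.toReal ω)))
    (hSp : ∀ t : ℝ, 0 ≤ t → ∀ f : Lp ℂ p (wmp p.toReal ω),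
      (Sp t f : ℝ → ℂ) =ᵐ[wmp p.toReal ω] fun x => if t ≤ x then f (x - t) else 0) :
    Sp 0 = 1 := by
  ext1 f
  apply Lp.ext
  have h0 : ∀ᵐ x ∂(wmp p.toReal ω), 0 ≤ x := by
    rw [wmp_ae_iff p.toReal ω hω_cont hω_pos]
    exact ae_of_all _ fun x h => h
  filter_upwards [hSp 0 le_rfl f, h0] with x hx1 hx2
  rw [hx1, if_pos hx2, sub_zero]
  rfl

theorem Sp_cont_Cc (p : ℝ≥0∞) [Fact (1 ≤ p)] (hp : p ≠ ∞)
    (ω : ℝ → ℝ) (hω_cont : Continuous ω) (hω_pos : ∀ x, 0 < ω x)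
    (Sp : ℝ → (Lp ℂ p (wmp p.toReal ω) →L[ℂ] Lp ℂ p (wmp p.toReal ω)))
    (hSp : ∀ t : ℝ, 0 ≤ t → ∀ f : Lp ℂ p (wmp p.toReal ω),
      (Sp t f : ℝ → ℂ) =ᵐ[wmp p.toReal ω] fun x => if t ≤ x then f (x - t) else 0)
    (g : ℝ → ℂ) (hg : Continuous g) (hgs : HasCompactSupport g)
    (hgL : MemLp g p (wmp p.toReal ω)) (t₀ : ℝ) (ht₀ : 0 ≤ t₀) :
    Tendsto (fun t => Sp t hgL.toLp) (𝓝[Ici 0] t₀) (𝓝 (Sp t₀ hgL.toLp)) := by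
  have hp1 : 1 ≤ p := Fact.out
  have hp0 : p ≠ 0 := (zero_lt_one.trans_le hp1).ne'
  have hq : 0 < p.toReal := ENNReal.toReal_pos hp0 hp
  have := wmp_locfin p.toReal hq.le ω hω_cont
  have hform : ∀ t, 0 ≤ t → (Sp t hgL.toLp : ℝ → ℂ) =ᵐ[wmp p.toReal ω]
      fun x => if t ≤ x then g (x - t) else 0 := by
    intro t ht
    filter_upwards [hSp t ht hgL.toLp,
      wmp_ae_shift p.toReal ω hω_cont hω_pos _ hgL.coeFn_toLp t] with x h1 h2
    rw [h1]
    split_ifs with h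
    · exact h2 h
    · rfl
  rw [Lp.tendsto_Lp_iff_tendsto_eLpNorm']
  have hE : ∀ᶠ t in 𝓝[Ici 0] t₀,
      eLpNorm (fun x => (if t ≤ x then g (x - t) else 0) - (if t₀ ≤ x then g (x - t₀) else 0)) p
        (wmp p.toReal ω) = eLpNorm (⇑(Sp t hgL.toLp) - ⇑(Sp t₀ hgL.toLp)) p (wmp p.toReal ω) := by
    filter_upwards [self_mem_nhdsWithin] with t ht
    exact (eLpNorm_congr_ae ((hform t ht).sub (hform t₀ ht₀))).symm
  refine Tendsto.congr' hE ?_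
  simp_rw [eLpNorm_eq_lintegral_rpow_enorm_toReal hp0 hp]
  have hz : (0 : ℝ≥0∞) = 0 ^ (1 / p.toReal) := by
    rw [ENNReal.zero_rpow_of_pos (by positivity)]
  rw [hz]
  refine (ENNReal.continuous_rpow_const.tendsto 0).comp ?_
  obtain ⟨B, hB⟩ := hgs.exists_bound_of_continuous hg
  have hB0 : 0 ≤ B := (norm_nonneg _).trans (hB 0)
  obtain ⟨R, hR⟩ : ∃ R : ℝ, ∀ x, g x ≠ 0 → x ≤ R := by
    obtain ⟨R, hR⟩ := hgs.isCompact.bddAbove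
    exact ⟨R, fun x hx => hR (subset_tsupport g hx)⟩
  have hint : (0 : ℝ≥0∞) = ∫⁻ x, 0 ∂(wmp p.toReal ω) := by simp
  rw [hint]
  refine tendsto_lintegral_filter_of_dominated_convergence
    (fun x => (Icc 0 (R + (t₀ + 1))).indicator (fun _ => ENNReal.ofReal (2 * B) ^ p.toReal) x)
    ?_ ?_ ?_ ?_
  · refine Eventually.of_forall fun t => ?_
    have h1 : ∀ t : ℝ, Measurable fun x => if t ≤ x then g (x - t) else 0 := fun t =>
      Measurable.ite measurableSet_Ici (hg.measurable.comp (measurable_id.sub_const t))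
        measurable_const
    exact (((h1 t).sub (h1 t₀)).enorm).pow_const _
  · have hnear : ∀ᶠ t in 𝓝[Ici 0] t₀, t < t₀ + 1 :=
      nhdsWithin_le_nhds (Iio_mem_nhds (by linarith))
    filter_upwards [hnear] with t ht
    rw [wmp_ae_iff p.toReal ω hω_cont hω_pos]
    refine ae_of_all _ fun x hx => ?_
    by_cases hxR : x ≤ R + (t₀ + 1)
    · rw [indicator_of_mem (show x ∈ Icc 0 (R + (t₀ + 1)) from ⟨hx, hxR⟩)]
      refine ENNReal.rpow_le_rpow ?_ hq.le
      rw [← ofReal_norm]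
      refine ENNReal.ofReal_le_ofReal ?_
      refine (norm_sub_le _ _).trans ?_
      have h1 : ∀ t : ℝ, ‖if t ≤ x then g (x - t) else 0‖ ≤ B := by
        intro t
        split_ifs
        · exact hB _
        · simpa using hB0
      linarith [h1 t, h1 t₀]
    · have h1 : ∀ t : ℝ, t ≤ t₀ + 1 → (if t ≤ x then g (x - t) else 0) = 0 := by
        intro t ht
        split_ifs
        · by_contra h
          have := hR _ h
          linarith
        · rfl
      rw [h1 t ht.le, h1 t₀ (by linarith)]
      simp [hq]
  · rw [lintegral_indicator_const measurableSet_Icc]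
    exact ENNReal.mul_ne_top (ENNReal.rpow_ne_top_of_nonneg hq.le ENNReal.ofReal_ne_top)
      isCompact_Icc.measure_lt_top.ne
  · rw [wmp_ae_iff p.toReal ω hω_cont hω_pos]
    have hne : ∀ᵐ x : ℝ, x ≠ t₀ := by
      simp [ae_iff]
    filter_upwards [hne] with x hx _
    have hz' : (0 : ℝ≥0∞) = ‖(if t₀ ≤ x then g (x - t₀) else 0) -
        (if t₀ ≤ x then g (x - t₀) else 0)‖ₑ ^ p.toReal := by simp [hq]
    rw [hz']
    refine ((ENNReal.continuous_rpow_const.comp continuous_enorm).tendsto _).comp ?_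
    refine Tendsto.sub_const ?_ _
    refine Tendsto.mono_left ?_ nhdsWithin_le_nhds
    rcases lt_or_gt_of_ne hx with h | h
    · rw [if_neg (by linarith)]
      refine Tendsto.congr' ?_ tendsto_const_nhds
      filter_upwards [Ioi_mem_nhds h] with t ht
      rw [if_neg (not_le.2 ht)]
    · rw [if_pos h.le]
      have hc : Tendsto (fun t => g (x - t)) (𝓝 t₀) (𝓝 (g (x - t₀))) :=
        Continuous.tendsto (by fun_prop) t₀
      refine hc.congr' ?_
      filter_upwards [Iio_mem_nhds h] with t ht
      rw [if_pos (le_of_lt ht)]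

theorem Sp_cont (p : ℝ≥0∞) [Fact (1 ≤ p)] (hp : p ≠ ∞)
    (ω : ℝ → ℝ) (hω_cont : Continuous ω) (hω_pos : ∀ x, 0 < ω x)
    (Sp : ℝ → (Lp ℂ p (wmp p.toReal ω) →L[ℂ] Lp ℂ p (wmp p.toReal ω)))
    (hSp : ∀ t : ℝ, 0 ≤ t → ∀ f : Lp ℂ p (wmp p.toReal ω),
      (Sp t f : ℝ → ℂ) =ᵐ[wmp p.toReal ω] fun x => if t ≤ x then f (x - t) else 0)
    (hbd : ∀ T : ℝ, ∃ M : ℝ, 0 < M ∧ ∀ t, 0 ≤ t → t ≤ T → ‖Sp t‖ ≤ M)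
    (f : Lp ℂ p (wmp p.toReal ω)) :
    ContinuousOn (fun t => Sp t f) (Ici 0) := by
  have hp1 : 1 ≤ p := Fact.out
  have hp0 : p ≠ 0 := (zero_lt_one.trans_le hp1).ne'
  have hq : 0 < p.toReal := ENNReal.toReal_pos hp0 hp
  have := wmp_locfin p.toReal hq.le ω hω_cont
  intro t₀ ht₀
  obtain ⟨M, hM, hMb⟩ := hbd (t₀ + 1)
  rw [ContinuousWithinAt, Metric.tendsto_nhds]
  intro ε hε
  have hδ : 0 < ε / (4 * M) := by positivity
  obtain ⟨g, hgs, hfg, hg, hgL⟩ := (Lp.memLp f).exists_hasCompactSupport_eLpNorm_sub_le hp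
    (ε := ENNReal.ofReal (ε / (4 * M))) (by simpa using hδ)
  have hnorm : ‖f - hgL.toLp‖ ≤ ε / (4 * M) := by
    rw [Lp.norm_def, eLpNorm_congr_ae (Lp.coeFn_sub _ _),
      eLpNorm_congr_ae (EventuallyEq.rfl.sub hgL.coeFn_toLp)]
    exact ENNReal.toReal_le_of_le_ofReal hδ.le hfg
  have h1 := Sp_cont_Cc p hp ω hω_cont hω_pos Sp hSp g hg hgs hgL t₀ ht₀
  rw [Metric.tendsto_nhds] at h1
  have hnear : ∀ᶠ t in 𝓝[Ici 0] t₀, t < t₀ + 1 :=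
      nhdsWithin_le_nhds (Iio_mem_nhds (by linarith))
  have hsm : ∀ t, 0 ≤ t → t ≤ t₀ + 1 → ‖Sp t (f - hgL.toLp)‖ ≤ ε / 4 := by
    intro t ht ht'
    refine ((Sp t).le_opNorm _).trans ?_
    calc ‖Sp t‖ * ‖f - hgL.toLp‖ ≤ M * (ε / (4 * M)) :=
          mul_le_mul (hMb t ht ht') hnorm (norm_nonneg _) hM.le
      _ = ε / 4 := by field_simp
  filter_upwards [h1 (ε / 4) (by positivity), hnear, self_mem_nhdsWithin] with t h2 h3 h4
  rw [dist_eq_norm] at h2 ⊢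
  have e : Sp t f - Sp t₀ f = Sp t (f - hgL.toLp) - Sp t₀ (f - hgL.toLp) +
      (Sp t hgL.toLp - Sp t₀ hgL.toLp) := by
    simp only [map_sub]; abel
  rw [e]
  have h5 := norm_add_le (Sp t (f - hgL.toLp) - Sp t₀ (f - hgL.toLp))
      (Sp t hgL.toLp - Sp t₀ hgL.toLp)
  have h6 := norm_sub_le (Sp t (f - hgL.toLp)) (Sp t₀ (f - hgL.toLp))
  have h7 := hsm t h4 h3.le
  have h8 := hsm t₀ ht₀ (by linarith)
  linarith

/-! ### Bochner integral representation -/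

theorem setIntegral_norm_bound {μ : Measure ℝ} (p : ℝ≥0∞) [Fact (1 ≤ p)]
    (s : Set ℝ) (hs : μ s ≠ ∞) :
    ∃ C : ℝ, 0 ≤ C ∧ ∀ f : Lp ℂ p μ, ∫ x in s, ‖f x‖ ∂μ ≤ C * ‖f‖ := by
  have hp1 : 1 ≤ p := Fact.out
  refine ⟨(μ s ^ (1 / (1 : ℝ≥0∞).toReal - 1 / p.toReal)).toReal, ENNReal.toReal_nonneg,
    fun f => ?_⟩
  have h := eLpNorm_le_eLpNorm_mul_rpow_measure_univ (μ := μ.restrict s) hp1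
    (Lp.aestronglyMeasurable f).restrict
  have h2 : ∫ x in s, ‖f x‖ ∂μ = (eLpNorm f 1 (μ.restrict s)).toReal := by
    rw [eLpNorm_one_eq_lintegral_enorm,
      integral_norm_eq_lintegral_enorm (Lp.aestronglyMeasurable f).restrict]
  have hexp : 0 ≤ 1 / (1 : ℝ≥0∞).toReal - 1 / p.toReal := by
    rcases eq_or_ne p ∞ with rfl | hp
    · simp
    · have : 1 ≤ p.toReal := by
        rw [← ENNReal.toReal_one]; exact ENNReal.toReal_mono hp hp1
      have h3 : 1 / p.toReal ≤ 1 := by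
        rw [div_le_one (by linarith)]; exact this
      simpa using h3
  have hfin : μ s ^ (1 / (1 : ℝ≥0∞).toReal - 1 / p.toReal) ≠ ∞ :=
    ENNReal.rpow_ne_top_of_nonneg hexp hs
  rw [h2, Lp.norm_def, ← ENNReal.toReal_mul, mul_comm]
  refine ENNReal.toReal_mono (ENNReal.mul_ne_top (Lp.eLpNorm_ne_top f) hfin) ?_
  refine h.trans ?_
  rw [Measure.restrict_apply_univ]
  gcongr
  exact Measure.restrict_le_self

theorem setIntegral_clm {μ : Measure ℝ} (p : ℝ≥0∞) [Fact (1 ≤ p)]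
    (s : Set ℝ) (hs : μ s ≠ ∞) :
    ∃ L : Lp ℂ p μ →L[ℂ] ℂ, ∀ f, L f = ∫ x in s, f x ∂μ := by
  have hp1 : 1 ≤ p := Fact.out
  obtain ⟨C, hC, hb⟩ := setIntegral_norm_bound (μ := μ) p s hs
  have hi : ∀ f : Lp ℂ p μ, IntegrableOn f s μ := fun f => integrableOn_Lp_of_measure_ne_top f hp1 hs
  refine ⟨LinearMap.mkContinuous
    { toFun := fun f => ∫ x in s, f x ∂μ
      map_add' := fun f g => ?_
      map_smul' := fun c f => ?_ } C (fun f => ?_), fun f => rfl⟩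
  · rw [← integral_add (hi f) (hi g)]
    exact integral_congr_ae (ae_restrict_of_ae (Lp.coeFn_add f g))
  · rw [RingHom.id_apply, ← integral_smul]
    exact integral_congr_ae (ae_restrict_of_ae (Lp.coeFn_smul c f))
  · exact (norm_integral_le_integral_norm _).trans (hb f)

theorem phi_neg (φ : ℝ → ℂ) (hφ_plus : tsupport φ ⊆ Set.Ici (0 : ℝ)) (y : ℝ) (hy : y < 0) :
    φ y = 0 := by
  by_contra h
  have := hφ_plus (subset_tsupport φ h)
  exact absurd this (not_le.2 hy)

theorem integrable_smul_of_continuousOn {X : Type*} [NormedAddCommGroup X] [NormedSpace ℂ X]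
    (φ : ℝ → ℂ) (hφ_cont : Continuous φ) (hφ_supp : HasCompactSupport φ)
    (hφ_plus : tsupport φ ⊆ Set.Ici (0 : ℝ)) (h : ℝ → X) (hh : ContinuousOn h (Ici 0)) :
    Integrable (fun y => φ y • h y) := by
  have e : (fun y => φ y • h y) = fun y => φ y • h (max y 0) := by
    funext y
    rcases le_or_gt 0 y with hy | hy
    · rw [max_eq_left hy]
    · rw [phi_neg φ hφ_plus y hy, zero_smul, zero_smul]
  rw [e]
  have hc : Continuous fun y : ℝ => h (max y 0) :=
    hh.comp_continuous (by fun_prop) (fun y => mem_Ici.2 (le_max_right _ _))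
  exact (hφ_cont.smul hc).integrable_of_hasCompactSupport hφ_supp.smul_right

theorem T_eq_integral (p : ℝ≥0∞) [Fact (1 ≤ p)] (hp : p ≠ ∞)
    (ω : ℝ → ℝ) (hω_cont : Continuous ω) (hω_pos : ∀ x, 0 < ω x)
    (Sp : ℝ → (Lp ℂ p (wmp p.toReal ω) →L[ℂ] Lp ℂ p (wmp p.toReal ω)))
    (hSp : ∀ t : ℝ, 0 ≤ t → ∀ f : Lp ℂ p (wmp p.toReal ω),
      (Sp t f : ℝ → ℂ) =ᵐ[wmp p.toReal ω] fun x => if t ≤ x then f (x - t) else 0)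
    (hbd : ∀ T : ℝ, ∃ M : ℝ, 0 < M ∧ ∀ t, 0 ≤ t → t ≤ T → ‖Sp t‖ ≤ M)
    (φ : ℝ → ℂ) (hφ_cont : Continuous φ) (hφ_supp : HasCompactSupport φ)
    (hφ_plus : tsupport φ ⊆ Set.Ici (0 : ℝ))
    (T : Lp ℂ p (wmp p.toReal ω) →L[ℂ] Lp ℂ p (wmp p.toReal ω))
    (hT : ∀ f : Lp ℂ p (wmp p.toReal ω),
      (T f : ℝ → ℂ) =ᵐ[wmp p.toReal ω]
        fun x => ∫ y : ℝ, φ y * Set.indicator (Set.Ici (0 : ℝ)) (⇑f) (x - y))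
    (f : Lp ℂ p (wmp p.toReal ω)) :
    Integrable (fun y => φ y • Sp y f) ∧ T f = ∫ y, φ y • Sp y f := by
  have hp1 : 1 ≤ p := Fact.out
  have hp0 : p ≠ 0 := (zero_lt_one.trans_le hp1).ne'
  have hq : 0 < p.toReal := ENNReal.toReal_pos hp0 hp
  have := wmp_locfin p.toReal hq.le ω hω_cont
  have hint := integrable_smul_of_continuousOn φ hφ_cont hφ_supp hφ_plus _
    (Sp_cont p hp ω hω_cont hω_pos Sp hSp hbd f)
  refine ⟨hint, ?_⟩
  obtain ⟨K, hK⟩ : ∃ K : ℝ, ∀ x, φ x ≠ 0 → x ≤ K := by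
    obtain ⟨K, hK⟩ := hφ_supp.isCompact.bddAbove
    exact ⟨K, fun x hx => hK (subset_tsupport φ hx)⟩
  obtain ⟨M, hM, hMb⟩ := hbd K
  have hi : ∀ (f : Lp ℂ p (wmp p.toReal ω)) (s : Set ℝ), wmp p.toReal ω s < ∞ →
      IntegrableOn f s (wmp p.toReal ω) :=
    fun f s hs => integrableOn_Lp_of_measure_ne_top f hp1 hs.ne
  apply Lp.ext
  refine ae_eq_of_forall_setIntegral_eq_of_sigmaFinite (fun s _ hs => hi _ s hs)
    (fun s _ hs => hi _ s hs) fun s hs hsfin => ?_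
  obtain ⟨L, hL⟩ := setIntegral_clm (μ := wmp p.toReal ω) p s hsfin.ne
  obtain ⟨C, hC, hCb⟩ := setIntegral_norm_bound (μ := wmp p.toReal ω) p s hsfin.ne
  rw [← hL (∫ y, φ y • Sp y f), ← L.integral_comp_comm hint]
  have key : ∀ y, (fun x => φ y * Set.indicator (Set.Ici (0 : ℝ)) (⇑f) (x - y))
      =ᵐ[wmp p.toReal ω] (φ y • Sp y f : Lp ℂ p (wmp p.toReal ω)) := by
    intro y
    rcases le_or_gt 0 y with hy | hy
    · filter_upwards [Lp.coeFn_smul (φ y) (Sp y f), hSp y hy f] with x h1 h2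
      rw [h1, Pi.smul_apply, h2, smul_eq_mul]
      congr 1
      by_cases h : y ≤ x
      · rw [if_pos h, indicator_of_mem (show x - y ∈ Ici (0 : ℝ) by simpa using h)]
      · rw [if_neg h, indicator_of_notMem (by simpa using h)]
    · rw [phi_neg φ hφ_plus y hy, zero_smul]
      filter_upwards [Lp.coeFn_zero ℂ p (wmp p.toReal ω)] with x h1
      rw [h1]; simp
  rw [integral_congr_ae (ae_restrict_of_ae (hT f))]
  rw [integral_integral_swap]
  · refine integral_congr_ae (ae_of_all _ fun y => ?_)
    simp only
    rw [hL, integral_congr_ae (ae_restrict_of_ae (key y))]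
  · have hmeas : AEStronglyMeasurable (Function.uncurry fun (x y : ℝ) =>
        φ y * Set.indicator (Set.Ici (0 : ℝ)) (⇑f) (x - y))
        (((wmp p.toReal ω).restrict s).prod volume) := by
      have hf : StronglyMeasurable f := Lp.stronglyMeasurable f
      have h1 : StronglyMeasurable (Set.indicator (Set.Ici (0 : ℝ)) (⇑f)) :=
        hf.indicator measurableSet_Ici
      have h2 : StronglyMeasurable (Function.uncurry fun (x y : ℝ) =>
        φ y * Set.indicator (Set.Ici (0 : ℝ)) (⇑f) (x - y)) :=
        (hφ_cont.stronglyMeasurable.comp_measurable measurable_snd).mul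
          (h1.comp_measurable (measurable_fst.sub measurable_snd))
      exact h2.aestronglyMeasurable
    rw [integrable_prod_iff' hmeas]
    refine ⟨ae_of_all _ fun y => ?_, ?_⟩
    · exact (hi (φ y • Sp y f) s hsfin).congr (ae_restrict_of_ae (key y).symm)
    · refine Integrable.mono' (g := fun y => C * (M * ‖f‖) * ‖φ y‖) ?_ ?_ (ae_of_all _ fun y => ?_)
      · exact ((hφ_cont.integrable_of_hasCompactSupport hφ_supp).norm).const_mul _
      · exact hmeas.norm.prod_swap.integral_prod_right'
      · have e : ∫ x in s, ‖φ y * Set.indicator (Set.Ici (0 : ℝ)) (⇑f) (x - y)‖ ∂(wmp p.toReal ω)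
            = ∫ x in s, ‖(φ y • Sp y f : Lp ℂ p (wmp p.toReal ω)) x‖ ∂(wmp p.toReal ω) := by
          refine integral_congr_ae (ae_restrict_of_ae ?_)
          filter_upwards [key y] with x hx
          rw [hx]
        have h0 : 0 ≤ ∫ x in s, ‖φ y * Set.indicator (Set.Ici (0 : ℝ)) (⇑f) (x - y)‖
            ∂(wmp p.toReal ω) := integral_nonneg fun x => norm_nonneg _
        simp only [Function.uncurry_apply_pair]
        rw [Real.norm_of_nonneg h0, e]
        refine (hCb _).trans ?_
        rw [norm_smul, mul_assoc]
        refine mul_le_mul_of_nonneg_left ?_ hC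
        rw [mul_comm]
        by_cases hy : φ y = 0
        · simp [hy]
        · refine mul_le_mul_of_nonneg_right ?_ (norm_nonneg _)
          have hy0 : 0 ≤ y := by
            by_contra h
            exact hy (phi_neg φ hφ_plus y (not_le.1 h))
          exact ((Sp y).le_opNorm f).trans
            (mul_le_mul_of_nonneg_right (hMb y hy0 (hK y hy)) (norm_nonneg _))

/-! ### Norm continuity of `x ↦ 𝐒_x T_φ` -/

theorem SpT_cont (p : ℝ≥0∞) [Fact (1 ≤ p)] (hp : p ≠ ∞)
    (ω : ℝ → ℝ) (hω_cont : Continuous ω) (hω_pos : ∀ x, 0 < ω x)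
    (Sp : ℝ → (Lp ℂ p (wmp p.toReal ω) →L[ℂ] Lp ℂ p (wmp p.toReal ω)))
    (hSp : ∀ t : ℝ, 0 ≤ t → ∀ f : Lp ℂ p (wmp p.toReal ω),
      (Sp t f : ℝ → ℂ) =ᵐ[wmp p.toReal ω] fun x => if t ≤ x then f (x - t) else 0)
    (hbd : ∀ T : ℝ, ∃ M : ℝ, 0 < M ∧ ∀ t, 0 ≤ t → t ≤ T → ‖Sp t‖ ≤ M)
    (φ : ℝ → ℂ) (hφ_cont : Continuous φ) (hφ_supp : HasCompactSupport φ)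
    (hφ_plus : tsupport φ ⊆ Set.Ici (0 : ℝ))
    (T : Lp ℂ p (wmp p.toReal ω) →L[ℂ] Lp ℂ p (wmp p.toReal ω))
    (hT : ∀ f : Lp ℂ p (wmp p.toReal ω),
      (T f : ℝ → ℂ) =ᵐ[wmp p.toReal ω]
        fun x => ∫ y : ℝ, φ y * Set.indicator (Set.Ici (0 : ℝ)) (⇑f) (x - y)) :
    ContinuousOn (fun x => Sp x * T) (Ici 0) := by
  have hrep := T_eq_integral p hp ω hω_cont hω_pos Sp hSp hbd φ hφ_cont hφ_supp hφ_plus T hT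
  obtain ⟨K, hK0, hK⟩ : ∃ K : ℝ, 0 ≤ K ∧ ∀ x, φ x ≠ 0 → x ≤ K := by
    obtain ⟨K, hK⟩ := hφ_supp.isCompact.bddAbove
    exact ⟨max K 0, le_max_right _ _, fun x hx => (hK (subset_tsupport φ hx)).trans
      (le_max_left _ _)⟩
  -- the shifted representation
  have hshift : ∀ x, 0 ≤ x → ∀ f, Sp x (T f) = ∫ s, φ (s - x) • Sp s f := by
    intro x hx f
    rw [(hrep f).2, ← (Sp x).integral_comp_comm (hrep f).1,
      ← integral_sub_right_eq_self _ x]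
    refine integral_congr_ae (ae_of_all _ fun s => ?_)
    simp only [map_smul]
    rcases le_or_gt 0 (s - x) with h | h
    · have := Sp_add p ω hω_cont hω_pos Sp hSp x (s - x) hx h
      rw [add_sub_cancel] at this
      rw [this]; rfl
    · rw [phi_neg φ hφ_plus _ h, zero_smul, zero_smul]
  have hshift_int : ∀ x, 0 ≤ x → ∀ f, Integrable fun s => φ (s - x) • Sp s f := by
    intro x hx f
    refine integrable_smul_of_continuousOn (fun s => φ (s - x)) (by fun_prop) ?_ ?_ _
      (Sp_cont p hp ω hω_cont hω_pos Sp hSp hbd f)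
    · exact hφ_supp.comp_homeomorph (Homeomorph.subRight x)
    · refine closure_minimal (fun s hs => ?_) isClosed_Ici
      by_contra h
      refine hs (phi_neg φ hφ_plus (s - x) ?_)
      have : s < 0 := not_le.1 h
      linarith
  intro x₀ hx₀
  have hx₀' : 0 ≤ x₀ := hx₀
  obtain ⟨M, hM, hMb⟩ := hbd (x₀ + 1 + K)
  rw [ContinuousWithinAt, Metric.tendsto_nhds]
  intro ε hε
  have hlen : 0 < x₀ + 1 + K := by linarith
  set η : ℝ := ε / (2 * M * (x₀ + 1 + K)) with hη
  have hη0 : 0 < η := by positivity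
  have huc := hφ_supp.uniformContinuous_of_continuous hφ_cont
  rw [Metric.uniformContinuous_iff] at huc
  obtain ⟨δ, hδ, hδb⟩ := huc η hη0
  have hnear : ∀ᶠ t in 𝓝[Ici 0] x₀, t < x₀ + 1 :=
      nhdsWithin_le_nhds (Iio_mem_nhds (by linarith))
  have hnear2 : ∀ᶠ t in 𝓝[Ici 0] x₀, dist t x₀ < δ :=
      nhdsWithin_le_nhds (Metric.ball_mem_nhds x₀ hδ)
  filter_upwards [hnear, hnear2, self_mem_nhdsWithin] with x h1 h2 h3
  rw [dist_eq_norm]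
  have hle : ‖Sp x * T - Sp x₀ * T‖ ≤ η * M * (x₀ + 1 + K) := by
    refine ContinuousLinearMap.opNorm_le_bound _ (by positivity) fun f => ?_
    have e : (Sp x * T - Sp x₀ * T) f = ∫ s in Icc 0 (x₀ + 1 + K),
        (φ (s - x) • Sp s f - φ (s - x₀) • Sp s f) := by
      rw [setIntegral_eq_integral_of_forall_compl_eq_zero,
        integral_sub (hshift_int x h3 f) (hshift_int x₀ hx₀ f),
        ← hshift x h3 f, ← hshift x₀ hx₀ f]
      · rfl
      · intro s hs
        have hz : ∀ x, 0 ≤ x → x ≤ x₀ + 1 → φ (s - x) = 0 := by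
          intro x hx hx'
          by_contra hne
          refine hs ⟨?_, ?_⟩
          · by_contra h
            exact hne (phi_neg φ hφ_plus _ (by linarith))
          · have := hK _ hne
            linarith
        rw [hz x h3 h1.le, hz x₀ hx₀ (by linarith)]
        simp
    rw [e]
    refine (norm_setIntegral_le_of_norm_le_const (C := η * M * ‖f‖) ?_ ?_).trans ?_
    · exact measure_Icc_lt_top
    · intro s hs
      rw [← sub_smul, norm_smul, mul_assoc]
      refine mul_le_mul ?_ ?_ (norm_nonneg _) hη0.le
      · rw [← dist_eq_norm]
        refine (hδb ?_).le
        rw [dist_sub_left]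
        exact h2
      · exact ((Sp s).le_opNorm f).trans
          (mul_le_mul_of_nonneg_right (hMb s hs.1 hs.2) (norm_nonneg _))
    · rw [Real.volume_real_Icc_of_le hlen.le]
      apply le_of_eq; ring
  refine hle.trans_lt ?_
  have : η * M * (x₀ + 1 + K) = ε / 2 := by
    rw [hη]; field_simp
  linarith

/-! ### Continuous multiplicative functions on `ℝ⁺` -/

theorem exp_of_mul (θ : ℝ → ℂ) (hc : ContinuousOn θ (Ici 0)) (h0 : θ 0 = 1)
    (hmul : ∀ x y, 0 ≤ x → 0 ≤ y → θ (x + y) = θ x * θ y) :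
    ∃ lam : ℂ, ∀ x : ℝ, 0 ≤ x → θ x = Complex.exp (lam * (x : ℂ)) := by
  -- continuous extension
  set g : ℝ → ℂ := fun x => θ (max x 0) with hg
  have hgc : Continuous g :=
    hc.comp_continuous (by fun_prop) (fun y => mem_Ici.2 (le_max_right _ _))
  have hgθ : ∀ x, 0 ≤ x → g x = θ x := fun x hx => by simp [hg, max_eq_left hx]
  set G : ℝ → ℂ := fun x => ∫ t in (0 : ℝ)..x, g t with hG
  have hGd : ∀ x, HasDerivAt G (g x) x := fun x =>
    intervalIntegral.integral_hasDerivAt_right (hgc.intervalIntegrable _ _)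
      (hgc.stronglyMeasurableAtFilter _ _) hgc.continuousAt
  have hGfund : ∀ x a, 0 ≤ x → 0 ≤ a → θ x * G a = G (x + a) - G x := by
    intro x a hx ha
    simp only [hG]
    rw [intervalIntegral.integral_interval_sub_left (hgc.intervalIntegrable _ _)
      (hgc.intervalIntegrable _ _), ← intervalIntegral.integral_const_mul]
    have := intervalIntegral.integral_comp_add_left (a := 0) (b := a) g x
    rw [add_zero] at this
    rw [← this]
    refine intervalIntegral.integral_congr fun t ht => ?_
    rw [uIcc_of_le ha] at ht
    change θ x * g t = g (x + t)
    rw [hgθ t ht.1, hgθ (x + t) (by linarith [ht.1]), hmul x t hx ht.1]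
  obtain ⟨a, ha, hGa⟩ : ∃ a, 0 ≤ a ∧ G a ≠ 0 := by
    by_contra! hcon
    have hd : HasDerivWithinAt G (g 0) (Ici 0) 0 := (hGd 0).hasDerivWithinAt
    have hd2 : HasDerivWithinAt G 0 (Ici 0) 0 :=
      (hasDerivWithinAt_const (0 : ℝ) (Ici 0) (0 : ℂ)).congr (fun x hx => hcon x hx)
        (hcon 0 le_rfl)
    have := (uniqueDiffOn_Ici (0 : ℝ) 0 self_mem_Ici).eq_deriv _ hd hd2
    rw [hgθ 0 le_rfl, h0] at this
    exact one_ne_zero this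
  set F : ℝ → ℂ := fun x => (G (x + a) - G x) / G a with hF
  have hFθ : ∀ x, 0 ≤ x → θ x = F x := fun x hx => by
    simp only [hF]
    rw [← hGfund x a hx ha, mul_div_cancel_right₀ _ hGa]
  have hFd : ∀ x, HasDerivAt F ((g (x + a) - g x) / G a) x := fun x =>
    (((hGd (x + a)).comp_add_const x a).sub (hGd x)).div_const _
  set lam : ℂ := (θ a - 1) / G a with hlam
  have hFd' : ∀ x, 0 ≤ x → HasDerivAt F (lam * F x) x := by
    intro x hx
    convert hFd x using 1
    rw [hgθ x hx, hgθ (x + a) (by linarith), hmul x a hx ha, ← hFθ x hx, hlam]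
    ring
  refine ⟨lam, fun x hx => ?_⟩
  set H : ℝ → ℂ := fun x => F x * Complex.exp (-(lam * (x : ℂ))) with hH
  have hHd : ∀ x, 0 ≤ x → HasDerivAt H 0 x := by
    intro x hx
    have h1 : HasDerivAt (fun x : ℝ => -(lam * (x : ℂ))) (-(lam * 1)) x :=
      ((hasDerivAt_id x).ofReal_comp.const_mul lam).neg
    have h2 := (hFd' x hx).mul h1.cexp
    have h3 : lam * F x * Complex.exp (-(lam * (x : ℂ))) +
        F x * (Complex.exp (-(lam * (x : ℂ))) * -(lam * 1)) = 0 := by ring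
    rw [h3] at h2
    exact h2
  have hconst : H x = H 0 := by
    refine constant_of_has_deriv_right_zero (a := 0) (b := x) ?_ ?_ x ⟨hx, le_rfl⟩
    · exact fun y hy => (hHd y hy.1).continuousAt.continuousWithinAt
    · exact fun y hy => (hHd y hy.1).hasDerivWithinAt
  have hH0 : H 0 = 1 := by
    simp only [hH]
    rw [← hFθ 0 le_rfl, h0]; simp
  rw [hH0] at hconst
  simp only [hH] at hconst
  rw [hFθ x hx]
  rw [Complex.exp_neg] at hconst
  field_simp [Complex.exp_ne_zero] at hconst
  exact hconst

/-! ### Spectrum of the unit translation -/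

theorem rec_solve (z : ℂ) (hz : z ≠ 0) (g : ℝ → ℂ) (x₀ δ : ℝ) (hx₀ : 0 ≤ x₀) (hδ : δ ≤ 1) (m : ℕ) :
    ∀ y : ℝ, 0 ≤ y → y ∈ Ico (x₀ + m) (x₀ + m + δ) →
      (∀ k : ℕ, (k : ℝ) ≤ y → z * g (y - k) - (if 1 ≤ y - k then g (y - k - 1) else 0) =
        (Ico x₀ (x₀ + δ)).indicator (fun _ => 1) (y - k)) →
      g y = (z ^ (m + 1))⁻¹ := by
  have hstep : ∀ y : ℝ, 1 ≤ y → (∀ k : ℕ, (k : ℝ) ≤ y →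
        z * g (y - k) - (if 1 ≤ y - k then g (y - k - 1) else 0) =
        (Ico x₀ (x₀ + δ)).indicator (fun _ => (1 : ℂ)) (y - k)) →
      (∀ k : ℕ, (k : ℝ) ≤ y - 1 →
        z * g (y - 1 - k) - (if 1 ≤ y - 1 - k then g (y - 1 - k - 1) else 0) =
        (Ico x₀ (x₀ + δ)).indicator (fun _ => (1 : ℂ)) (y - 1 - k)) := by
    intro y hy h k hk
    have := h (k + 1) (by push_cast; linarith)
    have e : y - ((k + 1 : ℕ) : ℝ) = y - 1 - k := by push_cast; ring
    rwa [e] at this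
  have hA : ∀ n : ℕ, ∀ y : ℝ, 0 ≤ y → y < n → y < x₀ → (∀ k : ℕ, (k : ℝ) ≤ y →
        z * g (y - k) - (if 1 ≤ y - k then g (y - k - 1) else 0) =
        (Ico x₀ (x₀ + δ)).indicator (fun _ => (1 : ℂ)) (y - k)) → g y = 0 := by
    intro n
    induction n with
    | zero => intro y hy hy'; simp at hy'; linarith
    | succ n ih =>
      intro y hy hyn hyx h
      have h0 := h 0 (by simpa using hy)
      simp only [Nat.cast_zero, sub_zero] at h0
      rw [indicator_of_notMem (fun hm => absurd hm.1 (not_le.2 hyx))] at h0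
      have h1 : (if 1 ≤ y then g (y - 1) else 0) = 0 := by
        split_ifs with h1
        · push_cast at hyn
          exact ih (y - 1) (by linarith) (by linarith) (by linarith) (hstep y h1 h)
        · rfl
      rw [h1, sub_zero] at h0
      exact (mul_eq_zero.1 h0).resolve_left hz
  induction m with
  | zero =>
    intro y hy hyI h
    simp only [Nat.cast_zero, add_zero] at hyI
    have h0 := h 0 (by simpa using hy)
    simp only [Nat.cast_zero, sub_zero] at h0
    rw [indicator_of_mem hyI] at h0
    have h1 : (if 1 ≤ y then g (y - 1) else 0) = 0 := by
      split_ifs with h1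
      · obtain ⟨n, hn⟩ := exists_nat_gt (y - 1)
        exact hA n (y - 1) (by linarith) hn (by linarith [hyI.2]) (hstep y h1 h)
      · rfl
    rw [h1, sub_zero] at h0
    rw [zero_add, pow_one]
    exact eq_inv_of_mul_eq_one_right h0
  | succ m ih =>
    intro y hy hyI h
    push_cast at hyI
    have h0 := h 0 (by simpa using hy)
    simp only [Nat.cast_zero, sub_zero] at h0
    rw [indicator_of_notMem (fun hm => by
      have := hm.2
      have := hyI.1
      have : (0 : ℝ) ≤ m := Nat.cast_nonneg m
      linarith)] at h0
    have h1 : 1 ≤ y := by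
      have := hyI.1
      have : (0 : ℝ) ≤ m := Nat.cast_nonneg m
      linarith
    rw [if_pos h1] at h0
    have h2 := ih (y - 1) (by linarith) ⟨by linarith [hyI.1], by linarith [hyI.2]⟩ (hstep y h1 h)
    rw [h2] at h0
    have h3 : z * g y = (z ^ (m + 1))⁻¹ := by linear_combination h0
    rw [pow_succ, mul_inv, ← h3]
    field_simp

theorem wmp_real_Ico (q : ℝ) (hq : 0 ≤ q) (ω : ℝ → ℝ) (hω_cont : Continuous ω)
    (hω_pos : ∀ x, 0 < ω x) (a b : ℝ) (ha : 0 ≤ a) (hab : a ≤ b) :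
    (wmp q ω).real (Ico a b) = ∫ x in a..b, ω x ^ q := by
  have hc : Continuous fun x => ω x ^ q := hω_cont.rpow_const (fun x => Or.inr hq)
  rw [intervalIntegral.integral_of_le hab, ← integral_Ico_eq_integral_Ioc, Measure.real, wmp,
    withDensity_apply _ measurableSet_Ico, Measure.restrict_restrict measurableSet_Ico,
    inter_eq_left.2 (fun x hx => mem_Ici.2 (ha.trans hx.1)),
    integral_eq_lintegral_of_nonneg_ae]
  · exact ae_of_all _ fun x => Real.rpow_nonneg (hω_pos x).le _
  · exact hc.aestronglyMeasurable

theorem resolvent_weight_bound (p : ℝ≥0∞) [Fact (1 ≤ p)] (hp : p ≠ ∞)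
    (ω : ℝ → ℝ) (hω_cont : Continuous ω) (hω_pos : ∀ x, 0 < ω x)
    (S : Lp ℂ p (wmp p.toReal ω) →L[ℂ] Lp ℂ p (wmp p.toReal ω))
    (hS : ∀ f : Lp ℂ p (wmp p.toReal ω),
      (S f : ℝ → ℂ) =ᵐ[wmp p.toReal ω] fun x => if 1 ≤ x then f (x - 1) else 0)
    (z : ℂ) (hz : z ≠ 0) (hzr : z ∈ resolventSet ℂ S) :
    ∃ C : ℝ, 0 ≤ C ∧ ∀ (m : ℕ) (x : ℝ), 0 ≤ x → ω (x + m) ≤ C * ‖z‖ ^ m * ω x := by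
  have hp1 : 1 ≤ p := Fact.out
  have hp0 : p ≠ 0 := (zero_lt_one.trans_le hp1).ne'
  have hq : 0 < p.toReal := ENNReal.toReal_pos hp0 hp
  have := wmp_locfin p.toReal hq.le ω hω_cont
  obtain ⟨u, hu⟩ := (spectrum.mem_resolventSet_iff.1 hzr)
  set R : Lp ℂ p (wmp p.toReal ω) →L[ℂ] Lp ℂ p (wmp p.toReal ω) := ↑u⁻¹ with hR
  have hRr : ∀ f, z • R f - S (R f) = f := by
    intro f
    have h1 : (u : Lp ℂ p (wmp p.toReal ω) →L[ℂ] Lp ℂ p (wmp p.toReal ω)) * R = 1 := u.mul_inv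
    have h2 := congrArg (fun A => A f) h1
    rw [hu] at h2
    simpa [Algebra.algebraMap_eq_smul_one] using h2
  have hzn : 0 < ‖z‖ := norm_pos_iff.2 hz
  refine ⟨‖R‖ * ‖z‖, by positivity, fun m x₀ hx₀ => ?_⟩
  set K : ℝ := ‖R‖ * ‖z‖ * ‖z‖ ^ m with hK
  have hK0 : 0 ≤ K := by positivity
  have hm0 : (0 : ℝ) ≤ m := Nat.cast_nonneg m
  have hfin : ∀ a b, wmp p.toReal ω (Ico a b) ≠ ∞ := fun a b =>
    ((measure_mono Ico_subset_Icc_self).trans_lt isCompact_Icc.measure_lt_top).ne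
  -- comparison of the measures of intervals
  have hcomp : ∀ δ, 0 < δ → δ ≤ 1 → (wmp p.toReal ω).real (Ico (x₀ + m) (x₀ + m + δ)) ≤
      K ^ p.toReal * (wmp p.toReal ω).real (Ico x₀ (x₀ + δ)) := by
    intro δ hδ hδ1
    set f : Lp ℂ p (wmp p.toReal ω) :=
      indicatorConstLp p (measurableSet_Ico (a := x₀) (b := x₀ + δ)) (hfin _ _) (1 : ℂ) with hf
    set g := R f with hg
    have hE : ∀ᵐ x ∂(wmp p.toReal ω), z * g x - (if 1 ≤ x then g (x - 1) else 0) =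
        (Ico x₀ (x₀ + δ)).indicator (fun _ => (1 : ℂ)) x := by
      have h0 := hRr f
      have h1 : (f : ℝ → ℂ) =ᵐ[wmp p.toReal ω] _ :=
        indicatorConstLp_coeFn (hs := measurableSet_Ico (a := x₀) (b := x₀ + δ))
          (hμs := hfin _ _) (c := (1 : ℂ))
      have h2 : ((z • g - S g : Lp ℂ p (wmp p.toReal ω)) : ℝ → ℂ) =ᵐ[wmp p.toReal ω] f := by
        rw [h0]
      filter_upwards [h1, h2, Lp.coeFn_sub (z • g) (S g), Lp.coeFn_smul z g, hS g]
        with x e1 e2 e3 e4 e5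
      rw [← e1, ← e2, e3, Pi.sub_apply, e4, e5, Pi.smul_apply, smul_eq_mul]
    have hE' : ∀ᵐ x ∂(wmp p.toReal ω), ∀ k : ℕ, (k : ℝ) ≤ x →
        z * g (x - k) - (if 1 ≤ x - k then g (x - k - 1) else 0) =
        (Ico x₀ (x₀ + δ)).indicator (fun _ => (1 : ℂ)) (x - k) :=
      ae_all_iff.2 fun k => wmp_ae_shift p.toReal ω hω_cont hω_pos _ hE k
    have hle : ‖indicatorConstLp p (measurableSet_Ico (a := x₀ + m) (b := x₀ + m + δ))
        (hfin _ _) ((z ^ (m + 1))⁻¹ : ℂ)‖ ≤ ‖g‖ := by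
      refine Lp.norm_le_norm_of_ae_le ?_
      filter_upwards [hE', indicatorConstLp_coeFn (p := p)
          (hs := measurableSet_Ico (a := x₀ + m) (b := x₀ + m + δ))
          (hμs := hfin _ _) (c := ((z ^ (m + 1))⁻¹ : ℂ))] with x e1 e2
      rw [e2]
      by_cases hx : x ∈ Ico (x₀ + m) (x₀ + m + δ)
      · rw [indicator_of_mem hx,
          rec_solve z hz g x₀ δ hx₀ hδ1 m x (by linarith [hx.1]) hx e1]
      · rw [indicator_of_notMem hx, norm_zero]
        exact norm_nonneg _
    have hle2 := hle.trans (R.le_opNorm f)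
    rw [norm_indicatorConstLp hp0 hp, hf, norm_indicatorConstLp hp0 hp, norm_one, one_mul,
      norm_inv, norm_pow] at hle2
    have hle3 : (wmp p.toReal ω).real (Ico (x₀ + m) (x₀ + m + δ)) ^ (1 / p.toReal) ≤
        K * (wmp p.toReal ω).real (Ico x₀ (x₀ + δ)) ^ (1 / p.toReal) := by
      rw [inv_mul_le_iff₀ (by positivity)] at hle2
      refine hle2.trans (le_of_eq ?_)
      rw [hK]; ring
    have hle4 := Real.rpow_le_rpow (by positivity) hle3 hq.le
    rw [Real.mul_rpow hK0 (by positivity), ← Real.rpow_mul measureReal_nonneg,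
      ← Real.rpow_mul measureReal_nonneg, one_div_mul_cancel hq.ne', Real.rpow_one,
      Real.rpow_one] at hle4
    exact hle4
  by_contra! hcon
  have hc1 : Continuous fun x => ω x ^ p.toReal :=
    hω_cont.rpow_const (fun x => Or.inr hq.le)
  have hev : ∀ᶠ x in 𝓝 x₀, K * ω x < ω (x + m) :=
    (isOpen_lt (f := fun x => K * ω x) (g := fun x => ω (x + m)) (by fun_prop)
      (by fun_prop)).mem_nhds hcon
  obtain ⟨ε, hε, hεb⟩ := Metric.eventually_nhds_iff.1 hev
  set δ := min (ε / 2) 1 with hδ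
  have hδ0 : 0 < δ := by positivity
  have hδ1 : δ ≤ 1 := min_le_right _ _
  have hδε : δ < ε := (min_le_left _ _).trans_lt (by linarith)
  have h1 := hcomp δ hδ0 hδ1
  rw [wmp_real_Ico _ hq.le ω hω_cont hω_pos _ _ (by linarith) (by linarith),
    wmp_real_Ico _ hq.le ω hω_cont hω_pos _ _ hx₀ (by linarith),
    ← intervalIntegral.integral_const_mul] at h1
  have e : ∫ x in (x₀ + m)..(x₀ + m + δ), ω x ^ p.toReal =
      ∫ x in x₀..(x₀ + δ), ω (x + m) ^ p.toReal := by
    rw [intervalIntegral.integral_comp_add_right (fun x => ω x ^ p.toReal)]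
    congr 1; ring
  rw [e] at h1
  have hlt : ∀ x ∈ Icc x₀ (x₀ + δ), K ^ p.toReal * ω x ^ p.toReal < ω (x + m) ^ p.toReal := by
    intro x hx
    rw [← Real.mul_rpow hK0 (hω_pos x).le]
    refine Real.rpow_lt_rpow (mul_nonneg hK0 (hω_pos x).le) (hεb ?_) hq
    rw [Real.dist_eq, abs_of_nonneg (by linarith [hx.1])]
    linarith [hx.2]
  refine absurd h1 (not_le.2 ?_)
  refine intervalIntegral.integral_lt_integral_of_continuousOn_of_le_of_exists_lt
    (by linarith) (hc1.const_mul _).continuousOn ?_ (fun x hx => (hlt x ⟨hx.1.le, hx.2⟩).le)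
    ⟨x₀, ⟨le_rfl, by linarith⟩, hlt x₀ ⟨le_rfl, by linarith⟩⟩
  exact (hc1.comp (continuous_add_const (m : ℝ))).continuousOn

/-- Key step in the proof of Theorem 5: let `𝒜` be the closed (commutative) subalgebra of
bounded operators on `𝐄 = L^p_ω(ℝ⁺)` generated by the Wiener–Hopf operators `T_φ`
(`φ ∈ C_c(ℝ)`, `supp φ ⊆ ℝ⁺`) and the right translations `𝐒_x`, `x ≥ 0`. If `γ` is a character
of `𝒜` with `γ(T_φ) ≠ 0` for some generator `T_φ`, then `θ_γ(x) = γ(𝐒_x)` is continuous and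
nonvanishing on `ℝ⁺`, `θ_γ(x) = e^{λx}` for some `λ` with `e^λ ∈ σ(𝐒_1)`, and
`γ(T_ψ) = ∫_0^∞ ψ(x) e^{λx} dx` for every generator `T_ψ`. -/
theorem thm5_key
    (p : ℝ≥0∞) [Fact (1 ≤ p)] (hp : p ≠ ∞)
    (ω : ℝ → ℝ) (hω_cont : Continuous ω) (hω_pos : ∀ x, 0 < ω x)
    (hω_sub : ∀ t : ℝ, 0 ≤ t → ∃ c C : ℝ, 0 < c ∧
      ∀ x : ℝ, 0 ≤ x → c ≤ ω (x + t) / ω x ∧ ω (x + t) / ω x ≤ C)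
    (Sp : ℝ → (Lp ℂ p (wmp p.toReal ω) →L[ℂ] Lp ℂ p (wmp p.toReal ω)))
    (hSp : ∀ t : ℝ, 0 ≤ t → ∀ f : Lp ℂ p (wmp p.toReal ω),
      (Sp t f : ℝ → ℂ) =ᵐ[wmp p.toReal ω] fun x => if t ≤ x then f (x - t) else 0)
    -- `𝒜` is the closed algebra generated by the operators `T_φ` and the translations `𝐒_x`
    (A : Subalgebra ℂ (Lp ℂ p (wmp p.toReal ω) →L[ℂ] Lp ℂ p (wmp p.toReal ω)))
    (hA : A = (Algebra.adjoin ℂ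
      ({T : Lp ℂ p (wmp p.toReal ω) →L[ℂ] Lp ℂ p (wmp p.toReal ω) |
          ∃ φ : ℝ → ℂ, Continuous φ ∧ HasCompactSupport φ ∧ tsupport φ ⊆ Set.Ici (0 : ℝ) ∧
            ∀ f : Lp ℂ p (wmp p.toReal ω),
              (T f : ℝ → ℂ) =ᵐ[wmp p.toReal ω]
                fun x => ∫ y : ℝ, φ y * Set.indicator (Set.Ici (0 : ℝ)) (⇑f) (x - y)} ∪
        {T : Lp ℂ p (wmp p.toReal ω) →L[ℂ] Lp ℂ p (wmp p.toReal ω) |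
          ∃ x : ℝ, 0 ≤ x ∧ T = Sp x})).topologicalClosure)
    -- `γ` is a character of `𝒜`
    (γ : A →ₐ[ℂ] ℂ) (hγ_cont : Continuous γ)
    -- `γ(T_φ) ≠ 0` for some `φ ∈ C_c(ℝ)` with `supp φ ⊆ ℝ⁺`
    (φ : ℝ → ℂ) (hφ_cont : Continuous φ) (hφ_supp : HasCompactSupport φ)
    (hφ_plus : tsupport φ ⊆ Set.Ici (0 : ℝ))
    (Tφ : Lp ℂ p (wmp p.toReal ω) →L[ℂ] Lp ℂ p (wmp p.toReal ω))
    (hTφ : ∀ f : Lp ℂ p (wmp p.toReal ω),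
      (Tφ f : ℝ → ℂ) =ᵐ[wmp p.toReal ω]
        fun x => ∫ y : ℝ, φ y * Set.indicator (Set.Ici (0 : ℝ)) (⇑f) (x - y))
    (hTφ_mem : Tφ ∈ A) (hγ_ne : γ ⟨Tφ, hTφ_mem⟩ ≠ 0)
    (hSp_mem : ∀ x : ℝ, 0 ≤ x → Sp x ∈ A)
    -- `θ_γ(x) = γ(𝐒_x)` for `x ≥ 0`
    (θ : ℝ → ℂ) (hθ : ∀ (x : ℝ) (hx : 0 ≤ x), θ x = γ ⟨Sp x, hSp_mem x hx⟩) :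
    ContinuousOn θ (Set.Ici (0 : ℝ)) ∧
    (∀ x ∈ Set.Ici (0 : ℝ), θ x ≠ 0) ∧
    ∃ lam : ℂ,
      (∀ x : ℝ, 0 ≤ x → θ x = Complex.exp (lam * (x : ℂ))) ∧
      Complex.exp lam ∈ spectrum ℂ (Sp 1) ∧
      ∀ ψ : ℝ → ℂ, Continuous ψ → HasCompactSupport ψ → tsupport ψ ⊆ Set.Ici (0 : ℝ) →
        ∀ Tψ : Lp ℂ p (wmp p.toReal ω) →L[ℂ] Lp ℂ p (wmp p.toReal ω),
          (∀ f : Lp ℂ p (wmp p.toReal ω),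
            (Tψ f : ℝ → ℂ) =ᵐ[wmp p.toReal ω]
              fun x => ∫ y : ℝ, ψ y * Set.indicator (Set.Ici (0 : ℝ)) (⇑f) (x - y)) →
          ∀ hmem : Tψ ∈ A,
            γ ⟨Tψ, hmem⟩ = ∫ x in Set.Ioi (0 : ℝ), ψ x * Complex.exp (lam * (x : ℂ)) := by
  have hp1 : 1 ≤ p := Fact.out
  have hbd : ∀ T : ℝ, ∃ M : ℝ, 0 < M ∧ ∀ t, 0 ≤ t → t ≤ T → ‖Sp t‖ ≤ M := by
    intro T
    obtain ⟨M, hM, hMb⟩ := weight_local_bound ω hω_cont hω_pos hω_sub T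
    exact ⟨M, hM, fun t ht hT =>
      Sp_norm_le p hp ω hω_cont hω_pos t ht (Sp t) (hSp t ht) M hM.le (hMb t ht hT)⟩
  -- extension of the character to a bounded functional on all operators
  obtain ⟨G, hG⟩ : ∃ G : (Lp ℂ p (wmp p.toReal ω) →L[ℂ] Lp ℂ p (wmp p.toReal ω)) →L[ℂ] ℂ,
      ∀ (a : Lp ℂ p (wmp p.toReal ω) →L[ℂ] Lp ℂ p (wmp p.toReal ω)) (ha : a ∈ A),
        G a = γ ⟨a, ha⟩ := by
    obtain ⟨G, hG, -⟩ := exists_extension_norm_eq (𝕜 := ℂ) (Subalgebra.toSubmodule A)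
      (⟨γ.toLinearMap, hγ_cont⟩ : StrongDual ℂ (Subalgebra.toSubmodule A))
    exact ⟨G, fun a ha => hG ⟨a, ha⟩⟩
  have hGmul : ∀ a ∈ A, ∀ b ∈ A, G (a * b) = G a * G b := by
    intro a ha b hb
    rw [hG a ha, hG b hb, hG (a * b) (A.mul_mem ha hb), ← map_mul]
    rfl
  have hθG : ∀ x, 0 ≤ x → θ x = G (Sp x) := fun x hx => by
    rw [hθ x hx, hG _ (hSp_mem x hx)]
  have hφne : G Tφ ≠ 0 := by rw [hG Tφ hTφ_mem]; exact hγ_ne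
  have hF := SpT_cont p hp ω hω_cont hω_pos Sp hSp hbd φ hφ_cont hφ_supp hφ_plus Tφ hTφ
  have hθF : ∀ x, 0 ≤ x → G (Sp x * Tφ) = θ x * G Tφ := fun x hx => by
    rw [hGmul _ (hSp_mem x hx) _ hTφ_mem, hθG x hx]
  have hcont : ContinuousOn θ (Ici 0) := by
    have h1 : ContinuousOn (fun x => G (Sp x * Tφ) / G Tφ) (Ici 0) :=
      (G.continuous.comp_continuousOn hF).div_const _
    refine h1.congr fun x hx => ?_
    change θ x = G (Sp x * Tφ) / G Tφ
    rw [hθF x hx, mul_div_cancel_right₀ _ hφne]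
  have hθ0 : θ 0 = 1 := by
    have h1 : (⟨Sp 0, hSp_mem 0 le_rfl⟩ : A) = 1 :=
      Subtype.ext (Sp_zero p ω hω_cont hω_pos Sp hSp)
    rw [hθ 0 le_rfl, h1, map_one]
  have hθmul : ∀ x y, 0 ≤ x → 0 ≤ y → θ (x + y) = θ x * θ y := by
    intro x y hx hy
    rw [hθG _ (add_nonneg hx hy), hθG x hx, hθG y hy,
      Sp_add p ω hω_cont hω_pos Sp hSp x y hx hy, hGmul _ (hSp_mem x hx) _ (hSp_mem y hy)]
  obtain ⟨lam, hlam⟩ := exp_of_mul θ hcont hθ0 hθmul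
  refine ⟨hcont, fun x hx => ?_, lam, hlam, ?_, ?_⟩
  · rw [hlam x hx]; exact Complex.exp_ne_zero _
  · -- spectrum
    by_contra hspec
    set z : ℂ := Complex.exp lam with hz
    have hz0 : z ≠ 0 := Complex.exp_ne_zero _
    have hres : z ∈ resolventSet ℂ (Sp 1) := by
      simpa [spectrum] using hspec
    have hop := spectrum.isOpen_resolventSet (𝕜 := ℂ) (Sp 1)
    obtain ⟨r, hr0, hr1, hrz⟩ : ∃ r : ℝ, 0 < r ∧ r < 1 ∧ (r : ℂ) * z ∈ resolventSet ℂ (Sp 1) := by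
      have hc : Tendsto (fun r : ℝ => (r : ℂ) * z) (𝓝[<] 1) (𝓝 z) := by
        have : Tendsto (fun r : ℝ => (r : ℂ) * z) (𝓝 1) (𝓝 (((1 : ℝ) : ℂ) * z)) :=
          Continuous.tendsto (by fun_prop) 1
        rw [Complex.ofReal_one, one_mul] at this
        exact this.mono_left nhdsWithin_le_nhds
      have h1 := hc.eventually (hop.mem_nhds hres)
      have h2 : ∀ᶠ r : ℝ in 𝓝[<] 1, r ∈ Ioo (0 : ℝ) 1 := Ioo_mem_nhdsLT zero_lt_one
      obtain ⟨r, h3, h4⟩ := (h1.and h2).exists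
      exact ⟨r, h4.1, h4.2, h3⟩
    have hrz0 : (r : ℂ) * z ≠ 0 := mul_ne_zero (by exact_mod_cast hr0.ne') hz0
    obtain ⟨C, hC, hCb⟩ := resolvent_weight_bound p hp ω hω_cont hω_pos (Sp 1)
      (hSp 1 zero_le_one) _ hrz0 hrz
    have hzn : 0 < ‖z‖ := norm_pos_iff.2 hz0
    have hnorm : ∀ m : ℕ, 1 ≤ ‖G‖ * C * r ^ m := by
      intro m
      have hm0 : (0 : ℝ) ≤ m := Nat.cast_nonneg m
      have h1 := Sp_norm_le p hp ω hω_cont hω_pos m hm0 (Sp m) (hSp m hm0)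
        (C * ‖(r : ℂ) * z‖ ^ m) (by positivity) (hCb m)
      have h2 : θ m = z ^ m := by
        rw [hlam m hm0, hz, ← Complex.exp_nat_mul, mul_comm, Complex.ofReal_natCast]
      have h3 : ‖z‖ ^ m ≤ ‖G‖ * (C * ‖(r : ℂ) * z‖ ^ m) := by
        rw [← norm_pow, ← h2, hθG m hm0]
        exact (G.le_opNorm _).trans (mul_le_mul_of_nonneg_left h1 (norm_nonneg _))
      rw [norm_mul, Complex.norm_real, Real.norm_of_nonneg hr0.le, mul_pow] at h3
      have h4 : 0 < ‖z‖ ^ m := by positivity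
      have h5 : 1 * ‖z‖ ^ m ≤ (‖G‖ * C * r ^ m) * ‖z‖ ^ m := by
        linarith
      exact le_of_mul_le_mul_right h5 h4
    have hlim : Tendsto (fun m : ℕ => ‖G‖ * C * r ^ m) atTop (𝓝 (‖G‖ * C * 0)) :=
      (tendsto_pow_atTop_nhds_zero_of_lt_one hr0.le hr1).const_mul _
    have := ge_of_tendsto' hlim hnorm
    rw [mul_zero] at this
    linarith
  · intro ψ hψ_cont hψ_supp hψ_plus Tψ hTψ hmem
    have hint := integrable_smul_of_continuousOn ψ hψ_cont hψ_supp hψ_plus _ hF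
    have hprod : Tψ * Tφ = ∫ y, ψ y • (Sp y * Tφ) := by
      ext1 f
      rw [ContinuousLinearMap.integral_apply hint]
      exact (T_eq_integral p hp ω hω_cont hω_pos Sp hSp hbd ψ hψ_cont hψ_supp hψ_plus Tψ hTψ
        (Tφ f)).2
    have h1 : G Tψ * G Tφ = (∫ y, ψ y * θ y) * G Tφ := by
      rw [← hGmul _ hmem _ hTφ_mem, hprod, ← G.integral_comp_comm hint, ← integral_mul_const]
      refine integral_congr_ae (ae_of_all _ fun y => ?_)
      simp only [map_smul, smul_eq_mul]
      rcases le_or_gt 0 y with hy | hy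
      · rw [hθF y hy, mul_assoc]
      · rw [phi_neg ψ hψ_plus y hy]; simp
    rw [← hG Tψ hmem, mul_right_cancel₀ hφne h1, ← integral_Ici_eq_integral_Ioi,
      ← integral_indicator measurableSet_Ici]
    refine integral_congr_ae (ae_of_all _ fun y => ?_)
    simp only
    rcases le_or_gt 0 y with hy | hy
    · rw [indicator_of_mem (mem_Ici.2 hy), hlam y hy]
    · rw [indicator_of_notMem (by simpa using hy), phi_neg ψ hψ_plus y hy, zero_mul]
end
end
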